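/- For all L>0 and R>0, the infimum defining e_gs(L;R) is attained: there exists φ∈H¹_{mag,0}(S_R) with 𝓔_{L,R}(φ)=e_gs(L;R). -/

import Mathlib

open MeasureTheory Real Set Filter Topology

noncomputable section

/-- The open square `Q_r = (-r/2, r/2) × (-r/2, r/2)`. -/
def Qsq (r : ℝ) : Set (ℝ × ℝ) := Ioo (-r/2) (r/2) ×ˢ Ioo (-r/2) (r/2)

/-- The vertical strip `S_R = (-R/2, R/2) × ℝ`. -/
def Strip (R : ℝ) : Set (ℝ × ℝ) := Ioo (-R/2) (R/2) ×ˢ (univ : Set ℝ)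

/-- The magnetic potential `A₀(x) = (-x₂/2, x₁/2)` of the constant unit magnetic field. -/
def A₀ (x : ℝ × ℝ) : ℝ × ℝ := (-x.2 / 2, x.1 / 2)

/-- The magnetic potential `A_van(x) = (-x₂²/2, 0)` generating the field `B(x) = x₂`. -/
def Avan (x : ℝ × ℝ) : ℝ × ℝ := (-x.2 ^ 2 / 2, 0)

/-- The magnetic gradient energy density `|(∇ - iA)u|²` at `x`. -/
def magGradSq (A : ℝ × ℝ → ℝ × ℝ) (u : ℝ × ℝ → ℂ) (x : ℝ × ℝ) : ℝ :=
  ‖fderiv ℝ u x (1, 0) - Complex.I * ((A x).1 : ℂ) * u x‖ ^ 2 +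
  ‖fderiv ℝ u x (0, 1) - Complex.I * ((A x).2 : ℂ) * u x‖ ^ 2

/-- The Ginzburg–Landau functional `F_{b,Q_r}` on the square `Q_r`. -/
def Fsq (b r : ℝ) (u : ℝ × ℝ → ℂ) : ℝ :=
  ∫ x in Qsq r, (b * magGradSq A₀ u x - ‖u x‖ ^ 2 + ‖u x‖ ^ 4 / 2)

/-- (Smooth surrogate of) membership in `H¹(Q_r; ℂ)`. -/
def MemH1sq (u : ℝ × ℝ → ℂ) : Prop := ContDiff ℝ 1 u

/-- (Smooth surrogate of) membership in `H¹₀(Q_r; ℂ)`: vanishing on the boundary. -/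
def MemH10sq (r : ℝ) (u : ℝ × ℝ → ℂ) : Prop :=
  ContDiff ℝ 1 u ∧ ∀ x ∈ frontier (Qsq r), u x = 0

/-- The Dirichlet ground-state energy `e_D(b, r)`. -/
def eD (b r : ℝ) : ℝ := sInf (Fsq b r '' {u | MemH10sq r u})

/-- The Neumann ground-state energy `e_N(b, r)`. -/
def eN (b r : ℝ) : ℝ := sInf (Fsq b r '' {u | MemH1sq u})

/-- The energy density of the strip functional `𝓔_{L,R}` at `x`. -/
def stripDensity (L : ℝ) (u : ℝ × ℝ → ℂ) (x : ℝ × ℝ) : ℝ :=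
  magGradSq Avan u x - L ^ (-(2:ℝ)/3) * ‖u x‖ ^ 2 + (L ^ (-(2:ℝ)/3) / 2) * ‖u x‖ ^ 4

/-- The strip functional `𝓔_{L,R}`. -/
def Estrip (L R : ℝ) (u : ℝ × ℝ → ℂ) : ℝ := ∫ x in Strip R, stripDensity L u x

/-- (Surrogate of) membership in the space `H¹_{mag,0}(S_R)`. -/
def MemH1mag0 (R : ℝ) (u : ℝ × ℝ → ℂ) : Prop :=
  ContDiff ℝ 1 u ∧
  IntegrableOn (fun x => ‖u x‖ ^ 2) (Strip R) ∧
  IntegrableOn (magGradSq Avan u) (Strip R) ∧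
  IntegrableOn (fun x => ‖u x‖ ^ 4) (Strip R) ∧
  ∀ x ∈ frontier (Strip R), u x = 0

/-- The ground-state energy `e_gs(L; R)` of the strip functional. -/
def egs (L R : ℝ) : ℝ := sInf (Estrip L R '' {u | MemH1mag0 R u})

/-- `g : (0,∞) → ℝ` is the thermodynamic limit of the Dirichlet square energies. -/
def IsLimitG (g : ℝ → ℝ) : Prop :=
  ∀ b > 0, Tendsto (fun r => eD b r / r ^ 2) atTop (nhds (g b))

/-- `E : (0,∞) → ℝ` is the large-`R` limit of the strip energies. -/
def IsLimitE (E : ℝ → ℝ) : Prop :=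
  ∀ L > 0, Tendsto (fun R => egs L R / R) atTop (nhds (E L))


open MeasureTheory Real Set Filter Topology

noncomputable section

namespace SM

/-! ### One-dimensional Fourier facts -/

/-- frequencies -/
def fx (R : ℝ) (k : ℕ) : ℝ := (k + 1) * π / R
def fy (M : ℝ) (l : ℤ) : ℝ := l * π / M
def sC (R : ℝ) (k : ℕ) (x : ℝ) : ℂ := (Real.sin (fx R k * (x + R / 2)) : ℂ)
def cC (R : ℝ) (k : ℕ) (x : ℝ) : ℂ := (Real.cos (fx R k * (x + R / 2)) : ℂ)
def eC (M : ℝ) (l : ℤ) (y : ℝ) : ℂ := Complex.exp (Complex.I * ((fy M l * y : ℝ) : ℂ))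

lemma hasSum_of_eq {ι : Type*} {f g : ι → ℝ} {a b : ℝ} (h : HasSum f a) (hf : ∀ i, g i = f i)
    (ha : b = a) : HasSum g b := by
  rw [ha, show g = f from funext hf]; exact h

lemma ext_parseval {R : ℝ} (hR : 0 < R) {f : ℝ → ℂ} (hf : Continuous f) (e : ℂ) (he : ‖e‖ = 1) :
    HasSum (fun n : ℤ => ‖∫ x in (0:ℝ)..R, (Complex.exp (-(Complex.I * ((n * π / R * x : ℝ) : ℂ)))
      + e * Complex.exp (Complex.I * ((n * π / R * x : ℝ) : ℂ))) * f x‖ ^ 2)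
      (4 * R * ∫ x in (0:ℝ)..R, ‖f x‖ ^ 2) := by
  set F : ℝ → ℂ := fun x => if 0 < x then f x else e * f (-x) with hF
  have hab : -R < R := by linarith
  have hmeas : Measurable F := Measurable.ite measurableSet_Ioi hf.measurable (by fun_prop)
  obtain ⟨C, hC⟩ := (isCompact_Icc (a := -R) (b := R)).exists_bound_of_continuousOn hf.continuousOn
  have hbd : ∀ x ∈ Ioc (-R) R, ‖F x‖ ≤ C := by
    intro x hx
    simp only [hF]
    split_ifs with h
    · exact hC x ⟨hx.1.le, hx.2⟩
    · rw [norm_mul, he, one_mul]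
      exact hC _ ⟨by linarith [hx.2], by linarith [hx.1]⟩
  have hL2 : MemLp F 2 (volume.restrict (Ioc (-R) R)) := by
    apply MemLp.of_bound hmeas.aestronglyMeasurable C
    exact (ae_restrict_iff' measurableSet_Ioc).2 (Eventually.of_forall hbd)
  have key := hasSum_sq_fourierCoeffOn hab hL2
  have split : ∀ (G : ℝ → ℂ), Continuous G → ∫ x in (-R)..R, G x * F x
      = ∫ x in (0:ℝ)..R, (G x + e * G (-x)) * f x := by
    intro G hG
    have h1 : ∫ x in (0:ℝ)..R, G x * F x = ∫ x in (0:ℝ)..R, G x * f x := by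
      apply intervalIntegral.integral_congr_ae
      refine Eventually.of_forall fun x hx => ?_
      rw [uIoc_of_le hR.le] at hx
      simp [hF, hx.1]
    have h2 : ∫ x in (-R)..0, G x * F x = ∫ x in (-R)..0, G x * (e * f (-x)) := by
      apply intervalIntegral.integral_congr
      intro x hx
      rw [uIcc_of_le (by linarith)] at hx
      simp [hF, not_lt.2 hx.2]
    have h3 : ∫ x in (-R)..0, G x * (e * f (-x)) = ∫ x in (0:ℝ)..R, G (-x) * (e * f x) := by
      have := intervalIntegral.integral_comp_neg (a := 0) (b := R) (fun x => G x * (e * f (-x)))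
      simp only [neg_neg, neg_zero] at this
      exact this.symm
    have i1 : IntervalIntegrable (fun x => G x * F x) volume (-R) 0 := by
      rw [intervalIntegrable_iff, uIoc_of_le (by linarith)]
      have : IntegrableOn F (Ioc (-R) 0) := (hL2.mono_measure (Measure.restrict_mono
        (Ioc_subset_Ioc_right hR.le) le_rfl)).integrable (by norm_num)
      exact IntegrableOn.continuousOn_mul_of_subset hG.continuousOn this isCompact_Icc measurableSet_Ioc Ioc_subset_Icc_self
    have i2 : IntervalIntegrable (fun x => G x * F x) volume 0 R := by
      rw [intervalIntegrable_iff, uIoc_of_le (by linarith)]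
      have : IntegrableOn F (Ioc 0 R) := (hL2.mono_measure (Measure.restrict_mono
        (Ioc_subset_Ioc_left (by linarith)) le_rfl)).integrable (by norm_num)
      exact IntegrableOn.continuousOn_mul_of_subset hG.continuousOn this isCompact_Icc measurableSet_Ioc Ioc_subset_Icc_self
    rw [← intervalIntegral.integral_add_adjacent_intervals i1 i2, h1, h2, h3,
      ← intervalIntegral.integral_add]
    · congr 1; ext x; ring
    · exact Continuous.intervalIntegrable (by fun_prop) _ _
    · exact Continuous.intervalIntegrable (by fun_prop) _ _
  have nsq : ∫ x in (-R)..R, ‖F x‖ ^ 2 = 2 * ∫ x in (0:ℝ)..R, ‖f x‖ ^ 2 := by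
    have h1 : ∫ x in (0:ℝ)..R, ‖F x‖ ^ 2 = ∫ x in (0:ℝ)..R, ‖f x‖ ^ 2 := by
      apply intervalIntegral.integral_congr_ae
      refine Eventually.of_forall fun x hx => ?_
      rw [uIoc_of_le hR.le] at hx
      simp [hF, hx.1]
    have h2 : ∫ x in (-R)..0, ‖F x‖ ^ 2 = ∫ x in (-R)..0, ‖f (-x)‖ ^ 2 := by
      apply intervalIntegral.integral_congr
      intro x hx
      rw [uIcc_of_le (by linarith)] at hx
      simp [hF, not_lt.2 hx.2, he]
    have h3 : ∫ x in (-R)..0, ‖f (-x)‖ ^ 2 = ∫ x in (0:ℝ)..R, ‖f x‖ ^ 2 := by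
      have := intervalIntegral.integral_comp_neg (a := 0) (b := R) (fun x => ‖f (-x)‖ ^ 2)
      simp only [neg_neg, neg_zero] at this
      exact this.symm
    have hi : IntegrableOn (fun x => ‖F x‖ ^ 2) (Ioc (-R) R) := by
      have := hL2.integrable_norm_pow (by norm_num)
      simp only [ENNReal.toReal_ofNat] at this
      exact_mod_cast this
    have i1 : IntervalIntegrable (fun x => ‖F x‖ ^ 2) volume (-R) 0 := by
      rw [intervalIntegrable_iff, uIoc_of_le (by linarith)]
      exact hi.mono_set (Ioc_subset_Ioc_right hR.le)
    have i2 : IntervalIntegrable (fun x => ‖F x‖ ^ 2) volume 0 R := by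
      rw [intervalIntegrable_iff, uIoc_of_le (by linarith)]
      exact hi.mono_set (Ioc_subset_Ioc_left (by linarith))
    rw [← intervalIntegral.integral_add_adjacent_intervals i1 i2, h1, h2, h3]
    ring
  have coef : ∀ n : ℤ, fourierCoeffOn hab F n = ((1 / (2 * R) : ℝ) : ℂ) *
      ∫ x in (0:ℝ)..R, (Complex.exp (-(Complex.I * ((n * π / R * x : ℝ) : ℂ)))
      + e * Complex.exp (Complex.I * ((n * π / R * x : ℝ) : ℂ))) * f x := by
    intro n
    rw [fourierCoeffOn_eq_integral]
    have : ∀ x : ℝ, fourier (-n) (x : AddCircle (R - -R)) • F x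
       = Complex.exp (-(Complex.I * ((n * π / R * x : ℝ) : ℂ))) * F x := by
      intro x
      rw [fourier_coe_apply, smul_eq_mul]
      congr 2
      push_cast
      have : (R : ℂ) ≠ 0 := by exact_mod_cast hR.ne'
      field_simp
      ring
    simp_rw [this]
    rw [split _ (by fun_prop)]
    rw [show R - -R = 2 * R by ring, Complex.real_smul]
    simp
  simp_rw [coef, nsq, norm_mul, mul_pow] at key
  have k2 := key.mul_left (4 * R ^ 2)
  refine hasSum_of_eq k2 (fun n => ?_) ?_
  · rw [Complex.norm_real, Real.norm_of_nonneg (by positivity)]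
    field_simp
    ring
  · rw [smul_eq_mul]
    field_simp
    try ring

lemma shift_int {R : ℝ} (g : ℝ → ℂ) :
    ∫ x in (-R/2)..(R/2), g x = ∫ x in (0:ℝ)..R, g (x - R / 2) := by
  rw [intervalIntegral.integral_comp_sub_right]
  congr 1 <;> ring

lemma shift_intr {R : ℝ} (g : ℝ → ℝ) :
    ∫ x in (-R/2)..(R/2), g x = ∫ x in (0:ℝ)..R, g (x - R / 2) := by
  rw [intervalIntegral.integral_comp_sub_right]
  congr 1 <;> ring

lemma sin_parseval {R : ℝ} (hR : 0 < R) {f : ℝ → ℂ} (hf : Continuous f) :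
    HasSum (fun k : ℕ => ‖∫ x in (-R/2)..(R/2), f x * sC R k x‖ ^ 2)
      (R / 2 * ∫ x in (-R/2)..(R/2), ‖f x‖ ^ 2) := by
  have h := ext_parseval hR (f := fun x => f (x - R / 2)) (by fun_prop) (-1) (by simp)
  have h2 := h.nat_add_neg
  have h3 := (hasSum_nat_add_iff' 1).2 h2
  simp only [shift_int, shift_intr (fun x => ‖f x‖ ^ 2)]
  have h4 := h3.mul_left (1 / 8)
  have e1 : ∀ n : ℤ, ‖∫ x in (0:ℝ)..R, (Complex.exp (-(Complex.I * ((n * π / R * x : ℝ) : ℂ)))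
      + -1 * Complex.exp (Complex.I * ((n * π / R * x : ℝ) : ℂ))) * f (x - R / 2)‖ ^ 2 =
      4 * ‖∫ x in (0:ℝ)..R, f (x - R / 2) * (Real.sin (n * π / R * x) : ℂ)‖ ^ 2 := by
    intro n
    have : ∀ x : ℝ, (Complex.exp (-(Complex.I * ((n * π / R * x : ℝ) : ℂ)))
      + -1 * Complex.exp (Complex.I * ((n * π / R * x : ℝ) : ℂ))) * f (x - R / 2)
      = (-2 * Complex.I) * (f (x - R / 2) * (Real.sin (n * π / R * x) : ℂ)) := by
      intro x
      rw [Complex.ofReal_sin, Complex.sin]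
      rw [mul_comm Complex.I]
      ring_nf
      rw [Complex.I_sq]
      ring
    simp_rw [this]
    rw [intervalIntegral.integral_const_mul, norm_mul, mul_pow]
    norm_num
  simp only [e1] at h4
  refine hasSum_of_eq h4 (fun k => ?_) ?_
  · have : ∀ x : ℝ, ((-((k + 1 : ℕ) : ℤ) : ℤ) : ℝ) * π / R * x = - (((k + 1 : ℕ) : ℤ) * π / R * x) := by
      intro x; push_cast; ring
    simp_rw [this, Real.sin_neg, Complex.ofReal_neg, mul_neg]
    rw [intervalIntegral.integral_neg, norm_neg]
    have : ∀ x : ℝ, sC R k (x - R / 2) = (Real.sin ((((k + 1 : ℕ) : ℤ):ℝ) * π / R * x) : ℂ) := by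
      intro x
      simp [sC, fx]
    simp_rw [this]
    ring
  · simp
    ring

lemma cos_bessel {R : ℝ} (hR : 0 < R) {f : ℝ → ℂ} (hf : Continuous f) (F : Finset ℕ) :
    ∑ k ∈ F, ‖∫ x in (-R/2)..(R/2), f x * cC R k x‖ ^ 2 ≤ R * ∫ x in (-R/2)..(R/2), ‖f x‖ ^ 2 := by
  have h := ext_parseval hR (f := fun x => f (x - R / 2)) (by fun_prop) 1 (by simp)
  simp only [shift_int, shift_intr (fun x => ‖f x‖ ^ 2)]
  have e1 : ∀ n : ℤ, ‖∫ x in (0:ℝ)..R, (Complex.exp (-(Complex.I * ((n * π / R * x : ℝ) : ℂ)))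
      + 1 * Complex.exp (Complex.I * ((n * π / R * x : ℝ) : ℂ))) * f (x - R / 2)‖ ^ 2 =
      4 * ‖∫ x in (0:ℝ)..R, f (x - R / 2) * (Real.cos (n * π / R * x) : ℂ)‖ ^ 2 := by
    intro n
    have : ∀ x : ℝ, (Complex.exp (-(Complex.I * ((n * π / R * x : ℝ) : ℂ)))
      + 1 * Complex.exp (Complex.I * ((n * π / R * x : ℝ) : ℂ))) * f (x - R / 2)
      = 2 * (f (x - R / 2) * (Real.cos (n * π / R * x) : ℂ)) := by
      intro x
      rw [Complex.ofReal_cos, Complex.cos]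
      rw [mul_comm Complex.I]
      ring_nf
    simp_rw [this]
    rw [intervalIntegral.integral_const_mul, norm_mul, mul_pow]
    norm_num
  simp only [e1] at h
  have h2 := sum_le_hasSum (F.map ⟨fun k : ℕ => ((k + 1 : ℕ) : ℤ), fun a b hab => by simpa using hab⟩)
    (fun i _ => by positivity) h
  rw [Finset.sum_map, ← Finset.mul_sum] at h2
  have h3 : ∀ k : ℕ, ∀ x : ℝ, cC R k (x - R / 2) = (Real.cos ((((k + 1 : ℕ) : ℤ):ℝ) * π / R * x) : ℂ) := by
    intro k x
    simp [cC, fx]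
  simp only [h3]
  exact le_of_mul_le_mul_left (h2.trans_eq (by ring)) (by norm_num : (0:ℝ) < 4)

lemma exp_parseval {M : ℝ} (hM : 0 < M) {f : ℝ → ℂ} (hf : Continuous f) :
    HasSum (fun l : ℤ => ‖∫ y in (-M)..M, f y * eC M (-l) y‖ ^ 2)
      (2 * M * ∫ y in (-M)..M, ‖f y‖ ^ 2) := by
  have hab : -M < M := by linarith
  have hL2 : MemLp f 2 (volume.restrict (Ioc (-M) M)) := by
    obtain ⟨C, hC⟩ := (isCompact_Icc (a := -M) (b := M)).exists_bound_of_continuousOn hf.continuousOn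
    apply MemLp.of_bound hf.aestronglyMeasurable C
    exact (ae_restrict_iff' measurableSet_Ioc).2 (Eventually.of_forall fun x hx => hC x ⟨hx.1.le, hx.2⟩)
  have key := hasSum_sq_fourierCoeffOn hab hL2
  have coef : ∀ n : ℤ, fourierCoeffOn hab f n = ((1 / (2 * M) : ℝ) : ℂ) *
      ∫ y in (-M)..M, f y * eC M (-n) y := by
    intro n
    rw [fourierCoeffOn_eq_integral]
    have : ∀ x : ℝ, fourier (-n) (x : AddCircle (M - -M)) • f x
       = f x * eC M (-n) x := by
      intro x
      rw [fourier_coe_apply, smul_eq_mul, mul_comm, eC, fy]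
      congr 2
      push_cast
      have : (M : ℂ) ≠ 0 := by exact_mod_cast hM.ne'
      field_simp
      ring
    simp_rw [this]
    rw [show M - -M = 2 * M by ring, Complex.real_smul]
  simp_rw [coef, norm_mul, mul_pow] at key
  have k2 := key.mul_left (4 * M ^ 2)
  refine hasSum_of_eq k2 (fun n => ?_) ?_
  · rw [Complex.norm_real, Real.norm_of_nonneg (by positivity)]
    field_simp
    ring
  · rw [smul_eq_mul]
    field_simp
    try ring

end SM
end

open MeasureTheory Real Set Filter Topology

noncomputable section

namespace SM

/-! ### Partial derivatives -/

def dx (f : ℝ × ℝ → ℂ) (p : ℝ × ℝ) : ℂ := fderiv ℝ f p (1, 0)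
def dy (f : ℝ × ℝ → ℂ) (p : ℝ × ℝ) : ℂ := fderiv ℝ f p (0, 1)

lemma dx_cont {f : ℝ × ℝ → ℂ} (hf : ContDiff ℝ 1 f) : Continuous (dx f) :=
  (hf.continuous_fderiv (by norm_num)).clm_apply continuous_const
lemma dy_cont {f : ℝ × ℝ → ℂ} (hf : ContDiff ℝ 1 f) : Continuous (dy f) :=
  (hf.continuous_fderiv (by norm_num)).clm_apply continuous_const

lemma c1d {f : ℝ × ℝ → ℂ} (hf : ContDiff ℝ 1 f) (p : ℝ × ℝ) : DifferentiableAt ℝ f p :=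
  (hf.differentiable (by norm_num)) p

lemma dx_contDiff {f : ℝ × ℝ → ℂ} {n : ℕ} (hf : ContDiff ℝ (n + 1) f) : ContDiff ℝ n (dx f) :=
  (hf.fderiv_right (m := n) le_rfl).clm_apply contDiff_const
lemma dy_contDiff {f : ℝ × ℝ → ℂ} {n : ℕ} (hf : ContDiff ℝ (n + 1) f) : ContDiff ℝ n (dy f) :=
  (hf.fderiv_right (m := n) le_rfl).clm_apply contDiff_const

lemma hasDerivAt_dx {f : ℝ × ℝ → ℂ} (hf : ContDiff ℝ 1 f) (x y : ℝ) :
    HasDerivAt (fun t => f (t, y)) (dx f (x, y)) x := by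
  have h1 := (c1d hf (x, y)).hasFDerivAt
  have h2 : HasDerivAt (fun t : ℝ => (t, y)) ((1 : ℝ), (0 : ℝ)) x :=
    (hasDerivAt_id x).prodMk (hasDerivAt_const x y)
  exact h1.comp_hasDerivAt x h2

lemma hasDerivAt_dy {f : ℝ × ℝ → ℂ} (hf : ContDiff ℝ 1 f) (x y : ℝ) :
    HasDerivAt (fun t => f (x, t)) (dy f (x, y)) y := by
  have h1 := (c1d hf (x, y)).hasFDerivAt
  have h2 : HasDerivAt (fun t : ℝ => (x, t)) ((0 : ℝ), (1 : ℝ)) y :=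
    (hasDerivAt_const y x).prodMk (hasDerivAt_id y)
  exact h1.comp_hasDerivAt y h2

lemma dx_mul {f g : ℝ × ℝ → ℂ} {p : ℝ × ℝ} (hf : DifferentiableAt ℝ f p)
    (hg : DifferentiableAt ℝ g p) :
    dx (fun q => f q * g q) p = dx f p * g p + f p * dx g p := by
  unfold dx; rw [fderiv_fun_mul hf hg]; simp; ring
lemma dy_mul {f g : ℝ × ℝ → ℂ} {p : ℝ × ℝ} (hf : DifferentiableAt ℝ f p)
    (hg : DifferentiableAt ℝ g p) :
    dy (fun q => f q * g q) p = dy f p * g p + f p * dy g p := by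
  unfold dy; rw [fderiv_fun_mul hf hg]; simp; ring
lemma dx_add {f g : ℝ × ℝ → ℂ} {p : ℝ × ℝ} (hf : DifferentiableAt ℝ f p)
    (hg : DifferentiableAt ℝ g p) : dx (fun q => f q + g q) p = dx f p + dx g p := by
  unfold dx; rw [fderiv_fun_add hf hg]; simp
lemma dy_add {f g : ℝ × ℝ → ℂ} {p : ℝ × ℝ} (hf : DifferentiableAt ℝ f p)
    (hg : DifferentiableAt ℝ g p) : dy (fun q => f q + g q) p = dy f p + dy g p := by
  unfold dy; rw [fderiv_fun_add hf hg]; simp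
lemma dx_sub {f g : ℝ × ℝ → ℂ} {p : ℝ × ℝ} (hf : DifferentiableAt ℝ f p)
    (hg : DifferentiableAt ℝ g p) : dx (fun q => f q - g q) p = dx f p - dx g p := by
  unfold dx; rw [fderiv_fun_sub hf hg]; simp
lemma dy_sub {f g : ℝ × ℝ → ℂ} {p : ℝ × ℝ} (hf : DifferentiableAt ℝ f p)
    (hg : DifferentiableAt ℝ g p) : dy (fun q => f q - g q) p = dy f p - dy g p := by
  unfold dy; rw [fderiv_fun_sub hf hg]; simp
lemma dx_sum {ι : Type*} (F : Finset ι) {f : ι → ℝ × ℝ → ℂ} {p : ℝ × ℝ}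
    (hf : ∀ i ∈ F, DifferentiableAt ℝ (f i) p) :
    dx (fun q => ∑ i ∈ F, f i q) p = ∑ i ∈ F, dx (f i) p := by
  unfold dx; rw [fderiv_fun_sum hf]; simp
lemma dy_sum {ι : Type*} (F : Finset ι) {f : ι → ℝ × ℝ → ℂ} {p : ℝ × ℝ}
    (hf : ∀ i ∈ F, DifferentiableAt ℝ (f i) p) :
    dy (fun q => ∑ i ∈ F, f i q) p = ∑ i ∈ F, dy (f i) p := by
  unfold dy; rw [fderiv_fun_sum hf]; simp
lemma dx_conj (f : ℝ × ℝ → ℂ) (p : ℝ × ℝ) :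
    dx (fun q => (starRingEnd ℂ) (f q)) p = (starRingEnd ℂ) (dx f p) := by
  unfold dx
  have := (Complex.conjCLE : ℂ ≃L[ℝ] ℂ).comp_fderiv (f := f) (x := p)
  have h2 : (Complex.conjCLE : ℂ ≃L[ℝ] ℂ) ∘ f = fun q => (starRingEnd ℂ) (f q) := by ext; simp
  rw [h2] at this
  rw [this]; simp
lemma dy_conj (f : ℝ × ℝ → ℂ) (p : ℝ × ℝ) :
    dy (fun q => (starRingEnd ℂ) (f q)) p = (starRingEnd ℂ) (dy f p) := by
  unfold dy
  have := (Complex.conjCLE : ℂ ≃L[ℝ] ℂ).comp_fderiv (f := f) (x := p)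
  have h2 : (Complex.conjCLE : ℂ ≃L[ℝ] ℂ) ∘ f = fun q => (starRingEnd ℂ) (f q) := by ext; simp
  rw [h2] at this
  rw [this]; simp
lemma conj_c1 {n : WithTop ℕ∞} {f : ℝ × ℝ → ℂ} (hf : ContDiff ℝ n f) :
    ContDiff ℝ n (fun q => (starRingEnd ℂ) (f q)) :=
  (Complex.conjCLE : ℂ ≃L[ℝ] ℂ).contDiff.comp hf

lemma dx_fst {g : ℝ → ℂ} {g' : ℂ} {p : ℝ × ℝ} (hg : HasDerivAt g g' p.1) :
    dx (fun q => g q.1) p = g' := by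
  have := hg.hasFDerivAt.comp p (hasFDerivAt_fst (𝕜 := ℝ) (p := p))
  unfold dx
  rw [show (fun q : ℝ × ℝ => g q.1) = g ∘ Prod.fst from rfl, this.fderiv]; simp
lemma dy_fst {g : ℝ → ℂ} {g' : ℂ} {p : ℝ × ℝ} (hg : HasDerivAt g g' p.1) :
    dy (fun q => g q.1) p = 0 := by
  have := hg.hasFDerivAt.comp p (hasFDerivAt_fst (𝕜 := ℝ) (p := p))
  unfold dy
  rw [show (fun q : ℝ × ℝ => g q.1) = g ∘ Prod.fst from rfl, this.fderiv]; simp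
lemma dx_snd {g : ℝ → ℂ} {g' : ℂ} {p : ℝ × ℝ} (hg : HasDerivAt g g' p.2) :
    dx (fun q => g q.2) p = 0 := by
  have := hg.hasFDerivAt.comp p (hasFDerivAt_snd (𝕜 := ℝ) (p := p))
  unfold dx
  rw [show (fun q : ℝ × ℝ => g q.2) = g ∘ Prod.snd from rfl, this.fderiv]; simp
lemma dy_snd {g : ℝ → ℂ} {g' : ℂ} {p : ℝ × ℝ} (hg : HasDerivAt g g' p.2) :
    dy (fun q => g q.2) p = g' := by
  have := hg.hasFDerivAt.comp p (hasFDerivAt_snd (𝕜 := ℝ) (p := p))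
  unfold dy
  rw [show (fun q : ℝ × ℝ => g q.2) = g ∘ Prod.snd from rfl, this.fderiv]; simp

/-! ### Measure and compact support in `y` -/

def mu (R : ℝ) : Measure (ℝ × ℝ) := volume.restrict (Strip R)

def CptY {E : Type*} [Zero E] (f : ℝ × ℝ → E) : Prop := ∃ M : ℝ, ∀ p : ℝ × ℝ, M < |p.2| → f p = 0

lemma mu_eq (R : ℝ) : mu R = (volume.restrict (Ioo (-R/2) (R/2))).prod volume := by
  unfold mu Strip
  rw [Measure.volume_eq_prod, ← Measure.prod_restrict, Measure.restrict_univ]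

lemma CptY.dx {f : ℝ × ℝ → ℂ} (h : CptY f) : CptY (dx f) := by
  obtain ⟨M, hM⟩ := h
  refine ⟨M, fun p hp => ?_⟩
  have : f =ᶠ[𝓝 p] fun _ => 0 := by
    have : IsOpen {q : ℝ × ℝ | M < |q.2|} := isOpen_lt continuous_const (by fun_prop)
    filter_upwards [this.mem_nhds hp] with q hq using hM q hq
  unfold SM.dx; rw [this.fderiv_eq]; simp
lemma CptY.dy {f : ℝ × ℝ → ℂ} (h : CptY f) : CptY (dy f) := by
  obtain ⟨M, hM⟩ := h
  refine ⟨M, fun p hp => ?_⟩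
  have : f =ᶠ[𝓝 p] fun _ => 0 := by
    have : IsOpen {q : ℝ × ℝ | M < |q.2|} := isOpen_lt continuous_const (by fun_prop)
    filter_upwards [this.mem_nhds hp] with q hq using hM q hq
  unfold SM.dy; rw [this.fderiv_eq]; simp

lemma CptY.integrable {E : Type*} [NormedAddCommGroup E] [NormedSpace ℝ E] {R : ℝ}
    {f : ℝ × ℝ → E} (h : CptY f) (hf : Continuous f) : Integrable f (mu R) := by
  obtain ⟨M, hM⟩ := h
  have hK : IsCompact (Icc (-R/2) (R/2) ×ˢ Icc (-M) M) := isCompact_Icc.prod isCompact_Icc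
  have h1 : IntegrableOn f (Icc (-R/2) (R/2) ×ˢ Icc (-M) M) (mu R) := by
    have := hf.continuousOn.integrableOn_compact (μ := (volume : Measure (ℝ × ℝ))) hK
    exact Integrable.mono_measure this (Measure.restrict_mono le_rfl Measure.restrict_le_self)
  have h2 : f =ᵐ[mu R] (Icc (-R/2) (R/2) ×ˢ Icc (-M) M).indicator f := by
    have : ∀ᵐ p ∂(mu R), p ∈ Strip R := by
      apply ae_restrict_mem
      exact measurableSet_Ioo.prod MeasurableSet.univ
    filter_upwards [this] with p hp
    by_cases hy : |p.2| ≤ M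
    · rw [indicator_of_mem]
      exact ⟨⟨hp.1.1.le, hp.1.2.le⟩, abs_le.1 hy⟩
    · rw [hM p (not_le.1 hy), indicator]; split_ifs <;> simp [hM p (not_le.1 hy)]
  rw [integrable_congr h2]
  exact h1.integrable_indicator (measurableSet_Icc.prod measurableSet_Icc)

/-- iterated integral over a box -/
def ibox {E : Type*} [NormedAddCommGroup E] [NormedSpace ℝ E] (R M : ℝ) (f : ℝ × ℝ → E) : E :=
  ∫ y in (-M)..M, ∫ x in (-R/2)..(R/2), f (x, y)

lemma inner_cont {E : Type*} [NormedAddCommGroup E] [NormedSpace ℝ E] {R : ℝ}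
    {f : ℝ × ℝ → E} (hf : Continuous f) :
    Continuous (fun y => ∫ x in (-R/2)..(R/2), f (x, y)) := by
  apply intervalIntegral.continuous_parametric_intervalIntegral_of_continuous'
  show Continuous fun q : ℝ × ℝ => f (q.2, q.1)
  fun_prop

lemma int_inner {E : Type*} [NormedAddCommGroup E] [NormedSpace ℝ E] {R : ℝ} (hR : 0 < R)
    {f : ℝ × ℝ → E} (hf : Integrable f (mu R)) :
    ∫ p, f p ∂(mu R) = ∫ y, ∫ x in (-R/2)..(R/2), f (x, y) := by
  rw [mu_eq] at hf ⊢
  rw [integral_prod_symm _ hf]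
  congr 1; ext y
  rw [intervalIntegral.integral_of_le (by linarith), integral_Ioc_eq_integral_Ioo]

lemma int_eq_ibox {E : Type*} [NormedAddCommGroup E] [NormedSpace ℝ E] {R M : ℝ} (hR : 0 < R)
    (hM : 0 < M) {f : ℝ × ℝ → E} (hf : Continuous f) (h0 : ∀ p : ℝ × ℝ, M ≤ |p.2| → f p = 0) :
    ∫ p, f p ∂(mu R) = ibox R M f := by
  rw [int_inner hR (CptY.integrable ⟨M, fun p hp => h0 p hp.le⟩ hf), ibox,
    intervalIntegral.integral_of_le (by linarith)]
  symm
  apply setIntegral_eq_integral_of_forall_compl_eq_zero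
  intro y hy
  have : M ≤ |y| := by
    by_contra h
    rw [not_le, abs_lt] at h
    exact hy ⟨h.1, h.2.le⟩
  have h1 : ∀ x : ℝ, f (x, y) = 0 := fun x => h0 (x, y) this
  simp [h1]

lemma ibox_mono {R M : ℝ} (hR : 0 < R) (hM : 0 < M) {f g : ℝ × ℝ → ℝ} (hf : Continuous f)
    (hg : Continuous g) (h : ∀ p ∈ Icc (-R/2) (R/2) ×ˢ Icc (-M) M, f p ≤ g p) :
    ibox R M f ≤ ibox R M g := by
  unfold ibox
  apply intervalIntegral.integral_mono_on (by linarith)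
    ((inner_cont hf).intervalIntegrable _ _) ((inner_cont hg).intervalIntegrable _ _)
  intro y hy
  apply intervalIntegral.integral_mono_on (by linarith)
  · exact Continuous.intervalIntegrable (by fun_prop) _ _
  · exact Continuous.intervalIntegrable (by fun_prop) _ _
  · intro x hx
    exact h (x, y) ⟨hx, hy⟩

/-- the box as a measure -/
lemma ibox_eq {E : Type*} [NormedAddCommGroup E] [NormedSpace ℝ E] {R M : ℝ} (hR : 0 < R)
    (hM : 0 < M) {f : ℝ × ℝ → E} (hf : Continuous f) :
    ibox R M f = ∫ p in Ioo (-R/2) (R/2) ×ˢ Ioo (-M) M, f p := by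
  have hi : IntegrableOn f (Ioo (-R/2) (R/2) ×ˢ Ioo (-M) M) :=
    (hf.continuousOn.integrableOn_compact (isCompact_Icc.prod isCompact_Icc)).mono_set
      (prod_mono Ioo_subset_Icc_self Ioo_subset_Icc_self)
  rw [IntegrableOn, Measure.volume_eq_prod, ← Measure.prod_restrict] at hi
  rw [Measure.volume_eq_prod, ← Measure.prod_restrict, integral_prod_symm _ hi, ibox,
    intervalIntegral.integral_of_le (by linarith), integral_Ioc_eq_integral_Ioo]
  congr 1; ext y
  rw [intervalIntegral.integral_of_le (by linarith), integral_Ioc_eq_integral_Ioo]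

lemma int_dx_zero {R : ℝ} (hR : 0 < R) {F : ℝ × ℝ → ℂ} (hF : ContDiff ℝ 1 F) (hc : CptY F)
    (hb : ∀ y, F (-R/2, y) = 0 ∧ F (R/2, y) = 0) : ∫ p, dx F p ∂(mu R) = 0 := by
  rw [int_inner hR (hc.dx.integrable (dx_cont hF))]
  have : ∀ y, ∫ x in (-R/2)..(R/2), dx F (x, y) = 0 := by
    intro y
    rw [intervalIntegral.integral_eq_sub_of_hasDerivAt (f := fun t => F (t, y))
      (fun x _ => hasDerivAt_dx hF x y)]
    · rw [(hb y).1, (hb y).2]; simp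
    · have := dx_cont hF
      exact Continuous.intervalIntegrable (by fun_prop) _ _
  simp [this]

lemma int_dy_zero {R : ℝ} {F : ℝ × ℝ → ℂ} (hF : ContDiff ℝ 1 F) (hc : CptY F) :
    ∫ p, dy F p ∂(mu R) = 0 := by
  have hi : Integrable (dy F) (mu R) := hc.dy.integrable (dy_cont hF)
  rw [mu_eq] at hi ⊢
  rw [integral_prod _ hi]
  have hcs : ∀ (g : ℝ × ℝ → ℂ), CptY g → Continuous g → ∀ x, Integrable (fun y => g (x, y)) := by
    intro g hg hgc x
    obtain ⟨M, hM⟩ := hg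
    apply Continuous.integrable_of_hasCompactSupport (by fun_prop)
    apply HasCompactSupport.intro (isCompact_Icc (a := -M) (b := M))
    intro y hy
    apply hM
    by_contra h
    exact hy (abs_le.1 (not_lt.1 h))
  have : ∀ x, ∫ y, dy F (x, y) = 0 := fun x =>
    integral_eq_zero_of_hasDerivAt_of_integrable (fun y => hasDerivAt_dy hF x y)
      (hcs _ hc.dy (dy_cont hF) x) (hcs _ hc hF.continuous x)
  simp [this]

lemma CptY.mul_left {f g : ℝ × ℝ → ℂ} (hf : CptY f) : CptY (fun p => f p * g p) := by
  obtain ⟨M, h⟩ := hf; exact ⟨M, fun p hp => by simp [h p hp]⟩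
lemma CptY.mul_right {f g : ℝ × ℝ → ℂ} (hg : CptY g) : CptY (fun p => f p * g p) := by
  obtain ⟨M, h⟩ := hg; exact ⟨M, fun p hp => by simp [h p hp]⟩

lemma ibp_x {R : ℝ} (hR : 0 < R) {f g : ℝ × ℝ → ℂ} (hf : ContDiff ℝ 1 f) (hg : ContDiff ℝ 1 g)
    (hc : CptY g) (hb : ∀ y, f (-R/2, y) = 0 ∧ f (R/2, y) = 0) :
    ∫ p, dx f p * g p ∂(mu R) = - ∫ p, f p * dx g p ∂(mu R) := by
  have h := int_dx_zero hR (hf.mul hg) hc.mul_right (fun y => by simp [hb y])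
  have e : ∀ p, dx (fun q => f q * g q) p = dx f p * g p + f p * dx g p := fun p =>
    dx_mul (c1d hf p) (c1d hg p)
  simp_rw [e] at h
  rw [integral_add] at h
  · exact eq_neg_of_add_eq_zero_left h
  · exact hc.mul_right.integrable ((dx_cont hf).mul hg.continuous)
  · exact hc.dx.mul_right.integrable (hf.continuous.mul (dx_cont hg))

lemma ibp_y {R : ℝ} {f g : ℝ × ℝ → ℂ} (hf : ContDiff ℝ 1 f) (hg : ContDiff ℝ 1 g)
    (hc : CptY g) :
    ∫ p, dy f p * g p ∂(mu R) = - ∫ p, f p * dy g p ∂(mu R) := by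
  have h := int_dy_zero (R := R) (hf.mul hg) hc.mul_right
  have e : ∀ p, dy (fun q => f q * g q) p = dy f p * g p + f p * dy g p := fun p =>
    dy_mul (c1d hf p) (c1d hg p)
  simp_rw [e] at h
  rw [integral_add] at h
  · exact eq_neg_of_add_eq_zero_left h
  · exact hc.mul_right.integrable ((dy_cont hf).mul hg.continuous)
  · exact hc.dy.mul_right.integrable (hf.continuous.mul (dy_cont hg))

end SM
end

open MeasureTheory Real Set Filter Topology

noncomputable section

namespace SM

/-! ### Two-dimensional Fourier series on the box -/

lemma sC_cont (R : ℝ) (k : ℕ) : Continuous (sC R k) := by unfold sC; fun_prop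
lemma cC_cont (R : ℝ) (k : ℕ) : Continuous (cC R k) := by unfold cC; fun_prop
lemma eC_cont (M : ℝ) (l : ℤ) : Continuous (eC M l) := by unfold eC; fun_prop

def EE (R M : ℝ) (i : ℕ × ℤ) (p : ℝ × ℝ) : ℂ := sC R i.1 p.1 * eC M i.2 p.2
def EB (R M : ℝ) (i : ℕ × ℤ) (p : ℝ × ℝ) : ℂ := sC R i.1 p.1 * eC M (-i.2) p.2
def CB (R M : ℝ) (i : ℕ × ℤ) (p : ℝ × ℝ) : ℂ := cC R i.1 p.1 * eC M (-i.2) p.2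
def lam (R M : ℝ) (i : ℕ × ℤ) : ℝ := fx R i.1 ^ 2 + fy M i.2 ^ 2

def cf (R M : ℝ) (f : ℝ × ℝ → ℂ) (i : ℕ × ℤ) : ℂ := ibox R M (fun p => f p * EB R M i p)

lemma EE_cont (R M : ℝ) (i) : Continuous (EE R M i) := by
  unfold EE; have := sC_cont R i.1; have := eC_cont M i.2; fun_prop
lemma EB_cont (R M : ℝ) (i) : Continuous (EB R M i) := by
  unfold EB; have := sC_cont R i.1; have := eC_cont M (-i.2); fun_prop
lemma CB_cont (R M : ℝ) (i) : Continuous (CB R M i) := by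
  unfold CB; have := cC_cont R i.1; have := eC_cont M (-i.2); fun_prop

lemma bessel_gen {R M : ℝ} (hR : 0 < R) (hM : 0 < M) (b : ℕ → ℝ → ℂ) (hb : ∀ k, Continuous (b k))
    (C : ℝ) (hB : ∀ (f : ℝ → ℂ), Continuous f → ∀ F : Finset ℕ,
      ∑ k ∈ F, ‖∫ x in (-R/2)..(R/2), f x * b k x‖ ^ 2 ≤ C * ∫ x in (-R/2)..(R/2), ‖f x‖ ^ 2)
    {f : ℝ × ℝ → ℂ} (hf : Continuous f) (F : Finset (ℕ × ℤ)) :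
    ∑ i ∈ F, ‖ibox R M (fun p => f p * (b i.1 p.1 * eC M (-i.2) p.2))‖ ^ 2
      ≤ C * (2 * M) * ibox R M (fun p => ‖f p‖ ^ 2) := by
  classical
  set g : ℕ → ℝ → ℂ := fun k y => ∫ x in (-R/2)..(R/2), f (x, y) * b k x with hg
  have hgc : ∀ k, Continuous (g k) := fun k =>
    inner_cont (f := fun p : ℝ × ℝ => f p * b k p.1) (by have := hb k; fun_prop)
  have e : ∀ i : ℕ × ℤ, ibox R M (fun p => f p * (b i.1 p.1 * eC M (-i.2) p.2))
      = ∫ y in (-M)..M, g i.1 y * eC M (-i.2) y := by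
    intro i
    unfold ibox
    congr 1; ext y
    simp only [hg]
    rw [← intervalIntegral.integral_mul_const]
    congr 1; ext x; ring
  simp_rw [e]
  calc _ ≤ ∑ i ∈ F.image Prod.fst ×ˢ F.image Prod.snd, ‖∫ y in (-M)..M, g i.1 y * eC M (-i.2) y‖ ^ 2 := by
        apply Finset.sum_le_sum_of_subset_of_nonneg
        · intro i hi
          simp only [Finset.mem_product, Finset.mem_image]
          exact ⟨⟨i, hi, rfl⟩, ⟨i, hi, rfl⟩⟩
        · intros; positivity
    _ = ∑ k ∈ F.image Prod.fst, ∑ l ∈ F.image Prod.snd, ‖∫ y in (-M)..M, g k y * eC M (-l) y‖ ^ 2 := by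
        rw [Finset.sum_product]
    _ ≤ ∑ k ∈ F.image Prod.fst, 2 * M * ∫ y in (-M)..M, ‖g k y‖ ^ 2 := by
        apply Finset.sum_le_sum
        intro k _
        exact sum_le_hasSum _ (fun _ _ => by positivity) (exp_parseval hM (hgc k))
    _ = 2 * M * ∫ y in (-M)..M, ∑ k ∈ F.image Prod.fst, ‖g k y‖ ^ 2 := by
        rw [intervalIntegral.integral_finsetSum, Finset.mul_sum]
        intro k _
        exact Continuous.intervalIntegrable (by have := hgc k; fun_prop) _ _
    _ ≤ 2 * M * ∫ y in (-M)..M, C * ∫ x in (-R/2)..(R/2), ‖f (x, y)‖ ^ 2 := by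
        apply mul_le_mul_of_nonneg_left _ (by linarith)
        apply intervalIntegral.integral_mono_on (by linarith)
        · apply Continuous.intervalIntegrable
          exact continuous_finsetSum _ fun k _ => by have := hgc k; fun_prop
        · apply Continuous.intervalIntegrable
          exact continuous_const.mul (inner_cont (f := fun p : ℝ × ℝ => ‖f p‖ ^ 2) (by fun_prop))
        · intro y _
          exact hB (fun x => f (x, y)) (by fun_prop) _
    _ = _ := by
        unfold ibox
        rw [intervalIntegral.integral_const_mul]; ring

lemma bessel_sin {R M : ℝ} (hR : 0 < R) (hM : 0 < M) {f : ℝ × ℝ → ℂ} (hf : Continuous f)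
    (F : Finset (ℕ × ℤ)) :
    ∑ i ∈ F, ‖cf R M f i‖ ^ 2 ≤ R * M * ibox R M (fun p => ‖f p‖ ^ 2) := by
  have := bessel_gen hR hM (sC R) (sC_cont R) (R / 2) (fun f hf F =>
    sum_le_hasSum F (fun _ _ => by positivity) (sin_parseval hR hf)) hf F
  calc _ ≤ _ := this
    _ = _ := by ring

lemma bessel_cos {R M : ℝ} (hR : 0 < R) (hM : 0 < M) {f : ℝ × ℝ → ℂ} (hf : Continuous f)
    (F : Finset (ℕ × ℤ)) :
    ∑ i ∈ F, ‖ibox R M (fun p => f p * CB R M i p)‖ ^ 2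
      ≤ 2 * R * M * ibox R M (fun p => ‖f p‖ ^ 2) := by
  have := bessel_gen hR hM (cC R) (cC_cont R) R (fun f hf F => cos_bessel hR hf F) hf F
  calc _ ≤ _ := this
    _ = _ := by ring

lemma parseval_le {R M : ℝ} (hR : 0 < R) (hM : 0 < M) {f : ℝ × ℝ → ℂ} (hf : Continuous f)
    {B : ℝ} (hB : ∀ F : Finset (ℕ × ℤ), ∑ i ∈ F, ‖cf R M f i‖ ^ 2 ≤ B) :
    R * M * ibox R M (fun p => ‖f p‖ ^ 2) ≤ B := by
  classical
  set g : ℕ → ℝ → ℂ := fun k y => ∫ x in (-R/2)..(R/2), f (x, y) * sC R k x with hg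
  have hgc : ∀ k, Continuous (g k) := fun k =>
    inner_cont (f := fun p : ℝ × ℝ => f p * sC R k p.1) (by have := sC_cont R k; fun_prop)
  have e : ∀ i : ℕ × ℤ, cf R M f i = ∫ y in (-M)..M, g i.1 y * eC M (-i.2) y := by
    intro i
    unfold cf ibox EB
    congr 1; ext y
    simp only [hg]
    rw [← intervalIntegral.integral_mul_const]
    congr 1; ext x; ring
  simp_rw [e] at hB
  have h1 : ∀ K : ℕ, 2 * M * ∫ y in (-M)..M, ∑ k ∈ Finset.range K, ‖g k y‖ ^ 2 ≤ B := by
    intro K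
    rw [intervalIntegral.integral_finsetSum, Finset.mul_sum]
    swap
    · intro k _
      exact Continuous.intervalIntegrable (by have := hgc k; fun_prop) _ _
    have hs := hasSum_sum (s := Finset.range K) (fun k _ => exp_parseval hM (hgc k))
    apply hasSum_le_of_sum_le hs
    intro G
    have := hB (Finset.range K ×ˢ G)
    rw [Finset.sum_product] at this
    rwa [Finset.sum_comm]
  have hFc : Continuous (fun y => ∫ x in (-R/2)..(R/2), ‖f (x, y)‖ ^ 2) :=
    inner_cont (f := fun p : ℝ × ℝ => ‖f p‖ ^ 2) (by fun_prop)
  have h2 : Tendsto (fun K : ℕ => ∫ y in (-M)..M, ∑ k ∈ Finset.range K, ‖g k y‖ ^ 2) atTop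
      (𝓝 (∫ y in (-M)..M, R / 2 * ∫ x in (-R/2)..(R/2), ‖f (x, y)‖ ^ 2)) := by
    apply intervalIntegral.tendsto_integral_filter_of_dominated_convergence
      (fun y => R / 2 * ∫ x in (-R/2)..(R/2), ‖f (x, y)‖ ^ 2)
    · refine Eventually.of_forall fun K => Continuous.aestronglyMeasurable ?_
      exact continuous_finsetSum _ fun k _ => by have := hgc k; fun_prop
    · refine Eventually.of_forall fun K => Eventually.of_forall fun y _ => ?_
      rw [Real.norm_of_nonneg (Finset.sum_nonneg fun _ _ => by positivity)]
      exact sum_le_hasSum _ (fun _ _ => by positivity)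
        (sin_parseval hR (f := fun x => f (x, y)) (by fun_prop))
    · exact Continuous.intervalIntegrable (by fun_prop) _ _
    · refine Eventually.of_forall fun y _ => ?_
      exact (sin_parseval hR (f := fun x => f (x, y)) (by fun_prop)).tendsto_sum_nat
  have h3 := le_of_tendsto' (h2.const_mul (2 * M)) h1
  unfold ibox
  rw [intervalIntegral.integral_const_mul] at h3
  linarith

/-! orthogonality -/

lemma hasSum_single_rest {ι : Type*} {a : ι → ℝ} {s : ℝ} (h : HasSum a s) (h0 : ∀ i, 0 ≤ a i)
    {i j : ι} (hi : a i = s) (hij : j ≠ i) : a j = 0 := by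
  classical
  have := sum_le_hasSum {i, j} (fun _ _ => h0 _) h
  rw [Finset.sum_pair hij.symm] at this
  linarith [h0 j]

lemma fx_pos {R : ℝ} (hR : 0 < R) (k : ℕ) : 0 < fx R k := by unfold fx; positivity

lemma sC_sq_int {R : ℝ} (hR : 0 < R) (k : ℕ) :
    ∫ x in (-R/2)..(R/2), Real.sin (fx R k * (x + R / 2)) ^ 2 = R / 2 := by
  have hk := fx_pos hR k
  simp only [mul_add]
  rw [intervalIntegral.integral_comp_mul_add (fun t => Real.sin t ^ 2) hk.ne' (fx R k * (R/2))]
  have e1 : fx R k * (-R/2) + fx R k * (R / 2) = 0 := by ring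
  have e2 : fx R k * (R/2) + fx R k * (R / 2) = ((k + 1 : ℕ) : ℝ) * π := by
    unfold fx; push_cast; field_simp; ring
  rw [e1, e2, integral_sin_sq, Real.sin_nat_mul_pi]
  unfold fx; push_cast; simp; field_simp

lemma sC_orth {R : ℝ} (hR : 0 < R) (k k' : ℕ) :
    ∫ x in (-R/2)..(R/2), sC R k x * sC R k' x = if k' = k then ((R / 2 : ℝ) : ℂ) else 0 := by
  have h0 : ∫ x in (-R/2)..(R/2), sC R k x * sC R k x = ((R / 2 : ℝ) : ℂ) := by
    refine Eq.trans ?_ (congrArg Complex.ofReal (sC_sq_int hR k))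
    rw [← intervalIntegral.integral_ofReal]
    congr 1; ext x; unfold sC; push_cast; ring
  split_ifs with h
  · rw [h, h0]
  · have hs := sin_parseval hR (sC_cont R k)
    have h1 : ∫ x in (-R/2)..(R/2), ‖sC R k x‖ ^ 2 = R / 2 := by
      refine Eq.trans ?_ (sC_sq_int hR k)
      congr 1; ext x; unfold sC; simp only [Complex.norm_real, Real.norm_eq_abs, sq_abs]
    have := hasSum_single_rest hs (fun _ => by positivity) (i := k) (j := k')
      (by rw [h0, h1, Complex.norm_real, Real.norm_of_nonneg (by positivity)]; ring) h
    simpa using this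

lemma eC_norm (M : ℝ) (l : ℤ) (y : ℝ) : ‖eC M l y‖ = 1 := by
  unfold eC; rw [Complex.norm_exp]; simp
lemma eC_mul_neg (M : ℝ) (l : ℤ) (y : ℝ) : eC M l y * eC M (-l) y = 1 := by
  unfold eC; rw [← Complex.exp_add]
  have : Complex.I * ((fy M l * y : ℝ) : ℂ) + Complex.I * ((fy M (-l) * y : ℝ) : ℂ) = 0 := by
    unfold fy; push_cast; ring
  rw [this, Complex.exp_zero]

lemma eC_orth {M : ℝ} (hM : 0 < M) (l l' : ℤ) :
    ∫ y in (-M)..M, eC M l y * eC M (-l') y = if l' = l then ((2 * M : ℝ) : ℂ) else 0 := by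
  have h0 : ∫ y in (-M)..M, eC M l y * eC M (-l) y = ((2 * M : ℝ) : ℂ) := by
    simp_rw [eC_mul_neg]; simp; ring
  split_ifs with h
  · rw [h, h0]
  · have hs := exp_parseval hM (eC_cont M l)
    have h1 : ∫ y in (-M)..M, ‖eC M l y‖ ^ 2 = 2 * M := by
      simp_rw [eC_norm]; simp; ring
    have := hasSum_single_rest hs (fun _ => by positivity) (i := l) (j := l')
      (by rw [h0, h1, Complex.norm_real, Real.norm_of_nonneg (by positivity)]; ring) h
    simpa using this

lemma ibox_prod (R M : ℝ) (g h : ℝ → ℂ) :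
    ibox R M (fun p => g p.1 * h p.2) = (∫ x in (-R/2)..(R/2), g x) * ∫ y in (-M)..M, h y := by
  unfold ibox
  simp only [intervalIntegral.integral_mul_const]
  rw [intervalIntegral.integral_const_mul]

lemma cf_EE {R M : ℝ} (hR : 0 < R) (hM : 0 < M) (i j : ℕ × ℤ) :
    cf R M (EE R M j) i = if i = j then ((R * M : ℝ) : ℂ) else 0 := by
  unfold cf EE EB
  have : (fun p : ℝ × ℝ => sC R j.1 p.1 * eC M j.2 p.2 * (sC R i.1 p.1 * eC M (-i.2) p.2))
      = fun p => (sC R j.1 p.1 * sC R i.1 p.1) * (eC M j.2 p.2 * eC M (-i.2) p.2) := by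
    ext p; ring
  rw [this, ibox_prod R M (fun x => sC R j.1 x * sC R i.1 x) (fun y => eC M j.2 y * eC M (-i.2) y),
    sC_orth hR, eC_orth hM]
  rcases i with ⟨k, l⟩; rcases j with ⟨k', l'⟩
  simp only [Prod.mk.injEq]
  by_cases h1 : k = k' <;> by_cases h2 : l = l' <;> simp [h1, h2]
  ring

end SM
end

open MeasureTheory Real Set Filter Topology

noncomputable section

namespace SM

def Sy {E : Type*} [Zero E] (M : ℝ) (f : ℝ × ℝ → E) : Prop := ∀ p : ℝ × ℝ, M < |p.2| → f p = 0

lemma Sy.cpt {E : Type*} [Zero E] {M : ℝ} {f : ℝ × ℝ → E} (h : Sy M f) : CptY f := ⟨M, h⟩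
lemma Sy.dx {M : ℝ} {f : ℝ × ℝ → ℂ} (hM : Sy M f) : Sy M (dx f) := by
  intro p hp
  have : f =ᶠ[𝓝 p] fun _ => 0 := by
    have : IsOpen {q : ℝ × ℝ | M < |q.2|} := isOpen_lt continuous_const (by fun_prop)
    filter_upwards [this.mem_nhds hp] with q hq using hM q hq
  unfold SM.dx; rw [this.fderiv_eq]; simp
lemma Sy.dy {M : ℝ} {f : ℝ × ℝ → ℂ} (hM : Sy M f) : Sy M (dy f) := by
  intro p hp
  have : f =ᶠ[𝓝 p] fun _ => 0 := by
    have : IsOpen {q : ℝ × ℝ | M < |q.2|} := isOpen_lt continuous_const (by fun_prop)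
    filter_upwards [this.mem_nhds hp] with q hq using hM q hq
  unfold SM.dy; rw [this.fderiv_eq]; simp
lemma Sy.mul_left {M : ℝ} {f g : ℝ × ℝ → ℂ} (hf : Sy M f) : Sy M (fun p => f p * g p) :=
  fun p hp => by simp [hf p hp]

lemma int_ibox {E : Type*} [NormedAddCommGroup E] [NormedSpace ℝ E] {R M M' : ℝ} (hR : 0 < R)
    (hM : 0 < M) (hMM : M' < M) {f : ℝ × ℝ → E} (hf : Continuous f) (h0 : Sy M' f) :
    ∫ p, f p ∂(mu R) = ibox R M f :=
  int_eq_ibox hR hM hf (fun p hp => h0 p (by linarith))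

lemma ibp_x' {R : ℝ} (hR : 0 < R) {f g : ℝ × ℝ → ℂ} (hf : ContDiff ℝ 1 f) (hg : ContDiff ℝ 1 g)
    (hc : CptY f) (hb : ∀ y, f (-R/2, y) = 0 ∧ f (R/2, y) = 0) :
    ∫ p, dx f p * g p ∂(mu R) = - ∫ p, f p * dx g p ∂(mu R) := by
  have h := int_dx_zero hR (hf.mul hg) hc.mul_left (fun y => by simp [hb y])
  have e : ∀ p, dx (fun q => f q * g q) p = dx f p * g p + f p * dx g p := fun p =>
    dx_mul (c1d hf p) (c1d hg p)
  simp_rw [e] at h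
  rw [integral_add] at h
  · exact eq_neg_of_add_eq_zero_left h
  · exact hc.dx.mul_left.integrable ((dx_cont hf).mul hg.continuous)
  · exact hc.mul_left.integrable (hf.continuous.mul (dx_cont hg))

lemma ibp_y' {R : ℝ} {f g : ℝ × ℝ → ℂ} (hf : ContDiff ℝ 1 f) (hg : ContDiff ℝ 1 g)
    (hc : CptY f) :
    ∫ p, dy f p * g p ∂(mu R) = - ∫ p, f p * dy g p ∂(mu R) := by
  have h := int_dy_zero (R := R) (hf.mul hg) hc.mul_left
  have e : ∀ p, dy (fun q => f q * g q) p = dy f p * g p + f p * dy g p := fun p =>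
    dy_mul (c1d hf p) (c1d hg p)
  simp_rw [e] at h
  rw [integral_add] at h
  · exact eq_neg_of_add_eq_zero_left h
  · exact hc.dy.mul_left.integrable ((dy_cont hf).mul hg.continuous)
  · exact hc.mul_left.integrable (hf.continuous.mul (dy_cont hg))

/-! derivatives of the basis functions -/

lemma sC_deriv (R : ℝ) (k : ℕ) (x : ℝ) : HasDerivAt (sC R k) (fx R k * cC R k x) x := by
  have h : HasDerivAt (fun x : ℝ => Real.sin (fx R k * (x + R / 2)))
      (Real.cos (fx R k * (x + R / 2)) * fx R k) x := by
    have h1 : HasDerivAt (fun x : ℝ => fx R k * (x + R / 2)) (fx R k) x := by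
      simpa using ((hasDerivAt_id x).add_const (R / 2)).const_mul (fx R k)
    exact (Real.hasDerivAt_sin _).comp x h1
  have h2 := h.ofReal_comp
  have e : (fx R k * cC R k x : ℂ) = ((Real.cos (fx R k * (x + R / 2)) * fx R k : ℝ) : ℂ) := by
    unfold cC; push_cast; ring
  rw [e]; exact h2

lemma cC_deriv (R : ℝ) (k : ℕ) (x : ℝ) : HasDerivAt (cC R k) (-(fx R k * sC R k x)) x := by
  have h : HasDerivAt (fun x : ℝ => Real.cos (fx R k * (x + R / 2)))
      (-Real.sin (fx R k * (x + R / 2)) * fx R k) x := by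
    have h1 : HasDerivAt (fun x : ℝ => fx R k * (x + R / 2)) (fx R k) x := by
      simpa using ((hasDerivAt_id x).add_const (R / 2)).const_mul (fx R k)
    exact (Real.hasDerivAt_cos _).comp x h1
  have h2 := h.ofReal_comp
  have e : (-(fx R k * sC R k x) : ℂ) = ((-Real.sin (fx R k * (x + R / 2)) * fx R k : ℝ) : ℂ) := by
    unfold sC; push_cast; ring
  rw [e]; exact h2

lemma eC_deriv (M : ℝ) (l : ℤ) (y : ℝ) :
    HasDerivAt (eC M l) (Complex.I * fy M l * eC M l y) y := by
  have h1 : HasDerivAt (fun x : ℝ => fy M l * x) (fy M l) y := by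
    simpa using (hasDerivAt_id y).const_mul (fy M l)
  have h2 := ((h1.ofReal_comp).const_mul Complex.I).cexp
  have e : Complex.I * fy M l * eC M l y = Complex.exp (Complex.I * ((fy M l * y : ℝ) : ℂ)) *
      (Complex.I * fy M l) := by
    unfold eC; ring
  rw [e]; exact h2

lemma sC_cd (R : ℝ) (k : ℕ) (n : ℕ) : ContDiff ℝ n (sC R k) := by
  unfold sC
  exact Complex.ofRealCLM.contDiff.comp (Real.contDiff_sin.comp (by fun_prop))
lemma cC_cd (R : ℝ) (k : ℕ) (n : ℕ) : ContDiff ℝ n (cC R k) := by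
  unfold cC
  exact Complex.ofRealCLM.contDiff.comp (Real.contDiff_cos.comp (by fun_prop))
lemma eC_cd (M : ℝ) (l : ℤ) (n : ℕ) : ContDiff ℝ n (eC M l) := by
  unfold eC
  have : ContDiff ℝ n (fun y : ℝ => ((fy M l * y : ℝ) : ℂ)) :=
    Complex.ofRealCLM.contDiff.comp (contDiff_const.mul contDiff_id)
  exact (contDiff_const.mul this).cexp

lemma fy_neg (M : ℝ) (l : ℤ) : fy M (-l) = - fy M l := by unfold fy; push_cast; ring

lemma EE_cd (R M : ℝ) (i) (n : ℕ) : ContDiff ℝ n (EE R M i) := by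
  unfold EE
  exact ((sC_cd R i.1 n).comp contDiff_fst).mul ((eC_cd M i.2 n).comp contDiff_snd)
lemma EB_cd (R M : ℝ) (i) (n : ℕ) : ContDiff ℝ n (EB R M i) := by
  unfold EB
  exact ((sC_cd R i.1 n).comp contDiff_fst).mul ((eC_cd M (-i.2) n).comp contDiff_snd)
lemma CB_cd (R M : ℝ) (i) (n : ℕ) : ContDiff ℝ n (CB R M i) := by
  unfold CB
  exact ((cC_cd R i.1 n).comp contDiff_fst).mul ((eC_cd M (-i.2) n).comp contDiff_snd)

lemma dfst {g : ℝ → ℂ} (hg : ∀ x, DifferentiableAt ℝ g x) (p : ℝ × ℝ) :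
    DifferentiableAt ℝ (fun q : ℝ × ℝ => g q.1) p := (hg p.1).comp p differentiableAt_fst
lemma dsnd {g : ℝ → ℂ} (hg : ∀ x, DifferentiableAt ℝ g x) (p : ℝ × ℝ) :
    DifferentiableAt ℝ (fun q : ℝ × ℝ => g q.2) p := (hg p.2).comp p differentiableAt_snd

lemma dprod {g h : ℝ → ℂ} {g' h' : ℝ → ℂ} (hg : ∀ x, HasDerivAt g (g' x) x)
    (hh : ∀ x, HasDerivAt h (h' x) x) (p : ℝ × ℝ) :
    dx (fun q => g q.1 * h q.2) p = g' p.1 * h p.2 ∧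
    dy (fun q => g q.1 * h q.2) p = g p.1 * h' p.2 := by
  have a := dfst (fun x => (hg x).differentiableAt) p
  have b := dsnd (fun x => (hh x).differentiableAt) p
  constructor
  · rw [dx_mul a b, dx_fst (hg p.1), dx_snd (hh p.2)]; simp
  · rw [dy_mul a b, dy_fst (hg p.1), dy_snd (hh p.2)]; simp

lemma dx_EB (R M : ℝ) (i) (p) : dx (EB R M i) p = fx R i.1 * CB R M i p := by
  have := (dprod (sC_deriv R i.1) (eC_deriv M (-i.2)) p).1
  unfold EB CB; rw [this]; ring
lemma dy_EB (R M : ℝ) (i) (p) : dy (EB R M i) p = -(Complex.I * fy M i.2 * EB R M i p) := by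
  have := (dprod (sC_deriv R i.1) (eC_deriv M (-i.2)) p).2
  unfold EB; rw [this, fy_neg]; push_cast; ring
lemma dy_EE (R M : ℝ) (i) (p) : dy (EE R M i) p = Complex.I * fy M i.2 * EE R M i p := by
  have := (dprod (sC_deriv R i.1) (eC_deriv M (i.2)) p).2
  unfold EE; rw [this]; ring
lemma dx_EE (R M : ℝ) (i) (p) : dx (EE R M i) p = fx R i.1 * (cC R i.1 p.1 * eC M i.2 p.2) := by
  have := (dprod (sC_deriv R i.1) (eC_deriv M (i.2)) p).1
  unfold EE; rw [this]; ring
lemma dx_CB (R M : ℝ) (i) (p) : dx (CB R M i) p = -(fx R i.1 * EB R M i p) := by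
  have := (dprod (cC_deriv R i.1) (eC_deriv M (-i.2)) p).1
  unfold CB EB; rw [this]; ring

lemma sC_norm (R : ℝ) (k : ℕ) (x : ℝ) : ‖sC R k x‖ ≤ 1 := by
  unfold sC; rw [Complex.norm_real]; exact Real.abs_sin_le_one _
lemma cC_norm (R : ℝ) (k : ℕ) (x : ℝ) : ‖cC R k x‖ ≤ 1 := by
  unfold cC; rw [Complex.norm_real]; exact Real.abs_cos_le_one _
lemma EE_norm (R M : ℝ) (i) (p) : ‖EE R M i p‖ ≤ 1 := by
  unfold EE; rw [norm_mul, eC_norm, mul_one]; exact sC_norm _ _ _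
lemma EB_norm (R M : ℝ) (i) (p) : ‖EB R M i p‖ ≤ 1 := by
  unfold EB; rw [norm_mul, eC_norm, mul_one]; exact sC_norm _ _ _
lemma EE_bd {R : ℝ} (hR : 0 < R) (M : ℝ) (i) (y) : EE R M i (-R/2, y) = 0 ∧ EE R M i (R/2, y) = 0 := by
  unfold EE sC
  constructor
  · have : fx R i.1 * (-R/2 + R / 2) = 0 := by ring
    simp only [this]; simp
  · have : fx R i.1 * (R/2 + R / 2) = ((i.1 + 1 : ℕ) : ℝ) * π := by
      unfold fx; push_cast; field_simp; ring
    simp only [this, Real.sin_nat_mul_pi]; simp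
lemma EB_bd {R : ℝ} (hR : 0 < R) (M : ℝ) (i) (y) : EB R M i (-R/2, y) = 0 ∧ EB R M i (R/2, y) = 0 := by
  have := EE_bd hR M (i.1, -i.2) y
  simpa [EE, EB] using this

/-! gradient Bessel -/

lemma bessel_dy {R M M' : ℝ} (hR : 0 < R) (hM : 0 < M) (hMM : M' < M) {f : ℝ × ℝ → ℂ}
    (hf : ContDiff ℝ 1 f) (hs : Sy M' f) (F : Finset (ℕ × ℤ)) :
    ∑ i ∈ F, fy M i.2 ^ 2 * ‖cf R M f i‖ ^ 2 ≤ R * M * ibox R M (fun p => ‖dy f p‖ ^ 2) := by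
  refine le_trans (le_of_eq ?_) (bessel_sin hR hM (dy_cont hf) F)
  apply Finset.sum_congr rfl
  intro i _
  have h1 : cf R M (dy f) i = Complex.I * fy M i.2 * cf R M f i := by
    unfold cf
    have := EB_cont R M i
    have := hf.continuous
    have := dy_cont hf
    rw [← int_ibox hR hM hMM (by fun_prop) hs.dy.mul_left, ← int_ibox hR hM hMM (by fun_prop) hs.mul_left,
      ibp_y' hf (EB_cd R M i 1) hs.cpt, ← integral_const_mul, ← integral_neg]
    congr 1; ext p; rw [dy_EB]; ring
  rw [h1]; simp [mul_pow]

lemma bessel_dx {R M M' : ℝ} (hR : 0 < R) (hM : 0 < M) (hMM : M' < M) {f : ℝ × ℝ → ℂ}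
    (hf : ContDiff ℝ 1 f) (hs : Sy M' f) (hb : ∀ y, f (-R/2, y) = 0 ∧ f (R/2, y) = 0)
    (F : Finset (ℕ × ℤ)) :
    ∑ i ∈ F, fx R i.1 ^ 2 * ‖cf R M f i‖ ^ 2 ≤ 2 * R * M * ibox R M (fun p => ‖dx f p‖ ^ 2) := by
  refine le_trans (le_of_eq ?_) (bessel_cos hR hM (dx_cont hf) F)
  apply Finset.sum_congr rfl
  intro i _
  have h1 : ibox R M (fun p => dx f p * CB R M i p) = fx R i.1 * cf R M f i := by
    unfold cf
    have := EB_cont R M i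
    have := CB_cont R M i
    have := hf.continuous
    have := dx_cont hf
    rw [← int_ibox hR hM hMM (by fun_prop) hs.dx.mul_left, ← int_ibox hR hM hMM (by fun_prop) hs.mul_left,
      ibp_x' hR hf (CB_cd R M i 1) hs.cpt hb, ← integral_const_mul, ← integral_neg]
    congr 1; ext p; rw [dx_CB]; ring
  rw [h1]; simp [mul_pow]

/-! finite sums -/

lemma ibox_sum {R M : ℝ} {ι : Type*} (F : Finset ι) {f : ι → ℝ × ℝ → ℂ}
    (hf : ∀ i, Continuous (f i)) :
    ibox R M (fun p => ∑ i ∈ F, f i p) = ∑ i ∈ F, ibox R M (f i) := by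
  unfold ibox
  have : ∀ y, ∫ x in (-R/2)..(R/2), ∑ i ∈ F, f i (x, y)
      = ∑ i ∈ F, ∫ x in (-R/2)..(R/2), f i (x, y) := fun y =>
    intervalIntegral.integral_finsetSum (fun i _ => Continuous.intervalIntegrable
      (by have := hf i; fun_prop) _ _)
  simp_rw [this]
  exact intervalIntegral.integral_finsetSum (fun i _ => (inner_cont (hf i)).intervalIntegrable _ _)

lemma ibox_const_mul {R M : ℝ} (c : ℂ) (f : ℝ × ℝ → ℂ) :
    ibox R M (fun p => c * f p) = c * ibox R M f := by
  unfold ibox; simp only [intervalIntegral.integral_const_mul]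

lemma cf_sum {R M : ℝ} (hR : 0 < R) (hM : 0 < M) (F : Finset (ℕ × ℤ)) (c : ℕ × ℤ → ℂ) (i) :
    cf R M (fun p => ∑ j ∈ F, c j * EE R M j p) i = if i ∈ F then ((R * M : ℝ) : ℂ) * c i else 0 := by
  classical
  have e : cf R M (fun p => ∑ j ∈ F, c j * EE R M j p) i = ∑ j ∈ F, c j * cf R M (EE R M j) i := by
    unfold cf
    simp_rw [Finset.sum_mul, mul_assoc]
    rw [ibox_sum F (f := fun j p => c j * (EE R M j p * EB R M i p))]
    · simp_rw [ibox_const_mul]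
    · intro j; have := EE_cont R M j; have := EB_cont R M i; fun_prop
  rw [e]
  simp_rw [cf_EE hR hM, mul_ite, mul_zero]
  rw [Finset.sum_ite_eq]
  congr 1; ring

lemma sum_norm_le {R M : ℝ} (hR : 0 < R) (hM : 0 < M) (F : Finset (ℕ × ℤ)) (c : ℕ × ℤ → ℂ) :
    ibox R M (fun p => ‖∑ j ∈ F, c j * EE R M j p‖ ^ 2) ≤ R * M * ∑ i ∈ F, ‖c i‖ ^ 2 := by
  classical
  have hpos : 0 < R * M := by positivity
  have := parseval_le hR hM (f := fun p => ∑ j ∈ F, c j * EE R M j p)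
    (continuous_finsetSum _ fun j _ => by have := EE_cont R M j; fun_prop)
    (B := (R * M) ^ 2 * ∑ i ∈ F, ‖c i‖ ^ 2) (by
      intro G
      simp_rw [cf_sum hR hM]
      calc _ ≤ ∑ i ∈ F, ‖((R * M : ℝ) : ℂ) * c i‖ ^ 2 := by
            have e : ∀ i, ‖if i ∈ F then ((R * M : ℝ) : ℂ) * c i else 0‖ ^ 2
                = if i ∈ F then ‖((R * M : ℝ) : ℂ) * c i‖ ^ 2 else 0 := by
              intro i; split_ifs <;> simp
            simp_rw [e]
            rw [← Finset.sum_filter]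
            apply Finset.sum_le_sum_of_subset_of_nonneg
            · intro i hi; exact (Finset.mem_filter.1 hi).2
            · intros; positivity
        _ = _ := by
            rw [Finset.mul_sum]
            apply Finset.sum_congr rfl
            intro i _
            rw [norm_mul, Complex.norm_real, Real.norm_of_nonneg hpos.le, mul_pow])
  have h2 : R * M * ibox R M (fun p => ‖∑ j ∈ F, c j * EE R M j p‖ ^ 2)
      ≤ R * M * (R * M * ∑ i ∈ F, ‖c i‖ ^ 2) := by
    refine this.trans (le_of_eq (by ring))
  exact le_of_mul_le_mul_left h2 hpos

end SM
end

open MeasureTheory Real Set Filter Topology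

noncomputable section

namespace SM

lemma fx_ge {R : ℝ} (hR : 0 < R) (k : ℕ) : fx R 0 ≤ fx R k := by
  unfold fx
  have := Real.pi_pos
  gcongr
  simp

lemma lam_pos {R : ℝ} (hR : 0 < R) (M : ℝ) (i) : 0 < lam R M i := by
  unfold lam; have := fx_pos hR i.1; positivity

lemma sum_q {R M : ℝ} (hR : 0 < R) (hM : 0 < M) :
    Summable (fun i : ℕ × ℤ => (fx R i.1 ^ 2 * (1 + fy M i.2 ^ 2))⁻¹) := by
  have hpi := Real.pi_pos
  have h1 : Summable (fun k : ℕ => (fx R k ^ 2)⁻¹) := by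
    have h : Summable (fun k : ℕ => 1 / ((k : ℝ)) ^ 2) := Real.summable_one_div_nat_pow.2 (by norm_num)
    have h' := ((summable_nat_add_iff 1).2 h).mul_left (R ^ 2 / π ^ 2)
    refine h'.congr fun k => ?_
    unfold fx; push_cast; field_simp
  have h2 : Summable (fun l : ℤ => (1 + fy M l ^ 2)⁻¹) := by
    have h : Summable (fun k : ℤ => 1 / ((k : ℝ)) ^ 2) := Real.summable_one_div_int_pow.2 (by norm_num)
    have h' := h.mul_left (M ^ 2 / π ^ 2)
    refine Summable.of_norm_bounded_eventually h' ?_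
    have : ({0} : Set ℤ).Finite := Set.finite_singleton 0
    filter_upwards [this.compl_mem_cofinite] with l hl
    have hl0 : (l : ℝ) ≠ 0 := by simpa using hl
    rw [Real.norm_of_nonneg (by positivity)]
    have e : M ^ 2 / π ^ 2 * (1 / (l : ℝ) ^ 2) = (fy M l ^ 2)⁻¹ := by unfold fy; field_simp
    rw [e]
    have : 0 < fy M l ^ 2 := by
      have : fy M l ≠ 0 := by unfold fy; positivity
      positivity
    apply inv_anti₀ this; linarith
  have := h1.mul_of_nonneg h2 (fun _ => by positivity) (fun _ => by positivity)
  refine this.congr fun i => ?_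
  rw [mul_inv]

lemma sum_lamy {R M : ℝ} (hR : 0 < R) (hM : 0 < M) :
    Summable (fun i : ℕ × ℤ => (lam R M i * (1 + fy M i.2 ^ 2))⁻¹) := by
  refine Summable.of_nonneg_of_le (fun i => by have := lam_pos hR M i; positivity) (fun i => ?_) (sum_q hR hM)
  have := fx_pos hR i.1
  apply inv_anti₀ (by positivity)
  gcongr
  unfold lam; nlinarith [sq_nonneg (fy M i.2)]

lemma sum_lam2 {R M : ℝ} (hR : 0 < R) (hM : 0 < M) :
    Summable (fun i : ℕ × ℤ => (lam R M i ^ 2)⁻¹) := by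
  have h0 := fx_pos hR 0
  refine Summable.of_nonneg_of_le (fun i => by have := lam_pos hR M i; positivity) (fun i => ?_)
    ((sum_lamy hR hM).mul_left (1 + (fx R 0 ^ 2)⁻¹))
  have hl := lam_pos hR M i
  have h1 : 1 + fy M i.2 ^ 2 ≤ (1 + (fx R 0 ^ 2)⁻¹) * lam R M i := by
    have h2 : fx R 0 ^ 2 ≤ fx R i.1 ^ 2 := by have := fx_ge hR i.1; gcongr
    have h3 : 1 ≤ (fx R 0 ^ 2)⁻¹ * fx R i.1 ^ 2 := by
      rw [inv_mul_eq_div, one_le_div (by positivity)]; exact h2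
    have h4 : 0 ≤ (fx R 0 ^ 2)⁻¹ := by positivity
    unfold lam
    nlinarith [sq_nonneg (fx R i.1), sq_nonneg (fy M i.2), mul_nonneg h4 (sq_nonneg (fy M i.2))]
  rw [mul_inv, ← div_eq_mul_inv, ← mul_div_assoc, div_eq_mul_inv, inv_eq_one_div, div_le_iff₀ (by positivity)] 
  have h5 : 0 < 1 + fy M i.2 ^ 2 := by positivity
  have : (1 + (fx R 0 ^ 2)⁻¹) * (lam R M i)⁻¹ * (1 + fy M i.2 ^ 2)⁻¹ * lam R M i ^ 2
    = ((1 + (fx R 0 ^ 2)⁻¹) * lam R M i) / (1 + fy M i.2 ^ 2) := by field_simp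
  rw [this, le_div_iff₀ h5]; linarith

lemma summable_of_weight {ι : Type*} {W a : ι → ℝ} (hW : ∀ i, 0 < W i)
    (hs : Summable fun i => (W i)⁻¹) {B : ℝ} (hB : ∀ F : Finset ι, ∑ i ∈ F, W i * a i ^ 2 ≤ B)
    (ha : ∀ i, 0 ≤ a i) : Summable a := by
  have h1 : Summable fun i => W i * a i ^ 2 :=
    summable_of_sum_le (fun i => by have := hW i; positivity) hB
  refine Summable.of_nonneg_of_le ha (fun i => ?_) (h1.add hs)
  have hw := hW i
  have e : W i * (W i)⁻¹ = 1 := mul_inv_cancel₀ hw.ne'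
  have : 0 < (W i)⁻¹ := by positivity
  nlinarith [mul_nonneg this.le (sq_nonneg (W i * a i - 1)), sq_nonneg (W i * a i), ha i]

lemma lam_fin {R M : ℝ} (hR : 0 < R) (hM : 0 < M) (Λ : ℝ) :
    ∃ G : Finset (ℕ × ℤ), ∀ i ∉ G, Λ < lam R M i := by
  have h := (sum_lam2 hR hM).tendsto_cofinite_zero
  have h2 : ∀ᶠ i in cofinite, (lam R M i ^ 2)⁻¹ < (1 + |Λ|)⁻¹ ^ 2 :=
    h.eventually_lt_const (by positivity)
  rw [eventually_cofinite] at h2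
  refine ⟨h2.toFinset, fun i hi => ?_⟩
  simp only [Set.Finite.mem_toFinset, mem_ofPred_eq, not_not] at hi
  have hl := lam_pos hR M i
  rw [← inv_pow] at hi
  have h3 := lt_of_pow_lt_pow_left₀ 2 (by positivity) hi
  have h4 := (inv_lt_inv₀ hl (by positivity)).1 h3
  linarith [le_abs_self Λ]

/-! series -/

def ser (R M : ℝ) (a : ℕ × ℤ → ℂ) (p : ℝ × ℝ) : ℂ := ∑' i, a i * EE R M i p
def par (R M : ℝ) (a : ℕ × ℤ → ℂ) (F : Finset (ℕ × ℤ)) (p : ℝ × ℝ) : ℂ := ∑ i ∈ F, a i * EE R M i p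

lemma term_le (R M : ℝ) (a : ℕ × ℤ → ℂ) (i p) : ‖a i * EE R M i p‖ ≤ ‖a i‖ := by
  rw [norm_mul]; exact mul_le_of_le_one_right (norm_nonneg _) (EE_norm _ _ _ _)

lemma ser_cont {R M : ℝ} {a : ℕ × ℤ → ℂ} (ha : Summable fun i => ‖a i‖) : Continuous (ser R M a) :=
  continuous_tsum (fun i => continuous_const.mul (EE_cont R M i)) ha (fun i p => term_le R M a i p)

lemma par_cont (R M : ℝ) (a : ℕ × ℤ → ℂ) (F) : Continuous (par R M a F) :=
  continuous_finsetSum _ fun i _ => continuous_const.mul (EE_cont R M i)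

lemma par_cd (R M : ℝ) (a : ℕ × ℤ → ℂ) (F) (n : ℕ) : ContDiff ℝ n (par R M a F) :=
  ContDiff.sum fun i _ => contDiff_const.mul (EE_cd R M i n)

lemma par_unif {R M : ℝ} {a : ℕ × ℤ → ℂ} (ha : Summable fun i => ‖a i‖) :
    TendstoUniformly (par R M a) (ser R M a) atTop :=
  tendstoUniformly_tsum ha (fun i p => term_le R M a i p)

lemma par_norm {R M : ℝ} {a : ℕ × ℤ → ℂ} (ha : Summable fun i => ‖a i‖) (F p) :
    ‖par R M a F p‖ ≤ ∑' i, ‖a i‖ :=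
  (norm_sum_le _ _).trans ((Finset.sum_le_sum fun i _ => term_le R M a i p).trans
    (ha.sum_le_tsum _ fun _ _ => norm_nonneg _))

lemma ser_bd {R : ℝ} (hR : 0 < R) (M : ℝ) (a) (y) : ser R M a (-R/2, y) = 0 ∧ ser R M a (R/2, y) = 0 := by
  unfold ser
  simp [(EE_bd hR M _ y).1, (EE_bd hR M _ y).2]

def nu (R M : ℝ) : Measure (ℝ × ℝ) := volume.restrict (Ioo (-R/2) (R/2) ×ˢ Ioo (-M) M)

instance (R M : ℝ) : IsFiniteMeasure (nu R M) := by
  unfold nu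
  refine ⟨?_⟩
  rw [Measure.restrict_apply_univ, Measure.volume_eq_prod, Measure.prod_prod, Real.volume_Ioo, Real.volume_Ioo]
  exact ENNReal.mul_lt_top ENNReal.ofReal_lt_top ENNReal.ofReal_lt_top

lemma nu_int {E : Type*} [NormedAddCommGroup E] [NormedSpace ℝ E] {R M : ℝ}
    {f : ℝ × ℝ → E} (hf : Continuous f) : Integrable f (nu R M) :=
  (hf.continuousOn.integrableOn_compact (isCompact_Icc.prod isCompact_Icc)).mono_set
      (prod_mono Ioo_subset_Icc_self Ioo_subset_Icc_self)

lemma ibox_nu {E : Type*} [NormedAddCommGroup E] [NormedSpace ℝ E] {R M : ℝ} (hR : 0 < R)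
    (hM : 0 < M) {f : ℝ × ℝ → E} (hf : Continuous f) : ibox R M f = ∫ p, f p ∂(nu R M) :=
  ibox_eq hR hM hf

lemma unif_int {R M : ℝ} {ι : Type*} {l : Filter ι}
    {f : ι → ℝ × ℝ → ℂ} {g : ℝ × ℝ → ℂ} (hf : ∀ i, Continuous (f i)) (hg : Continuous g)
    (h : TendstoUniformlyOn f g l (Icc (-R/2) (R/2) ×ˢ Icc (-M) M)) :
    Tendsto (fun i => ∫ p, f i p ∂(nu R M)) l (𝓝 (∫ p, g p ∂(nu R M))) := by
  rw [Metric.tendsto_nhds]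
  intro ε hε
  set m := (nu R M).real univ with hm
  have hm0 : 0 ≤ m := measureReal_nonneg
  have h2 := Metric.tendstoUniformlyOn_iff.1 h (ε / (m + 1)) (by positivity)
  filter_upwards [h2] with i hi
  rw [dist_eq_norm, ← integral_sub (nu_int (hf i)) (nu_int hg)]
  calc _ ≤ (ε / (m + 1)) * m := by
        apply norm_integral_le_of_norm_le_const
        have : ∀ᵐ p ∂(nu R M), p ∈ Ioo (-R/2) (R/2) ×ˢ Ioo (-M) M :=
          ae_restrict_mem (measurableSet_Ioo.prod measurableSet_Ioo)
        filter_upwards [this] with p hp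
        have := hi p ⟨Ioo_subset_Icc_self hp.1, Ioo_subset_Icc_self hp.2⟩
        rw [dist_comm, dist_eq_norm] at this
        exact this.le
    _ < ε := by
        rw [div_mul_eq_mul_div, div_lt_iff₀ (by positivity)]; nlinarith

lemma bdd_box {R M : ℝ} {g : ℝ × ℝ → ℂ} (hg : Continuous g) :
    ∃ C, 0 < C ∧ ∀ p ∈ Icc (-R/2) (R/2) ×ˢ Icc (-M) M, ‖g p‖ ≤ C := by
  have hK : IsCompact (Icc (-R/2) (R/2) ×ˢ Icc (-M) M) := isCompact_Icc.prod isCompact_Icc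
  obtain ⟨C, hC⟩ := hK.exists_bound_of_continuousOn hg.continuousOn
  exact ⟨|C| + 1, by positivity, fun p hp => (hC p hp).trans (by linarith [le_abs_self C])⟩

lemma unif_mul {R M : ℝ} {ι : Type*} {l : Filter ι}
    {f : ι → ℝ × ℝ → ℂ} {g h : ℝ × ℝ → ℂ} (hh : Continuous h)
    (hu : TendstoUniformlyOn f g l (Icc (-R/2) (R/2) ×ˢ Icc (-M) M)) :
    TendstoUniformlyOn (fun i p => f i p * h p) (fun p => g p * h p) l
      (Icc (-R/2) (R/2) ×ˢ Icc (-M) M) := by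
  obtain ⟨C, hC, hb⟩ := bdd_box (R := R) (M := M) hh
  rw [Metric.tendstoUniformlyOn_iff] at hu ⊢
  intro ε hε
  filter_upwards [hu (ε / C) (by positivity)] with i hi p hp
  rw [dist_eq_norm, ← sub_mul, norm_mul]
  have h1 := hi p hp
  rw [dist_eq_norm] at h1
  calc _ ≤ ‖g p - f i p‖ * C := by gcongr; exact hb p hp
    _ < ε / C * C := by gcongr
    _ = ε := by field_simp

lemma cf_ser {R M : ℝ} (hR : 0 < R) (hM : 0 < M) {a : ℕ × ℤ → ℂ} (ha : Summable fun i => ‖a i‖) (i) :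
    cf R M (ser R M a) i = ((R * M : ℝ) : ℂ) * a i := by
  classical
  have hE := EB_cont R M i
  have hpc : ∀ F, Continuous (fun p => par R M a F p * EB R M i p) := fun F => (par_cont R M a F).mul hE
  have hsc : Continuous (fun p => ser R M a p * EB R M i p) := (ser_cont ha).mul hE
  have h := unif_int (R := R) (M := M) hpc hsc (unif_mul hE (par_unif ha).tendstoUniformlyOn)
  have h1 : ∀ F, ∫ p, par R M a F p * EB R M i p ∂(nu R M) = if i ∈ F then ((R * M : ℝ) : ℂ) * a i else 0 := by
    intro F
    rw [← ibox_nu hR hM (hpc F)]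
    exact cf_sum hR hM F a i
  simp_rw [h1] at h
  rw [← ibox_nu hR hM hsc] at h
  have h2 : Tendsto (fun F : Finset (ℕ × ℤ) => if i ∈ F then ((R * M : ℝ) : ℂ) * a i else 0) atTop
      (𝓝 (((R * M : ℝ) : ℂ) * a i)) := by
    apply tendsto_const_nhds.congr'
    filter_upwards [eventually_ge_atTop {i}] with F hF
    rw [if_pos (hF (Finset.mem_singleton_self i))]
  exact tendsto_nhds_unique h h2

lemma fderiv_norm_le (f : ℝ × ℝ → ℂ) (p) : ‖fderiv ℝ f p‖ ≤ ‖dx f p‖ + ‖dy f p‖ := by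
  apply ContinuousLinearMap.opNorm_le_bound _ (by positivity)
  intro v
  have e : fderiv ℝ f p v = (v.1 : ℂ) * dx f p + (v.2 : ℂ) * dy f p := by
    have : v = v.1 • ((1 : ℝ), (0 : ℝ)) + v.2 • ((0 : ℝ), (1 : ℝ)) := by ext <;> simp
    conv_lhs => rw [this]
    rw [map_add, map_smul, map_smul]; simp [dx, dy]
  rw [e]
  refine (norm_add_le _ _).trans ?_
  rw [norm_mul, norm_mul, Complex.norm_real, Complex.norm_real]
  have h1 := norm_fst_le v
  have h2 := norm_snd_le v
  nlinarith [norm_nonneg (dx f p), norm_nonneg (dy f p)]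

lemma ser_c1 {R M : ℝ} (hR : 0 < R) {a : ℕ × ℤ → ℂ} (ha : Summable fun i => ‖a i‖)
    (ha1 : Summable fun i => Real.sqrt (lam R M i) * ‖a i‖) : ContDiff ℝ 1 (ser R M a) := by
  unfold ser
  refine contDiff_tsum (v := fun k i => if k = 0 then ‖a i‖ else 2 * (Real.sqrt (lam R M i) * ‖a i‖))
    (fun i => contDiff_const.mul (EE_cd R M i 1)) ?_ ?_
  · intro k _
    by_cases h : k = 0
    · simpa [h] using ha
    · simpa [h] using ha1.mul_left 2
  · intro k i p hk
    have hk1 : k ≤ 1 := by exact_mod_cast hk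
    interval_cases k
    · simp only [norm_iteratedFDeriv_zero]; exact term_le R M a i p
    · rw [norm_iteratedFDeriv_one]
      refine (fderiv_norm_le _ p).trans ?_
      have hd := c1d (EE_cd R M i 1) p
      rw [dx_mul (by fun_prop) hd, dy_mul (by fun_prop) hd]
      have z1 : dx (fun _ : ℝ × ℝ => a i) p = 0 := by unfold dx; simp
      have z2 : dy (fun _ : ℝ × ℝ => a i) p = 0 := by unfold dy; simp
      rw [z1, z2, dx_EE, dy_EE]
      simp only [zero_mul, zero_add, norm_mul, Complex.norm_real, Complex.norm_I, eC_norm, one_mul, mul_one]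
      have h1 : |fx R i.1| ≤ Real.sqrt (lam R M i) := Real.abs_le_sqrt (by unfold lam; nlinarith [sq_nonneg (fy M i.2)])
      have h2 : |fy M i.2| ≤ Real.sqrt (lam R M i) := Real.abs_le_sqrt (by unfold lam; nlinarith [sq_nonneg (fx R i.1)])
      simp only [Real.norm_eq_abs]
      have h3 := cC_norm R i.1 p.1
      have h4 := EE_norm R M i p
      have e1 : |fx R i.1| * ‖cC R i.1 p.1‖ ≤ Real.sqrt (lam R M i) * 1 := by gcongr
      have e2 : |fy M i.2| * ‖EE R M i p‖ ≤ Real.sqrt (lam R M i) * 1 := by gcongr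
      have := norm_nonneg (a i)
      simp
      nlinarith

end SM
end

open MeasureTheory Real Set Filter Topology

noncomputable section

namespace SM

lemma cf_sub {R M : ℝ} {f g : ℝ × ℝ → ℂ} (hf : Continuous f) (hg : Continuous g) (hR : 0 < R)
    (hM : 0 < M) (i) : cf R M (fun p => f p - g p) i = cf R M f i - cf R M g i := by
  unfold cf
  have hE := EB_cont R M i
  have h1 : Continuous fun p => f p * EB R M i p := hf.mul hE
  have h2 : Continuous fun p => g p * EB R M i p := hg.mul hE
  rw [ibox_nu hR hM h1, ibox_nu hR hM h2, ← integral_sub (nu_int h1) (nu_int h2)]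
  rw [ibox_nu hR hM (by fun_prop)]
  congr 1; ext p; ring

lemma ibox_nonneg {R M : ℝ} (hR : 0 < R) (hM : 0 < M) {f : ℝ × ℝ → ℝ} (hf : Continuous f)
    (h : ∀ p, 0 ≤ f p) : 0 ≤ ibox R M f := by
  rw [ibox_nu hR hM hf]; exact integral_nonneg h

lemma rellich {R M : ℝ} (hR : 0 < R) (hM : 0 < M) {ι : Type*} {l : Filter ι} [l.NeBot]
    {f : ι → ℝ × ℝ → ℂ} (hf : ∀ j, Continuous (f j)) {a : ℕ × ℤ → ℂ}
    (ha : ∀ i, Tendsto (fun j => cf R M (f j) i) l (𝓝 (a i))) {B : ℝ} (hB0 : 0 ≤ B)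
    (hB : ∀ j F, ∑ i ∈ F, lam R M i * ‖cf R M (f j) i‖ ^ 2 ≤ B)
    (hs : Summable fun i => ‖a i‖) :
    Tendsto (fun j => ibox R M (fun p => ‖f j p - ser R M (fun i => ((R * M : ℝ) : ℂ)⁻¹ * a i) p‖ ^ 2))
      l (𝓝 0) := by
  classical
  have hRM : 0 < R * M := by positivity
  set w := ser R M (fun i => ((R * M : ℝ) : ℂ)⁻¹ * a i) with hw
  have hs' : Summable fun i => ‖((R * M : ℝ) : ℂ)⁻¹ * a i‖ := by
    simp_rw [norm_mul]; exact hs.mul_left _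
  have hwc : Continuous w := ser_cont hs'
  have hcw : ∀ i, cf R M w i = a i := by
    intro i; rw [hw, cf_ser hR hM hs', mul_inv_cancel_left₀]
    exact_mod_cast hRM.ne'
  have hBa : ∀ F : Finset (ℕ × ℤ), ∑ i ∈ F, lam R M i * ‖a i‖ ^ 2 ≤ B := by
    intro F
    refine le_of_tendsto (f := fun j => ∑ i ∈ F, lam R M i * ‖cf R M (f j) i‖ ^ 2) (x := l) ?_
      (Eventually.of_forall fun j => hB j F)
    exact tendsto_finsetSum _ fun i _ => ((ha i).norm.pow 2).const_mul _
  rw [Metric.tendsto_nhds]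
  intro ε hε
  set Λ := 8 * (B + 1) / (R * M * ε) with hΛ
  have hΛ0 : 0 < Λ := by positivity
  obtain ⟨G, hG⟩ := lam_fin hR hM Λ
  have hGt : Tendsto (fun j => ∑ i ∈ G, ‖cf R M (f j) i - a i‖ ^ 2) l (𝓝 0) := by
    have : Tendsto (fun j => ∑ i ∈ G, ‖cf R M (f j) i - a i‖ ^ 2) l (𝓝 (∑ i ∈ G, ‖a i - a i‖ ^ 2)) :=
      tendsto_finsetSum _ fun i _ => ((ha i).sub_const _).norm.pow 2
    simpa using this
  filter_upwards [hGt.eventually_lt_const (show 0 < R * M * ε / 4 by positivity)] with j hj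
  have hc : Continuous (fun p => f j p - w p) := (hf j).sub hwc
  have key : R * M * ibox R M (fun p => ‖f j p - w p‖ ^ 2) ≤ R * M * ε / 4 + 4 * B / Λ := by
    apply parseval_le hR hM hc
    intro F
    simp_rw [cf_sub (hf j) hwc hR hM, hcw]
    have h1 : ∑ i ∈ F, ‖cf R M (f j) i - a i‖ ^ 2 ≤ ∑ i ∈ G, ‖cf R M (f j) i - a i‖ ^ 2
        + ∑ i ∈ F \ G, ‖cf R M (f j) i - a i‖ ^ 2 := by
      rw [← Finset.sum_union Finset.disjoint_sdiff]
      apply Finset.sum_le_sum_of_subset_of_nonneg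
      · intro i hi; by_cases h : i ∈ G <;> simp [h, hi]
      · intros; positivity
    have h2 : ∑ i ∈ F \ G, ‖cf R M (f j) i - a i‖ ^ 2 ≤ 4 * B / Λ := by
      rw [le_div_iff₀ hΛ0, Finset.sum_mul]
      calc _ ≤ ∑ i ∈ F \ G, (2 * (lam R M i * ‖cf R M (f j) i‖ ^ 2) + 2 * (lam R M i * ‖a i‖ ^ 2)) := by
            apply Finset.sum_le_sum
            intro i hi
            have hl := hG i (Finset.mem_sdiff.1 hi).2
            have hn : ‖cf R M (f j) i - a i‖ ^ 2 ≤ 2 * ‖cf R M (f j) i‖ ^ 2 + 2 * ‖a i‖ ^ 2 := by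
              have := norm_sub_le (cf R M (f j) i) (a i)
              nlinarith [sq_nonneg (‖cf R M (f j) i‖ - ‖a i‖), norm_nonneg (cf R M (f j) i - a i)]
            calc _ ≤ (2 * ‖cf R M (f j) i‖ ^ 2 + 2 * ‖a i‖ ^ 2) * lam R M i := by gcongr
              _ = _ := by ring
        _ ≤ _ := by
            rw [Finset.sum_add_distrib, ← Finset.mul_sum, ← Finset.mul_sum]
            linarith [hB j (F \ G), hBa (F \ G)]
    linarith
  have e2 : 4 * B / Λ ≤ R * M * ε / 2 := by
    rw [hΛ, div_le_iff₀ (by positivity)]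
    have : R * M * ε / 2 * (8 * (B + 1) / (R * M * ε)) = 4 * (B + 1) := by field_simp; ring
    rw [this]; linarith
  have h0 : 0 ≤ ibox R M (fun p => ‖f j p - w p‖ ^ 2) :=
    ibox_nonneg hR hM (by fun_prop) (fun p => by positivity)
  rw [dist_zero_right, Real.norm_of_nonneg h0]
  have : R * M * ibox R M (fun p => ‖f j p - w p‖ ^ 2) < R * M * ε := by
    have : 0 < R * M * ε := by positivity
    linarith
  exact lt_of_mul_lt_mul_left this hRM.le

lemma cf_le {R M : ℝ} (hR : 0 < R) (hM : 0 < M) {f : ℝ × ℝ → ℂ} (hf : Continuous f) (i) :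
    ‖cf R M f i‖ ^ 2 ≤ R * M * ibox R M (fun p => ‖f p‖ ^ 2) := by
  simpa using bessel_sin hR hM hf {i}

/-- the ultrafilter along which all limits are taken -/
def UU : Ultrafilter ℕ := hyperfilter ℕ

lemma UU_le : (UU : Filter ℕ) ≤ atTop := by
  have := hyperfilter_le_cofinite (α := ℕ)
  rwa [Nat.cofinite_eq_atTop] at this

lemma ulim {s : ℕ → ℂ} {B : ℝ} (h : ∀ j, ‖s j‖ ≤ B) : ∃ a, Tendsto s UU (𝓝 a) := by
  obtain ⟨a, _, ha⟩ := (isCompact_closedBall (0 : ℂ) B).ultrafilter_le_nhds (UU.map s) (by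
    rw [Ultrafilter.coe_map, le_principal_iff, mem_map]
    exact univ_mem' fun j => by simpa using h j)
  exact ⟨a, ha⟩

lemma ulimr {s : ℕ → ℝ} {B : ℝ} (h : ∀ j, |s j| ≤ B) : ∃ a, Tendsto s UU (𝓝 a) := by
  obtain ⟨a, _, ha⟩ := (isCompact_closedBall (0 : ℝ) B).ultrafilter_le_nhds (UU.map s) (by
    rw [Ultrafilter.coe_map, le_principal_iff, mem_map]
    exact univ_mem' fun j => by simpa using h j)
  exact ⟨a, ha⟩

end SM
end

open MeasureTheory Real Set Filter Topology

noncomputable section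

namespace SM

/-- the gauge-transformed covariant derivative -/
def D2 (v : ℝ × ℝ → ℂ) (p : ℝ × ℝ) : ℂ := dy v p - Complex.I * (p.1 * p.2 : ℝ) * v p
def gsq (v : ℝ × ℝ → ℂ) (p : ℝ × ℝ) : ℝ := ‖dx v p‖ ^ 2 + ‖D2 v p‖ ^ 2
def Bd (R : ℝ) (v : ℝ × ℝ → ℂ) : Prop := ∀ y, v (-R/2, y) = 0 ∧ v (R/2, y) = 0

/-- integrand of the weak Euler-Lagrange equation -/
def elI (κ : ℝ) (v ψ : ℝ × ℝ → ℂ) (p : ℝ × ℝ) : ℂ :=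
  dx v p * dx ψ p + D2 v p * (dy ψ p + Complex.I * (p.1 * p.2 : ℝ) * ψ p)
    + (κ * (‖v p‖ ^ 2 - 1) : ℝ) * v p * ψ p

lemma D2_cont {v : ℝ × ℝ → ℂ} (hv : ContDiff ℝ 1 v) : Continuous (D2 v) := by
  unfold D2
  have := dy_cont hv; have := hv.continuous
  fun_prop

lemma gsq_cont {v : ℝ × ℝ → ℂ} (hv : ContDiff ℝ 1 v) : Continuous (gsq v) := by
  unfold gsq
  have := dx_cont hv; have := D2_cont hv
  fun_prop

lemma elI_cont {κ : ℝ} {v ψ : ℝ × ℝ → ℂ} (hv : ContDiff ℝ 1 v) (hψ : ContDiff ℝ 1 ψ) :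
    Continuous (elI κ v ψ) := by
  unfold elI
  have := dx_cont hv; have := D2_cont hv; have := hv.continuous
  have := dx_cont hψ; have := dy_cont hψ; have := hψ.continuous
  fun_prop

structure Sq (R κ K : ℝ) (v : ℕ → ℝ × ℝ → ℂ) : Prop where
  c1 : ∀ j, ContDiff ℝ 1 (v j)
  bd : ∀ j, Bd R (v j)
  sup : ∀ j p, ‖v j p‖ ≤ 2
  ig : ∀ j, Integrable (gsq (v j)) (mu R)
  i2 : ∀ j, Integrable (fun p => ‖v j p‖ ^ 2) (mu R)
  bg : ∀ j, ∫ p, gsq (v j) p ∂(mu R) ≤ K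
  b2 : ∀ j, ∫ p, ‖v j p‖ ^ 2 ∂(mu R) ≤ K
  el : ∀ ψ, ContDiff ℝ 1 ψ → CptY ψ → Bd R ψ →
    Tendsto (fun j => ∫ p, elI κ (v j) ψ p ∂(mu R)) atTop (𝓝 0)

/-- a cutoff with three derivatives -/
structure Cut (M : ℝ) (χ c1 c2 c3 : ℝ → ℂ) : Prop where
  d1 : ∀ y, HasDerivAt χ (c1 y) y
  d2 : ∀ y, HasDerivAt c1 (c2 y) y
  d3 : ∀ y, HasDerivAt c2 (c3 y) y
  c : Continuous c3
  z : ∀ y, M < |y| → χ y = 0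
  z1 : ∀ y, M < |y| → c1 y = 0
  z2 : ∀ y, M < |y| → c2 y = 0
  z3 : ∀ y, M < |y| → c3 y = 0

lemma c1_of_deriv {f f' : ℝ → ℂ} (h : ∀ y, HasDerivAt f (f' y) y) (hf : Continuous f') :
    ContDiff ℝ 1 f := by
  rw [contDiff_one_iff_deriv]
  refine ⟨fun y => (h y).differentiableAt, ?_⟩
  rwa [show deriv f = f' from funext fun y => (h y).deriv]

lemma Cut.k2 {M : ℝ} {χ c1 c2 c3 : ℝ → ℂ} (h : Cut M χ c1 c2 c3) : ContDiff ℝ 1 c2 :=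
  c1_of_deriv h.d3 h.c
lemma Cut.k1 {M : ℝ} {χ c1 c2 c3 : ℝ → ℂ} (h : Cut M χ c1 c2 c3) : ContDiff ℝ 1 c1 :=
  c1_of_deriv h.d2 h.k2.continuous
lemma Cut.k0 {M : ℝ} {χ c1 c2 c3 : ℝ → ℂ} (h : Cut M χ c1 c2 c3) : ContDiff ℝ 1 χ :=
  c1_of_deriv h.d1 h.k1.continuous

lemma iadd {E : Type*} [NormedAddCommGroup E] {m : Measure (ℝ × ℝ)} {f g : ℝ × ℝ → E}
    (hf : Integrable f m) (hg : Integrable g m) : Integrable (fun p => f p + g p) m := hf.add hg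
lemma isub {E : Type*} [NormedAddCommGroup E] {m : Measure (ℝ × ℝ)} {f g : ℝ × ℝ → E}
    (hf : Integrable f m) (hg : Integrable g m) : Integrable (fun p => f p - g p) m := hf.sub hg

def GG (κ : ℝ) (χ c1 c2 : ℝ → ℂ) (v : ℝ × ℝ → ℂ) (p : ℝ × ℝ) : ℂ :=
  2 * c1 p.2 * dy v p + c2 p.2 * v p + χ p.2 * (Complex.I * (p.1 : ℝ) * v p
    + 2 * Complex.I * (p.1 * p.2 : ℝ) * dy v p + (p.1 ^ 2 * p.2 ^ 2 : ℝ) * v p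
    + (κ * (‖v p‖ ^ 2 - 1) : ℝ) * v p)

lemma GG_cont {κ M : ℝ} {χ c1 c2 c3 : ℝ → ℂ} (h : Cut M χ c1 c2 c3) {v : ℝ × ℝ → ℂ}
    (hv : ContDiff ℝ 1 v) : Continuous (GG κ χ c1 c2 v) := by
  unfold GG
  have := dy_cont hv; have := hv.continuous
  have := h.k0.continuous; have := h.k1.continuous; have := h.k2.continuous
  fun_prop

lemma GG_sy {κ M : ℝ} {χ c1 c2 c3 : ℝ → ℂ} (h : Cut M χ c1 c2 c3) (v : ℝ × ℝ → ℂ) :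
    Sy M (GG κ χ c1 c2 v) := by
  intro p hp
  unfold GG
  rw [h.z _ hp, h.z1 _ hp, h.z2 _ hp]; ring

lemma test_cd {R M M' : ℝ} {χ c1 c2 c3 : ℝ → ℂ} (h : Cut M' χ c1 c2 c3) (i) :
    ContDiff ℝ 1 (fun p : ℝ × ℝ => χ p.2 * EB R M i p) :=
  (h.k0.comp contDiff_snd).mul (EB_cd R M i 1)

lemma el1 {R M M' κ : ℝ} (hR : 0 < R) {χ c1 c2 c3 : ℝ → ℂ} (h : Cut M' χ c1 c2 c3)
    {v : ℝ × ℝ → ℂ} (hv : ContDiff ℝ 1 v) (hb : Bd R v) (i) :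
    ∫ p, elI κ v (fun p => χ p.2 * EB R M i p) p ∂(mu R)
      = lam R M i * ∫ p, χ p.2 * v p * EB R M i p ∂(mu R) + ∫ p, GG κ χ c1 c2 v p * EB R M i p ∂(mu R) := by
  set A : ℝ × ℝ → ℂ := fun p => v p * (χ p.2 * (fx R i.1 * CB R M i p)) with hA
  set b : ℝ × ℝ → ℂ := fun p => -c1 p.2 - Complex.I * fy M i.2 * χ p.2
    - Complex.I * (p.1 * p.2 : ℝ) * χ p.2 with hbdef
  set Bf : ℝ × ℝ → ℂ := fun p => v p * (b p * EB R M i p) with hB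
  have k0 := h.k0; have k1 := h.k1
  have s0 : ContDiff ℝ 1 (fun p : ℝ × ℝ => χ p.2) := k0.comp contDiff_snd
  have s1 : ContDiff ℝ 1 (fun p : ℝ × ℝ => c1 p.2) := k1.comp contDiff_snd
  have sxy : ContDiff ℝ 1 (fun p : ℝ × ℝ => ((p.1 * p.2 : ℝ) : ℂ)) :=
    Complex.ofRealCLM.contDiff.comp (contDiff_fst.mul contDiff_snd)
  have hbc : ContDiff ℝ 1 b := by
    rw [hbdef]
    exact (s1.neg.sub (contDiff_const.mul s0)).sub ((contDiff_const.mul sxy).mul s0)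
  have hEB := EB_cd R M i 1
  have hCB := CB_cd R M i 1
  have hAc : ContDiff ℝ 1 A := hv.mul (s0.mul (contDiff_const.mul hCB))
  have hBc : ContDiff ℝ 1 Bf := hv.mul (hbc.mul hEB)
  have hAs : Sy M' A := fun p hp => by simp [hA, h.z _ hp]
  have hBs : Sy M' Bf := fun p hp => by simp [hB, hbdef, h.z _ hp, h.z1 _ hp]
  have iA := int_dx_zero hR hAc hAs.cpt (fun y => by simp [hA, hb y])
  have iB := int_dy_zero (R := R) hBc hBs.cpt
  have dA : ∀ p, dx A p = dx v p * (χ p.2 * (fx R i.1 * CB R M i p))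
      - fx R i.1 ^ 2 * χ p.2 * v p * EB R M i p := by
    intro p
    rw [hA, dx_mul (c1d hv p) (c1d (s0.mul (contDiff_const.mul hCB)) p),
      dx_mul (f := fun p : ℝ × ℝ => χ p.2) (c1d s0 p) (c1d (contDiff_const.mul hCB) p),
      dx_mul (f := fun _ => (fx R i.1 : ℂ)) (by fun_prop) (c1d hCB p), dx_CB, dx_snd (h.d1 p.2)]
    have : dx (fun _ : ℝ × ℝ => (fx R i.1 : ℂ)) p = 0 := by unfold dx; simp
    rw [this]; ring
  have db : ∀ p, dy b p = -c2 p.2 - Complex.I * fy M i.2 * c1 p.2 - Complex.I * (p.1 : ℝ) * χ p.2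
      - Complex.I * (p.1 * p.2 : ℝ) * c1 p.2 := by
    intro p
    have e1 := hasDerivAt_dy hbc p.1 p.2
    have e2 : HasDerivAt (fun t => b (p.1, t)) (-c2 p.2 - Complex.I * fy M i.2 * c1 p.2
      - (Complex.I * (p.1 : ℝ) * χ p.2 + Complex.I * (p.1 * p.2 : ℝ) * c1 p.2)) p.2 := by
      have f1 : HasDerivAt (fun t : ℝ => Complex.I * ((p.1 * t : ℝ) : ℂ)) (Complex.I * (p.1 : ℝ)) p.2 := by
        have : HasDerivAt (fun t : ℝ => p.1 * t) p.1 p.2 := by simpa using (hasDerivAt_id p.2).const_mul p.1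
        exact this.ofReal_comp.const_mul Complex.I
      exact ((h.d2 p.2).neg.sub ((h.d1 p.2).const_mul (Complex.I * fy M i.2))).sub (f1.mul (h.d1 p.2))
    rw [show p = (p.1, p.2) from rfl, e1.unique e2]; ring
  have dB : ∀ p, dy Bf p = dy v p * (b p * EB R M i p) + v p * (dy b p * EB R M i p
      + b p * (-(Complex.I * fy M i.2 * EB R M i p))) := by
    intro p
    rw [hB, dy_mul (c1d hv p) (c1d (hbc.mul hEB) p), dy_mul (c1d hbc p) (c1d hEB p), dy_EB]
  have dψx : ∀ p, dx (fun p => χ p.2 * EB R M i p) p = χ p.2 * (fx R i.1 * CB R M i p) := by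
    intro p
    rw [dx_mul (f := fun p : ℝ × ℝ => χ p.2) (c1d s0 p) (c1d hEB p), dx_snd (h.d1 p.2), dx_EB]; ring
  have dψy : ∀ p, dy (fun p => χ p.2 * EB R M i p) p = c1 p.2 * EB R M i p
      + χ p.2 * (-(Complex.I * fy M i.2 * EB R M i p)) := by
    intro p
    rw [dy_mul (f := fun p : ℝ × ℝ => χ p.2) (c1d s0 p) (c1d hEB p), dy_snd (h.d1 p.2), dy_EB]
  have key : ∀ p, elI κ v (fun p => χ p.2 * EB R M i p) p = (lam R M i * (χ p.2 * v p * EB R M i p)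
      + GG κ χ c1 c2 v p * EB R M i p) + (dx A p + dy Bf p) := by
    intro p
    rw [dA, dB, db]
    unfold elI D2 GG lam
    rw [dψx, dψy]
    simp only [hbdef]
    push_cast
    linear_combination (-((p.1 : ℂ) ^ 2 * (p.2 : ℂ) ^ 2 + (fy M i.2 : ℂ) ^ 2) * χ p.2 * v p * EB R M i p) * Complex.I_sq
  simp_rw [key]
  have cE := EB_cont R M i; have := hv.continuous; have := k0.continuous
  have cG := GG_cont (κ := κ) h hv
  have i1 : Integrable (fun p => (lam R M i : ℂ) * (χ p.2 * v p * EB R M i p)) (mu R) :=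
    Sy.cpt (M := M') (fun p hp => by simp [h.z _ hp]) |>.integrable (by fun_prop)
  have i2 : Integrable (fun p => GG κ χ c1 c2 v p * EB R M i p) (mu R) :=
    (GG_sy h v).mul_left.cpt.integrable (by fun_prop)
  have i3 := hAs.dx.cpt.integrable (R := R) (dx_cont hAc)
  have i4 := hBs.dy.cpt.integrable (R := R) (dy_cont hBc)
  rw [integral_add (iadd i1 i2) (iadd i3 i4), integral_add i1 i2, integral_add i3 i4, iA, iB,
    integral_const_mul]
  simp

end SM
end

open MeasureTheory Real Set Filter Topology

noncomputable section

namespace SM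

lemma bdd_cpt {M : ℝ} {f : ℝ → ℂ} (hf : Continuous f) (hz : ∀ y, M < |y| → f y = 0) :
    ∃ A, 0 ≤ A ∧ ∀ y, ‖f y‖ ≤ A := by
  obtain ⟨A, hA⟩ := (isCompact_Icc (a := -M) (b := M)).exists_bound_of_continuousOn hf.continuousOn
  refine ⟨|A|, abs_nonneg _, fun y => ?_⟩
  by_cases h : M < |y|
  · rw [hz y h]; simp
  · exact (hA y (abs_le.1 (not_lt.1 h))).trans (le_abs_self A)

lemma Cut.bdd {M : ℝ} {χ c1 c2 c3 : ℝ → ℂ} (h : Cut M χ c1 c2 c3) :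
    ∃ A, 0 ≤ A ∧ ∀ y, ‖χ y‖ ≤ A ∧ ‖c1 y‖ ≤ A ∧ ‖c2 y‖ ≤ A ∧ ‖c3 y‖ ≤ A := by
  obtain ⟨A0, h0, k0⟩ := bdd_cpt h.k0.continuous h.z
  obtain ⟨A1, h1, k1⟩ := bdd_cpt h.k1.continuous h.z1
  obtain ⟨A2, h2, k2⟩ := bdd_cpt h.k2.continuous h.z2
  obtain ⟨A3, h3, k3⟩ := bdd_cpt h.c h.z3
  exact ⟨A0 + A1 + A2 + A3, by positivity, fun y => ⟨by linarith [k0 y], by linarith [k1 y],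
    by linarith [k2 y], by linarith [k3 y]⟩⟩

lemma dy_le_D2 (v : ℝ × ℝ → ℂ) (p : ℝ × ℝ) : ‖dy v p‖ ≤ ‖D2 v p‖ + |p.1| * |p.2| * ‖v p‖ := by
  have : dy v p = D2 v p + Complex.I * (p.1 * p.2 : ℝ) * v p := by unfold D2; ring
  rw [this]
  refine (norm_add_le _ _).trans ?_
  simp [Complex.norm_real]

lemma sq_lin {t α β a b : ℝ} (ht : 0 ≤ t) (h : t ≤ α * a + β * b) :
    t ^ 2 ≤ 2 * (α ^ 2 + β ^ 2) * (a ^ 2 + b ^ 2) := by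
  have h1 : t ^ 2 ≤ (α * a + β * b) ^ 2 := by gcongr
  nlinarith [sq_nonneg (α * b - β * a), sq_nonneg (α * a + β * b)]

lemma GG_bound {κ R M : ℝ} {χ c1 c2 c3 : ℝ → ℂ} (h : Cut M χ c1 c2 c3) :
    ∃ C, 0 ≤ C ∧ ∀ (v : ℝ × ℝ → ℂ) (p : ℝ × ℝ), |p.1| ≤ R / 2 → ‖v p‖ ≤ 2 →
      ‖GG κ χ c1 c2 v p‖ ^ 2 ≤ C * (gsq v p + ‖v p‖ ^ 2) := by
  obtain ⟨A, hA, hb⟩ := h.bdd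
  set X := R / 2 with hX
  set α := 2 * A + A * (2 * (X * M)) with hα
  set β := α * (X * M) + A + A * (X + X ^ 2 * M ^ 2 + |κ| * 5) with hβ
  refine ⟨2 * (α ^ 2 + β ^ 2), by positivity, fun v p hp hv => ?_⟩
  have hfin : ‖D2 v p‖ ^ 2 + ‖v p‖ ^ 2 ≤ gsq v p + ‖v p‖ ^ 2 := by
    unfold gsq; nlinarith [sq_nonneg ‖dx v p‖]
  by_cases hy : M < |p.2|
  · rw [GG_sy h v p hy]
    have : 0 ≤ gsq v p := by unfold gsq; positivity
    simp; positivity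
  rw [not_lt] at hy
  have hX0 : 0 ≤ X := (abs_nonneg _).trans hp
  have hM0 : 0 ≤ M := (abs_nonneg _).trans hy
  obtain ⟨b0, b1, b2, _⟩ := hb p.2
  have hxy : |p.1| * |p.2| ≤ X * M := by gcongr
  have hdy : ‖dy v p‖ ≤ ‖D2 v p‖ + X * M * ‖v p‖ := by
    refine (dy_le_D2 v p).trans ?_; gcongr
  have hk : |κ * (‖v p‖ ^ 2 - 1)| ≤ |κ| * 5 := by
    rw [abs_mul]; gcongr
    rw [abs_le]; constructor <;> nlinarith [norm_nonneg (v p)]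
  have main : ‖GG κ χ c1 c2 v p‖ ≤ 2 * A * ‖dy v p‖ + A * ‖v p‖ + A * (X * ‖v p‖
      + 2 * (X * M) * ‖dy v p‖ + X ^ 2 * M ^ 2 * ‖v p‖ + |κ| * 5 * ‖v p‖) := by
    unfold GG
    refine (norm_add₃_le).trans ?_
    have e1 : ‖2 * c1 p.2 * dy v p‖ ≤ 2 * A * ‖dy v p‖ := by
      rw [norm_mul, norm_mul]; simp only [Complex.norm_ofNat]; gcongr
    have e2 : ‖c2 p.2 * v p‖ ≤ A * ‖v p‖ := by rw [norm_mul]; gcongr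
    have e3 : ‖Complex.I * (p.1 : ℝ) * v p‖ ≤ X * ‖v p‖ := by
      simp only [norm_mul, Complex.norm_I, Complex.norm_real, Real.norm_eq_abs, one_mul]; gcongr
    have e4 : ‖2 * Complex.I * (p.1 * p.2 : ℝ) * dy v p‖ ≤ 2 * (X * M) * ‖dy v p‖ := by
      simp only [norm_mul, Complex.norm_I, Complex.norm_real, Real.norm_eq_abs, Complex.norm_ofNat, mul_one, abs_mul]
      gcongr
    have e5 : ‖((p.1 ^ 2 * p.2 ^ 2 : ℝ) : ℂ) * v p‖ ≤ X ^ 2 * M ^ 2 * ‖v p‖ := by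
      simp only [norm_mul, Complex.norm_real, Real.norm_eq_abs, abs_mul, abs_pow]
      gcongr
    have e6 : ‖((κ * (‖v p‖ ^ 2 - 1) : ℝ) : ℂ) * v p‖ ≤ |κ| * 5 * ‖v p‖ := by
      rw [norm_mul, Complex.norm_real, Real.norm_eq_abs]; gcongr
    have e7 : ‖χ p.2 * (Complex.I * (p.1 : ℝ) * v p
      + 2 * Complex.I * (p.1 * p.2 : ℝ) * dy v p + (p.1 ^ 2 * p.2 ^ 2 : ℝ) * v p
      + (κ * (‖v p‖ ^ 2 - 1) : ℝ) * v p)‖ ≤ A * (X * ‖v p‖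
      + 2 * (X * M) * ‖dy v p‖ + X ^ 2 * M ^ 2 * ‖v p‖ + |κ| * 5 * ‖v p‖) := by
      rw [norm_mul]
      gcongr
      refine (norm_add_le _ _).trans (add_le_add ?_ e6)
      exact (norm_add₃_le).trans (add_le_add (add_le_add e3 e4) e5)
    linarith
  have main2 : ‖GG κ χ c1 c2 v p‖ ≤ α * ‖D2 v p‖ + β * ‖v p‖ := by
    have : 2 * A * ‖dy v p‖ + A * ‖v p‖ + A * (X * ‖v p‖
      + 2 * (X * M) * ‖dy v p‖ + X ^ 2 * M ^ 2 * ‖v p‖ + |κ| * 5 * ‖v p‖)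
      = α * ‖dy v p‖ + (A + A * (X + X ^ 2 * M ^ 2 + |κ| * 5)) * ‖v p‖ := by rw [hα]; ring
    rw [this] at main
    have h2 : α * ‖dy v p‖ ≤ α * (‖D2 v p‖ + X * M * ‖v p‖) := by
      apply mul_le_mul_of_nonneg_left hdy; positivity
    rw [hβ]; nlinarith
  refine (sq_lin (norm_nonneg _) main2).trans ?_
  gcongr

def XV (χ : ℝ → ℂ) (v : ℝ × ℝ → ℂ) (p : ℝ × ℝ) : ℂ := χ p.2 * v p

lemma XV_c1 {M : ℝ} {χ c1 c2 c3 : ℝ → ℂ} (h : Cut M χ c1 c2 c3) {v : ℝ × ℝ → ℂ}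
    (hv : ContDiff ℝ 1 v) : ContDiff ℝ 1 (XV χ v) := (h.k0.comp contDiff_snd).mul hv

lemma XV_sy {M : ℝ} {χ c1 c2 c3 : ℝ → ℂ} (h : Cut M χ c1 c2 c3) (v : ℝ × ℝ → ℂ) :
    Sy M (XV χ v) := fun p hp => by unfold XV; rw [h.z _ hp, zero_mul]

lemma XV_bound {R M : ℝ} {χ c1 c2 c3 : ℝ → ℂ} (h : Cut M χ c1 c2 c3) :
    ∃ C, 0 ≤ C ∧ ∀ (v : ℝ × ℝ → ℂ), ContDiff ℝ 1 v → ∀ (p : ℝ × ℝ), |p.1| ≤ R / 2 →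
      ‖XV χ v p‖ ^ 2 ≤ C * (gsq v p + ‖v p‖ ^ 2) ∧
      ‖dx (XV χ v) p‖ ^ 2 ≤ C * (gsq v p + ‖v p‖ ^ 2) ∧
      ‖dy (XV χ v) p‖ ^ 2 ≤ C * (gsq v p + ‖v p‖ ^ 2) := by
  obtain ⟨A, hA, hb⟩ := h.bdd
  set X := R / 2 with hX
  set β := A + A * (X * M) with hβ
  refine ⟨2 * (A ^ 2 + β ^ 2) + A ^ 2, by positivity, fun v hv p hp => ?_⟩
  obtain ⟨b0, b1, _, _⟩ := hb p.2
  have s0 : ContDiff ℝ 1 (fun p : ℝ × ℝ => χ p.2) := h.k0.comp contDiff_snd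
  have g0 : 0 ≤ gsq v p := by unfold gsq; positivity
  have hβ2 : 0 ≤ 2 * (A ^ 2 + β ^ 2) := by positivity
  refine ⟨?_, ?_, ?_⟩
  · have : ‖XV χ v p‖ ^ 2 ≤ A ^ 2 * ‖v p‖ ^ 2 := by
      unfold XV; rw [norm_mul, mul_pow]; gcongr
    nlinarith [sq_nonneg ‖v p‖, mul_nonneg hβ2 g0, mul_nonneg hβ2 (sq_nonneg ‖v p‖), mul_nonneg (sq_nonneg A) g0]
  · have e : dx (XV χ v) p = χ p.2 * dx v p := by
      unfold XV
      rw [dx_mul (f := fun p : ℝ × ℝ => χ p.2) (c1d s0 p) (c1d hv p), dx_snd (h.d1 p.2)]; ring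
    have h1 : ‖dx (XV χ v) p‖ ^ 2 ≤ A ^ 2 * ‖dx v p‖ ^ 2 := by
      rw [e, norm_mul, mul_pow]; gcongr
    have h2 : A ^ 2 * ‖dx v p‖ ^ 2 ≤ A ^ 2 * gsq v p := by
      gcongr; unfold gsq; nlinarith [sq_nonneg ‖D2 v p‖]
    nlinarith [sq_nonneg ‖v p‖, mul_nonneg hβ2 g0, mul_nonneg hβ2 (sq_nonneg ‖v p‖), mul_nonneg (sq_nonneg A) (sq_nonneg ‖v p‖)]
  · by_cases hy : M < |p.2|
    · rw [(XV_sy h v).dy p hy]; simp; positivity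
    rw [not_lt] at hy
    have hX0 : 0 ≤ X := (abs_nonneg _).trans hp
    have hM0 : 0 ≤ M := (abs_nonneg _).trans hy
    have hxy : |p.1| * |p.2| ≤ X * M := by gcongr
    have hdy : ‖dy v p‖ ≤ ‖D2 v p‖ + X * M * ‖v p‖ := by
      refine (dy_le_D2 v p).trans ?_; gcongr
    have e : dy (XV χ v) p = c1 p.2 * v p + χ p.2 * dy v p := by
      unfold XV
      rw [dy_mul (f := fun p : ℝ × ℝ => χ p.2) (c1d s0 p) (c1d hv p), dy_snd (h.d1 p.2)]
    have h1 : ‖dy (XV χ v) p‖ ≤ A * ‖D2 v p‖ + β * ‖v p‖ := by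
      rw [e]
      refine (norm_add_le _ _).trans ?_
      rw [norm_mul, norm_mul]
      have e1 : ‖c1 p.2‖ * ‖v p‖ ≤ A * ‖v p‖ := by gcongr
      have e2 : ‖χ p.2‖ * ‖dy v p‖ ≤ A * (‖D2 v p‖ + X * M * ‖v p‖) := by gcongr
      rw [hβ]; nlinarith
    have h2 := sq_lin (norm_nonneg _) h1
    have h3 : 2 * (A ^ 2 + β ^ 2) * (‖D2 v p‖ ^ 2 + ‖v p‖ ^ 2) ≤ 2 * (A ^ 2 + β ^ 2) * (gsq v p + ‖v p‖ ^ 2) := by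
      gcongr; unfold gsq; nlinarith [sq_nonneg ‖dx v p‖]
    nlinarith [mul_nonneg (sq_nonneg A) g0, mul_nonneg (sq_nonneg A) (sq_nonneg ‖v p‖)]

lemma ae_strip (R : ℝ) : ∀ᵐ p ∂(mu R), |p.1| ≤ R / 2 ∧ |p.1| < R / 2 := by
  have : ∀ᵐ p ∂(mu R), p ∈ Strip R := ae_restrict_mem (measurableSet_Ioo.prod MeasurableSet.univ)
  filter_upwards [this] with p hp
  have : |p.1| < R / 2 := abs_lt.2 ⟨by have := hp.1.1; linarith, hp.1.2⟩
  exact ⟨this.le, this⟩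

lemma ib_le {R M M' κ K C : ℝ} (hR : 0 < R) (hM : 0 < M) (hMM : M' < M) {v : ℕ → ℝ × ℝ → ℂ}
    (hS : Sq R κ K v) (hC : 0 ≤ C) {g : ℝ × ℝ → ℂ} (hg : Continuous g) (hs : Sy M' g) (j : ℕ)
    (hb : ∀ p : ℝ × ℝ, |p.1| ≤ R / 2 → ‖g p‖ ^ 2 ≤ C * (gsq (v j) p + ‖v j p‖ ^ 2)) :
    ibox R M (fun p => ‖g p‖ ^ 2) ≤ 2 * C * K := by
  have hs2 : Sy M' (fun p => ‖g p‖ ^ 2) := fun p hp => by simp [hs p hp]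
  rw [← int_ibox hR hM hMM (by fun_prop) hs2]
  calc _ ≤ ∫ p, C * (gsq (v j) p + ‖v j p‖ ^ 2) ∂(mu R) := by
        apply integral_mono_ae (hs2.cpt.integrable (by fun_prop))
          ((iadd (hS.ig j) (hS.i2 j)).const_mul C)
        filter_upwards [ae_strip R] with p hp using hb p hp.1
    _ ≤ _ := by
        rw [integral_const_mul, integral_add (hS.ig j) (hS.i2 j)]
        nlinarith [hS.bg j, hS.b2 j]

lemma reg1 {R M M' κ K : ℝ} (hR : 0 < R) (hM : 0 < M) (hMM : M' < M) {v : ℕ → ℝ × ℝ → ℂ}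
    (hS : Sq R κ K v) {χ c1 c2 c3 : ℝ → ℂ} (h : Cut M' χ c1 c2 c3) :
    ∃ a : ℕ × ℤ → ℂ, ∃ B : ℝ, (∀ i, Tendsto (fun j => cf R M (XV χ (v j)) i) UU (𝓝 (a i))) ∧
      (∀ F : Finset (ℕ × ℤ), ∑ i ∈ F, lam R M i ^ 2 * ‖a i‖ ^ 2 ≤ B) ∧
      (∀ i, Tendsto (fun j => cf R M (GG κ χ c1 c2 (v j)) i) UU (𝓝 (-(lam R M i * a i)))) ∧
      Tendsto (fun j => ibox R M (fun p => ‖XV χ (v j) p -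
        ser R M (fun i => ((R * M : ℝ) : ℂ)⁻¹ * a i) p‖ ^ 2)) UU (𝓝 0) := by
  obtain ⟨C, hC, hCb⟩ := XV_bound (R := R) h
  obtain ⟨D, hD, hDb⟩ := GG_bound (R := R) (κ := κ) h
  have hK : 0 ≤ K := le_trans (integral_nonneg fun p => by positivity) (hS.b2 0)
  have hXc : ∀ j, Continuous (XV χ (v j)) := fun j => (XV_c1 h (hS.c1 j)).continuous
  have b0 : ∀ j, ibox R M (fun p => ‖XV χ (v j) p‖ ^ 2) ≤ 2 * C * K := fun j =>
    ib_le hR hM hMM hS hC (hXc j) (XV_sy h _) j (fun p hp => (hCb (v j) (hS.c1 j) p hp).1)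
  have bx : ∀ j, ibox R M (fun p => ‖dx (XV χ (v j)) p‖ ^ 2) ≤ 2 * C * K := fun j =>
    ib_le hR hM hMM hS hC (dx_cont (XV_c1 h (hS.c1 j))) (XV_sy h _).dx j
      (fun p hp => (hCb (v j) (hS.c1 j) p hp).2.1)
  have by' : ∀ j, ibox R M (fun p => ‖dy (XV χ (v j)) p‖ ^ 2) ≤ 2 * C * K := fun j =>
    ib_le hR hM hMM hS hC (dy_cont (XV_c1 h (hS.c1 j))) (XV_sy h _).dy j
      (fun p hp => (hCb (v j) (hS.c1 j) p hp).2.2)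
  have bG : ∀ j, ibox R M (fun p => ‖GG κ χ c1 c2 (v j) p‖ ^ 2) ≤ 2 * D * K := fun j =>
    ib_le hR hM hMM hS hD (GG_cont h (hS.c1 j)) (GG_sy h _) j
      (fun p hp => hDb (v j) p hp (hS.sup j p))
  have hex : ∀ i, ∃ a, Tendsto (fun j => cf R M (XV χ (v j)) i) UU (𝓝 a) := by
    intro i
    apply ulim (B := R * M * (2 * C * K) + 1)
    intro j
    have h1 := cf_le hR hM (hXc j) i
    have h2 : R * M * ibox R M (fun p => ‖XV χ (v j) p‖ ^ 2) ≤ R * M * (2 * C * K) := by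
      have := b0 j; gcongr
    nlinarith [sq_nonneg (‖cf R M (XV χ (v j)) i‖ - 1), norm_nonneg (cf R M (XV χ (v j)) i)]
  choose a ha using hex
  have hG : ∀ i, Tendsto (fun j => cf R M (GG κ χ c1 c2 (v j)) i) UU (𝓝 (-(lam R M i * a i))) := by
    intro i
    have hel := (hS.el _ (test_cd (R := R) (M := M) h i) (Sy.cpt (M := M') fun p hp => by
      simp [h.z _ hp]) (fun y => by simp [EB_bd hR M i y])).mono_left UU_le
    have := hel.sub ((ha i).const_mul (lam R M i : ℂ))
    rw [zero_sub] at this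
    refine this.congr fun j => ?_
    rw [el1 hR h (hS.c1 j) (hS.bd j) i]
    have cE := EB_cont R M i
    have e1 : ∫ p, χ p.2 * v j p * EB R M i p ∂(mu R) = cf R M (XV χ (v j)) i :=
      int_ibox hR hM hMM ((hXc j).mul cE) (XV_sy h (v j)).mul_left
    have e2 : ∫ p, GG κ χ c1 c2 (v j) p * EB R M i p ∂(mu R) = cf R M (GG κ χ c1 c2 (v j)) i :=
      int_ibox hR hM hMM ((GG_cont h (hS.c1 j)).mul cE) (GG_sy h (v j)).mul_left
    rw [e1, e2]; ring
  have hB : ∀ F : Finset (ℕ × ℤ), ∑ i ∈ F, lam R M i ^ 2 * ‖a i‖ ^ 2 ≤ R * M * (2 * D * K) := by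
    intro F
    have ht : Tendsto (fun j => ∑ i ∈ F, ‖cf R M (GG κ χ c1 c2 (v j)) i‖ ^ 2) UU
        (𝓝 (∑ i ∈ F, ‖-(lam R M i * a i)‖ ^ 2)) :=
      tendsto_finsetSum _ fun i _ => (hG i).norm.pow 2
    have e : ∑ i ∈ F, ‖-(lam R M i * a i)‖ ^ 2 = ∑ i ∈ F, lam R M i ^ 2 * ‖a i‖ ^ 2 := by
      apply Finset.sum_congr rfl; intro i _
      rw [norm_neg, norm_mul, mul_pow, Complex.norm_real, Real.norm_eq_abs, sq_abs]
    rw [← e]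
    refine le_of_tendsto' ht fun j => (bessel_sin hR hM (GG_cont h (hS.c1 j)) F).trans ?_
    have := bG j; gcongr
  refine ⟨a, R * M * (2 * D * K), ha, hB, hG, ?_⟩
  apply rellich hR hM hXc ha (B := 3 * (R * M * (2 * C * K))) (by positivity)
  · intro j F
    have h1 := bessel_dx hR hM hMM (XV_c1 h (hS.c1 j)) (XV_sy h _)
      (fun y => by have := hS.bd j y; simp [XV, this]) F
    have h2 := bessel_dy hR hM hMM (XV_c1 h (hS.c1 j)) (XV_sy h _) F
    have e : ∑ i ∈ F, lam R M i * ‖cf R M (XV χ (v j)) i‖ ^ 2 =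
      ∑ i ∈ F, fx R i.1 ^ 2 * ‖cf R M (XV χ (v j)) i‖ ^ 2 + ∑ i ∈ F, fy M i.2 ^ 2 * ‖cf R M (XV χ (v j)) i‖ ^ 2 := by
      rw [← Finset.sum_add_distrib]
      apply Finset.sum_congr rfl; intro i _; unfold lam; ring
    rw [e]
    have h3 : R * M * ibox R M (fun p => ‖dx (XV χ (v j)) p‖ ^ 2) ≤ R * M * (2 * C * K) := by
      have := bx j; gcongr
    have h4 : R * M * ibox R M (fun p => ‖dy (XV χ (v j)) p‖ ^ 2) ≤ R * M * (2 * C * K) := by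
      have := by' j; gcongr
    linarith
  · exact summable_of_weight (fun i => by have := lam_pos hR M i; positivity) (sum_lam2 hR hM) hB
      (fun i => norm_nonneg _)

end SM
end

open MeasureTheory Real Set Filter Topology

noncomputable section

namespace SM

lemma GG_nf {κ M : ℝ} {χ c1 c2 c3 : ℝ → ℂ} (h : Cut M χ c1 c2 c3) :
    ∃ α β γ : ℝ × ℝ → ℂ, ContDiff ℝ 1 α ∧ ContDiff ℝ 1 β ∧ ContDiff ℝ 1 γ ∧ Sy M α ∧ Sy M β ∧ Sy M γ ∧
      ∀ v p, GG κ χ c1 c2 v p = α p * dy v p + β p * v p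
        + γ p * (v p * (starRingEnd ℂ) (v p) * v p) := by
  have s0 : ContDiff ℝ 1 (fun p : ℝ × ℝ => χ p.2) := h.k0.comp contDiff_snd
  have s1 : ContDiff ℝ 1 (fun p : ℝ × ℝ => c1 p.2) := h.k1.comp contDiff_snd
  have s2 : ContDiff ℝ 1 (fun p : ℝ × ℝ => c2 p.2) := h.k2.comp contDiff_snd
  have sx : ContDiff ℝ 1 (fun p : ℝ × ℝ => ((p.1 : ℝ) : ℂ)) :=
    Complex.ofRealCLM.contDiff.comp contDiff_fst
  have sxy : ContDiff ℝ 1 (fun p : ℝ × ℝ => ((p.1 * p.2 : ℝ) : ℂ)) :=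
    Complex.ofRealCLM.contDiff.comp (contDiff_fst.mul contDiff_snd)
  refine ⟨fun p => 2 * c1 p.2 + 2 * Complex.I * (p.1 * p.2 : ℝ) * χ p.2,
    fun p => c2 p.2 + χ p.2 * (Complex.I * (p.1 : ℝ) + ((p.1 * p.2 : ℝ) : ℂ) * (p.1 * p.2 : ℝ) - κ),
    fun p => κ * χ p.2, ?_, ?_, ?_, ?_, ?_, ?_, ?_⟩
  · exact (contDiff_const.mul s1).add ((contDiff_const.mul sxy).mul s0)
  · exact s2.add (s0.mul (((contDiff_const.mul sx).add (sxy.mul sxy)).sub contDiff_const))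
  · exact contDiff_const.mul s0
  · intro p hp; simp [h.z _ hp, h.z1 _ hp]
  · intro p hp; simp [h.z _ hp, h.z2 _ hp]
  · intro p hp; simp [h.z _ hp]
  · intro v p
    have := Complex.mul_conj (v p)
    rw [Complex.normSq_eq_norm_sq] at this
    unfold GG
    rw [this]
    push_cast
    ring

lemma GG_cf {R M κ M' : ℝ} (hR : 0 < R) (hM : 0 < M) (hMM : M' < M) {χ c1 c2 c3 : ℝ → ℂ}
    (h : Cut M' χ c1 c2 c3) (i) :
    ∃ Q P : ℝ × ℝ → ℂ, Continuous Q ∧ Continuous P ∧ Sy M' Q ∧ Sy M' P ∧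
      ∀ v, ContDiff ℝ 1 v → cf R M (GG κ χ c1 c2 v) i
        = ibox R M (fun p => v p * Q p + (‖v p‖ ^ 2 : ℝ) * v p * P p) := by
  obtain ⟨α, β, γ, ca, cb, cg, sa, sb, sg, hG⟩ := GG_nf (κ := κ) h
  have hE := EB_cd R M i 1
  have hd := dy_cont (ca.mul hE)
  have hEc := hE.continuous
  have ka := ca.continuous; have kb := cb.continuous; have kg := cg.continuous
  have hs : Sy M' (fun p => α p * EB R M i p) := sa.mul_left
  refine ⟨fun p => β p * EB R M i p - dy (fun p => α p * EB R M i p) p, fun p => γ p * EB R M i p,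
    (kb.mul hEc).sub hd, kg.mul hEc, ?_, sg.mul_left, ?_⟩
  · intro p hp
    show β p * EB R M i p - dy (fun p => α p * EB R M i p) p = 0
    rw [sb p hp, hs.dy p hp]; simp
  intro v hv
  have cv := hv.continuous
  have cdv := dy_cont hv
  have e0 := ibp_y (R := R) hv (ca.mul hE) hs.cpt
  have i1 : Integrable (fun p => dy v p * (α p * EB R M i p)) (mu R) :=
    hs.cpt.mul_right.integrable (cdv.mul (ka.mul hEc))
  have i2 : Integrable (fun p => v p * dy (fun p => α p * EB R M i p) p) (mu R) :=
    hs.dy.cpt.mul_right.integrable (cv.mul hd)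
  have s3 : Sy M' (fun p => β p * v p * EB R M i p + γ p * ((‖v p‖ ^ 2 : ℝ) * v p) * EB R M i p) := by
    intro p hp; simp [sb p hp, sg p hp]
  have i3 := s3.cpt.integrable (R := R) (by fun_prop)
  unfold cf
  rw [← int_ibox hR hM hMM (by have := GG_cont (κ := κ) h hv; fun_prop) (GG_sy h v).mul_left,
    ← int_ibox hR hM hMM (by fun_prop) (M' := M')]
  · have l1 : ∀ p, GG κ χ c1 c2 v p * EB R M i p = dy v p * (α p * EB R M i p)
        + (β p * v p * EB R M i p + γ p * ((‖v p‖ ^ 2 : ℝ) * v p) * EB R M i p) := by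
      intro p
      rw [hG]
      have := Complex.mul_conj (v p)
      rw [Complex.normSq_eq_norm_sq] at this
      rw [this]; ring
    have l2 : ∀ p, v p * (β p * EB R M i p - dy (fun p => α p * EB R M i p) p)
        + (‖v p‖ ^ 2 : ℝ) * v p * (γ p * EB R M i p)
        = (β p * v p * EB R M i p + γ p * ((‖v p‖ ^ 2 : ℝ) * v p) * EB R M i p)
          - v p * dy (fun p => α p * EB R M i p) p := by intro p; ring
    simp_rw [l1, l2]
    rw [integral_add i1 i3, integral_sub i3 i2, e0]; ring
  · intro p hp
    simp [sb p hp, sg p hp, hs.dy p hp]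

/-- L² convergence on a finite measure space gives L¹ convergence -/
lemma l1_of_l2 {ι : Type*} {l : Filter ι} {m : Measure (ℝ × ℝ)} [IsFiniteMeasure m]
    {f : ι → ℝ × ℝ → ℝ} (h0 : ∀ j p, 0 ≤ f j p) (hi : ∀ j, Integrable (f j) m)
    (hi2 : ∀ j, Integrable (fun p => f j p ^ 2) m)
    (h : Tendsto (fun j => ∫ p, f j p ^ 2 ∂m) l (𝓝 0)) :
    Tendsto (fun j => ∫ p, f j p ∂m) l (𝓝 0) := by
  rw [Metric.tendsto_nhds] at h ⊢
  intro ε hε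
  set V := m.real univ with hV
  have hV0 : 0 ≤ V := measureReal_nonneg
  set δ := ε / (2 * (V + 1)) with hδ
  have hδ0 : 0 < δ := by positivity
  filter_upwards [h (δ * (ε / 2)) (by positivity)] with j hj
  simp only [Real.dist_eq, sub_zero] at hj ⊢
  have n1 : 0 ≤ ∫ p, f j p ∂m := integral_nonneg (h0 j)
  have n2 : 0 ≤ ∫ p, f j p ^ 2 ∂m := integral_nonneg (fun p => by positivity)
  rw [abs_of_nonneg n1]
  rw [abs_of_nonneg n2] at hj
  have : ∫ p, f j p ∂m ≤ ∫ p, (δ + δ⁻¹ * f j p ^ 2) ∂m := by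
    apply integral_mono (hi j) ((integrable_const _).add ((hi2 j).const_mul _))
    intro p
    have h1 : f j p * δ ≤ δ ^ 2 + f j p ^ 2 := by nlinarith [sq_nonneg (f j p - δ), h0 j p]
    have h2 : δ + δ⁻¹ * f j p ^ 2 = (δ ^ 2 + f j p ^ 2) / δ := by field_simp
    show f j p ≤ δ + δ⁻¹ * f j p ^ 2
    rw [h2, le_div_iff₀ hδ0]; exact h1
  rw [integral_add (integrable_const _) ((hi2 j).const_mul _), integral_const, integral_const_mul,
    smul_eq_mul, ← hV] at this
  have e1 : V * δ ≤ ε / 2 := by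
    rw [hδ, ← mul_div_assoc, div_le_div_iff₀ (by positivity) (by norm_num)]
    nlinarith
  have e2 : δ⁻¹ * ∫ p, f j p ^ 2 ∂m < ε / 2 := by
    rw [inv_mul_lt_iff₀ hδ0]; exact hj
  linarith

lemma cube_lip {z w : ℂ} {C : ℝ} (hz : ‖z‖ ≤ C) (hw : ‖w‖ ≤ C) :
    ‖((‖z‖ ^ 2 : ℝ) : ℂ) * z - ((‖w‖ ^ 2 : ℝ) : ℂ) * w‖ ≤ 3 * C ^ 2 * ‖z - w‖ := by
  have e : ((‖z‖ ^ 2 : ℝ) : ℂ) * z - ((‖w‖ ^ 2 : ℝ) : ℂ) * w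
      = ((‖z‖ ^ 2 : ℝ) : ℂ) * (z - w) + (((‖z‖ - ‖w‖) * (‖z‖ + ‖w‖) : ℝ) : ℂ) * w := by
    push_cast; ring
  rw [e]
  refine (norm_add_le _ _).trans ?_
  rw [norm_mul, norm_mul, Complex.norm_real, Complex.norm_real, Real.norm_eq_abs, Real.norm_eq_abs,
    abs_of_nonneg (by positivity : (0:ℝ) ≤ ‖z‖ ^ 2), abs_mul, abs_of_nonneg (by positivity : 0 ≤ ‖z‖ + ‖w‖)]
  have h1 : |‖z‖ - ‖w‖| ≤ ‖z - w‖ := abs_norm_sub_norm_le z w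
  have h0 := norm_nonneg (z - w)
  have hC : 0 ≤ C := (norm_nonneg z).trans hz
  have a1 : ‖z‖ ^ 2 ≤ C ^ 2 := by gcongr
  have a2 : |‖z‖ - ‖w‖| * (‖z‖ + ‖w‖) * ‖w‖ ≤ ‖z - w‖ * (C + C) * C := by gcongr
  nlinarith

lemma nl_conv {R M : ℝ} (hR : 0 < R) (hM : 0 < M) {ι : Type*} {l : Filter ι} {f : ι → ℝ × ℝ → ℂ}
    {w Q P : ℝ × ℝ → ℂ} (hf : ∀ j, Continuous (f j)) (hw : Continuous w) (hQ : Continuous Q)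
    (hP : Continuous P) {C : ℝ} (hfC : ∀ j p, ‖f j p‖ ≤ C) (hwC : ∀ p, ‖w p‖ ≤ C)
    (h : Tendsto (fun j => ibox R M (fun p => ‖f j p - w p‖ ^ 2)) l (𝓝 0)) :
    Tendsto (fun j => ibox R M (fun p => f j p * Q p + (‖f j p‖ ^ 2 : ℝ) * f j p * P p)) l
      (𝓝 (ibox R M (fun p => w p * Q p + (‖w p‖ ^ 2 : ℝ) * w p * P p))) := by
  have hd : ∀ j, Continuous (fun p => f j p - w p) := fun j => (hf j).sub hw
  have hc1 : ∀ j, Continuous (fun p => f j p * Q p + (‖f j p‖ ^ 2 : ℝ) * f j p * P p) := by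
    intro j; have := hf j; fun_prop
  have hc2 : Continuous (fun p => w p * Q p + (‖w p‖ ^ 2 : ℝ) * w p * P p) := by fun_prop
  simp_rw [fun j => ibox_nu hR hM (hc1 j), ibox_nu hR hM hc2]
  simp_rw [fun j => ibox_nu hR hM (by have := hd j; fun_prop : Continuous fun p => ‖f j p - w p‖ ^ 2)] at h
  have : IsFiniteMeasure (nu R M) := by
    have := (nu_int (R := R) (M := M) (f := fun _ : ℝ × ℝ => (1:ℝ)) continuous_const)
    exact (integrable_const_iff_isFiniteMeasure one_ne_zero).1 this
  have h1 := l1_of_l2 (m := nu R M) (f := fun j p => ‖f j p - w p‖) (fun j p => norm_nonneg _)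
    (fun j => nu_int (hd j).norm) (fun j => nu_int ((hd j).norm.pow 2)) h
  obtain ⟨q, hq0, hq⟩ := bdd_box (R := R) (M := M) hQ
  obtain ⟨r, hr0, hr⟩ := bdd_box (R := R) (M := M) hP
  rw [tendsto_iff_norm_sub_tendsto_zero]
  have h2 := h1.const_mul (q + 3 * C ^ 2 * r)
  rw [mul_zero] at h2
  refine squeeze_zero (fun j => norm_nonneg _) (fun j => ?_) h2
  rw [← integral_sub (nu_int (hc1 j)) (nu_int hc2), ← integral_const_mul]
  refine norm_integral_le_of_norm_le ((nu_int (hd j).norm).const_mul _) ?_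
  have : ∀ᵐ p ∂(nu R M), p ∈ Ioo (-R/2) (R/2) ×ˢ Ioo (-M) M :=
    ae_restrict_mem (measurableSet_Ioo.prod measurableSet_Ioo)
  filter_upwards [this] with p hp
  have hp' : p ∈ Icc (-R/2) (R/2) ×ˢ Icc (-M) M := ⟨Ioo_subset_Icc_self hp.1, Ioo_subset_Icc_self hp.2⟩
  have e : f j p * Q p + (‖f j p‖ ^ 2 : ℝ) * f j p * P p - (w p * Q p + (‖w p‖ ^ 2 : ℝ) * w p * P p)
     = (f j p - w p) * Q p + ((‖f j p‖ ^ 2 : ℝ) * f j p - (‖w p‖ ^ 2 : ℝ) * w p) * P p := by ring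
  rw [e]
  refine (norm_add_le _ _).trans ?_
  rw [norm_mul, norm_mul]
  have b1 := hq p hp'
  have b2 := hr p hp'
  have b3 := cube_lip (hfC j p) (hwC p)
  calc _ ≤ ‖f j p - w p‖ * q + (3 * C ^ 2 * ‖f j p - w p‖) * r := by gcongr
    _ = _ := by ring

end SM
end

open MeasureTheory Real Set Filter Topology

noncomputable section

namespace SM

lemma GG_c1 {κ M : ℝ} {χ c1 c2 c3 : ℝ → ℂ} (h : Cut M χ c1 c2 c3) {w : ℝ × ℝ → ℂ}
    (hw : ContDiff ℝ 2 w) : ContDiff ℝ 1 (GG κ χ c1 c2 w) := by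
  obtain ⟨α, β, γ, ca, cb, cg, sa, sb, sg, hG⟩ := GG_nf (κ := κ) h
  have h1 : ContDiff ℝ 1 w := hw.of_le (by norm_num)
  have h2 : ContDiff ℝ 1 (dy w) := dy_contDiff (n := 1) (by norm_num; exact hw)
  rw [show GG κ χ c1 c2 w = _ from funext (hG w)]
  exact ((ca.mul h2).add (cb.mul h1)).add (cg.mul ((h1.mul (conj_c1 h1)).mul h1))

lemma dyGG_bound {κ R M M' S : ℝ} {χ c1 c2 c3 : ℝ → ℂ} (h : Cut M' χ c1 c2 c3) (hS : 0 ≤ S) :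
    ∃ C, 0 ≤ C ∧ ∀ w : ℝ × ℝ → ℂ, ContDiff ℝ 2 w → (∀ p, ‖w p‖ ≤ S) →
      ∀ p ∈ Icc (-R/2) (R/2) ×ˢ Icc (-M) M, ‖dy (GG κ χ c1 c2 w) p‖ ^ 2
        ≤ C * (‖dy (dy w) p‖ ^ 2 + ‖dy w p‖ ^ 2 + ‖w p‖ ^ 2) := by
  obtain ⟨α, β, γ, ca, cb, cg, sa, sb, sg, hG⟩ := GG_nf (κ := κ) h
  obtain ⟨A1, p1, b1⟩ := bdd_box (R := R) (M := M) ca.continuous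
  obtain ⟨A2, p2, b2⟩ := bdd_box (R := R) (M := M) cb.continuous
  obtain ⟨A3, p3, b3⟩ := bdd_box (R := R) (M := M) cg.continuous
  obtain ⟨A4, p4, b4⟩ := bdd_box (R := R) (M := M) (dy_cont ca)
  obtain ⟨A5, p5, b5⟩ := bdd_box (R := R) (M := M) (dy_cont cb)
  obtain ⟨A6, p6, b6⟩ := bdd_box (R := R) (M := M) (dy_cont cg)
  set X := A4 + A2 + 3 * A3 * S ^ 2 with hX
  set Y := A5 + A6 * S ^ 2 with hY
  refine ⟨3 * (A1 ^ 2 + X ^ 2 + Y ^ 2), by positivity, fun w hw hwS p hp => ?_⟩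
  have h1 : ContDiff ℝ 1 w := hw.of_le (by norm_num)
  have h2 : ContDiff ℝ 1 (dy w) := dy_contDiff (n := 1) (by norm_num; exact hw)
  have hc := conj_c1 h1
  have hcub : ContDiff ℝ 1 (fun q => w q * (starRingEnd ℂ) (w q) * w q) := (h1.mul hc).mul h1
  have hab : ContDiff ℝ 1 (fun q => w q * (starRingEnd ℂ) (w q)) := h1.mul hc
  have t1 : ContDiff ℝ 1 (fun q => α q * dy w q) := ca.mul h2
  have t2 : ContDiff ℝ 1 (fun q => β q * w q) := cb.mul h1
  have t3 : ContDiff ℝ 1 (fun q => γ q * (w q * (starRingEnd ℂ) (w q) * w q)) := cg.mul hcub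
  have t12 : ContDiff ℝ 1 (fun q => α q * dy w q + β q * w q) := t1.add t2
  have e : dy (GG κ χ c1 c2 w) p = α p * dy (dy w) p + (dy α p * dy w p + β p * dy w p
      + γ p * ((dy w p * (starRingEnd ℂ) (w p) + w p * (starRingEnd ℂ) (dy w p)) * w p
        + w p * (starRingEnd ℂ) (w p) * dy w p))
      + (dy β p * w p + dy γ p * (w p * (starRingEnd ℂ) (w p) * w p)) := by
    rw [show GG κ χ c1 c2 w = _ from funext (hG w), dy_add (c1d t12 p) (c1d t3 p),
      dy_add (c1d t1 p) (c1d t2 p), dy_mul (c1d ca p) (c1d h2 p), dy_mul (c1d cb p) (c1d h1 p),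
      dy_mul (c1d cg p) (c1d hcub p), dy_mul (c1d hab p) (c1d h1 p), dy_mul (c1d h1 p) (c1d hc p), dy_conj]
    ring
  have hwp := hwS p
  have n0 := norm_nonneg (w p)
  have n1 := norm_nonneg (dy w p)
  have n2 := norm_nonneg (dy (dy w) p)
  have E : ‖dy (GG κ χ c1 c2 w) p‖ ≤ A1 * ‖dy (dy w) p‖ + X * ‖dy w p‖ + Y * ‖w p‖ := by
    rw [e]
    refine norm_add₃_le.trans ?_
    have q1 : ‖α p * dy (dy w) p‖ ≤ A1 * ‖dy (dy w) p‖ := by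
      rw [norm_mul]; gcongr; exact b1 p hp
    have q2 : ‖dy α p * dy w p + β p * dy w p
      + γ p * ((dy w p * (starRingEnd ℂ) (w p) + w p * (starRingEnd ℂ) (dy w p)) * w p
        + w p * (starRingEnd ℂ) (w p) * dy w p)‖ ≤ X * ‖dy w p‖ := by
      refine norm_add₃_le.trans ?_
      have r1 : ‖dy α p * dy w p‖ ≤ A4 * ‖dy w p‖ := by
        rw [norm_mul]; gcongr; exact b4 p hp
      have r2 : ‖β p * dy w p‖ ≤ A2 * ‖dy w p‖ := by
        rw [norm_mul]; gcongr; exact b2 p hp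
      have r3 : ‖(dy w p * (starRingEnd ℂ) (w p) + w p * (starRingEnd ℂ) (dy w p)) * w p
        + w p * (starRingEnd ℂ) (w p) * dy w p‖ ≤ 3 * S ^ 2 * ‖dy w p‖ := by
        refine (norm_add_le _ _).trans ?_
        rw [norm_mul, norm_mul, norm_mul, RCLike.norm_conj]
        have z := norm_add_le (dy w p * (starRingEnd ℂ) (w p)) (w p * (starRingEnd ℂ) (dy w p))
        rw [norm_mul, norm_mul, RCLike.norm_conj, RCLike.norm_conj] at z
        have : ‖w p‖ * ‖w p‖ ≤ S * S := by gcongr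
        have z2 := mul_le_mul_of_nonneg_right z n0
        nlinarith
      have r4 : ‖γ p * ((dy w p * (starRingEnd ℂ) (w p) + w p * (starRingEnd ℂ) (dy w p)) * w p
        + w p * (starRingEnd ℂ) (w p) * dy w p)‖ ≤ A3 * (3 * S ^ 2 * ‖dy w p‖) := by
        rw [norm_mul]; gcongr; exact b3 p hp
      rw [hX]; linarith
    have q3 : ‖dy β p * w p + dy γ p * (w p * (starRingEnd ℂ) (w p) * w p)‖ ≤ Y * ‖w p‖ := by
      refine (norm_add_le _ _).trans ?_
      have r1 : ‖dy β p * w p‖ ≤ A5 * ‖w p‖ := by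
        rw [norm_mul]; gcongr; exact b5 p hp
      have r2 : ‖dy γ p * (w p * (starRingEnd ℂ) (w p) * w p)‖ ≤ A6 * (S * S * ‖w p‖) := by
        rw [norm_mul, norm_mul, norm_mul, RCLike.norm_conj]; gcongr; exact b6 p hp
      rw [hY]; linarith
    linarith
  have hE2 : ‖dy (GG κ χ c1 c2 w) p‖ ^ 2 ≤ (A1 * ‖dy (dy w) p‖ + X * ‖dy w p‖ + Y * ‖w p‖) ^ 2 := by
    gcongr
  have cs : ∀ a b c x y z : ℝ, (a * x + b * y + c * z) ^ 2 ≤ 3 * (a ^ 2 + b ^ 2 + c ^ 2) * (x ^ 2 + y ^ 2 + z ^ 2) := by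
    intro a b c x y z
    nlinarith [sq_nonneg (a * y - b * x), sq_nonneg (a * z - c * x), sq_nonneg (b * z - c * y),
      sq_nonneg (a * x + b * y + c * z)]
  exact hE2.trans (cs _ _ _ _ _ _)

lemma dy_par (R M : ℝ) (a : ℕ × ℤ → ℂ) (F : Finset (ℕ × ℤ)) :
    dy (par R M a F) = par R M (fun i => a i * (Complex.I * fy M i.2)) F := by
  funext p
  show dy (fun p => ∑ i ∈ F, a i * EE R M i p) p = _
  rw [dy_sum F (fun i _ => (c1d (EE_cd R M i 1) p).const_mul (a i))]
  refine Finset.sum_congr rfl fun i _ => ?_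
  rw [dy_mul (f := fun _ => a i) (by fun_prop) (c1d (EE_cd R M i 1) p), dy_EE]
  have : dy (fun _ : ℝ × ℝ => a i) p = 0 := by unfold dy; simp
  rw [this]; ring

lemma par_l2 {R M : ℝ} (hR : 0 < R) (hM : 0 < M) (F : Finset (ℕ × ℤ)) (c : ℕ × ℤ → ℂ) :
    ibox R M (fun p => ‖par R M c F p‖ ^ 2) ≤ R * M * ∑ i ∈ F, ‖c i‖ ^ 2 := sum_norm_le hR hM F c

lemma unif_l2 {R M : ℝ} (hR : 0 < R) (hM : 0 < M) {ι : Type*} {l : Filter ι} {f : ι → ℝ × ℝ → ℂ}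
    {w : ℝ × ℝ → ℂ} (hf : ∀ j, Continuous (f j)) (hw : Continuous w)
    (h : TendstoUniformly f w l) :
    Tendsto (fun j => ibox R M (fun p => ‖f j p - w p‖ ^ 2)) l (𝓝 0) := by
  have hd : ∀ j, Continuous (fun p => f j p - w p) := fun j => (hf j).sub hw
  have hfin : IsFiniteMeasure (nu R M) := by
    have := (nu_int (R := R) (M := M) (f := fun _ : ℝ × ℝ => (1:ℝ)) continuous_const)
    exact (integrable_const_iff_isFiniteMeasure one_ne_zero).1 this
  set V := (nu R M).real univ with hV
  have hV0 : 0 ≤ V := measureReal_nonneg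
  rw [Metric.tendsto_nhds]
  intro ε hε
  rw [Metric.tendstoUniformly_iff] at h
  have hδ : 0 < min 1 (ε / (V + 1)) := by positivity
  filter_upwards [h _ hδ] with j hj
  have c0 : Continuous fun p => ‖f j p - w p‖ ^ 2 := by have := hd j; fun_prop
  rw [Real.dist_eq, sub_zero, abs_of_nonneg (ibox_nonneg hR hM c0 (fun p => by positivity)),
    ibox_nu hR hM c0]
  have : ∫ p, ‖f j p - w p‖ ^ 2 ∂(nu R M) ≤ ∫ _p, ε / (V + 1) ∂(nu R M) := by
    apply integral_mono (nu_int c0) (integrable_const _)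
    intro p
    have := hj p
    rw [dist_comm, dist_eq_norm] at this
    have t1 := this.le.trans (min_le_left _ _)
    have t2 := this.le.trans (min_le_right _ _)
    show ‖f j p - w p‖ ^ 2 ≤ _
    nlinarith [norm_nonneg (f j p - w p)]
  rw [integral_const, smul_eq_mul, ← hV] at this
  refine this.trans_lt ?_
  rw [← mul_div_assoc, div_lt_iff₀ (by positivity)]
  nlinarith

lemma reg2 {R M M' M'' κ K : ℝ} (hR : 0 < R) (hM : 0 < M) (hMM : M' < M) (hMM2 : M'' < M)
    {v : ℕ → ℝ × ℝ → ℂ}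
    (hS : Sq R κ K v) {χ c1 c2 c3 : ℝ → ℂ} (h : Cut M' χ c1 c2 c3) {χ' c1' c2' c3' : ℝ → ℂ}
    (h' : Cut M'' χ' c1' c2' c3') (hone : ∀ y, |y| ≤ M' → χ' y = 1) :
    ∃ w : ℝ × ℝ → ℂ, ContDiff ℝ 1 w ∧ Bd R w ∧
      Tendsto (fun j => ibox R M (fun p => ‖XV χ (v j) p - w p‖ ^ 2)) UU (𝓝 0) := by
  obtain ⟨a, B, -, haB, haG, haL⟩ := reg1 hR hM hMM hS h
  obtain ⟨b, B', -, hbB, -, hbL⟩ := reg1 hR hM hMM2 hS h'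
  have hRM : 0 < R * M := by positivity
  have sa : Summable fun i => ‖a i‖ := summable_of_weight (W := fun i => lam R M i ^ 2)
    (fun i => by have := lam_pos hR M i; positivity) (sum_lam2 hR hM) haB (fun i => norm_nonneg _)
  have sb : Summable fun i => ‖b i‖ := summable_of_weight (W := fun i => lam R M i ^ 2)
    (fun i => by have := lam_pos hR M i; positivity) (sum_lam2 hR hM) hbB (fun i => norm_nonneg _)
  set b' : ℕ × ℤ → ℂ := fun i => ((R * M : ℝ) : ℂ)⁻¹ * b i with hb'
  have nb' : ∀ i, ‖b' i‖ = (R * M)⁻¹ * ‖b i‖ := fun i => by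
    rw [hb', norm_mul, norm_inv, Complex.norm_real, Real.norm_of_nonneg hRM.le]
  have sb' : Summable fun i => ‖b' i‖ := by
    simp_rw [nb']; exact sb.mul_left _
  obtain ⟨A, hA, hAb⟩ := h'.bdd
  -- limit of the coefficients of GG along partial sums
  set S := ∑' i, ‖b' i‖ with hSdef
  have hS0 : 0 ≤ S := tsum_nonneg fun i => norm_nonneg _
  have hser : ∀ p, ‖ser R M b' p‖ ≤ S := fun p => by
    have := (par_unif (R := R) (M := M) sb').tendsto_at p
    exact le_of_tendsto this.norm (Eventually.of_forall fun F => par_norm sb' F p)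
  have lim : ∀ i, Tendsto (fun F => cf R M (GG κ χ c1 c2 (par R M b' F)) i) atTop
      (𝓝 (-(lam R M i * a i))) := by
    intro i
    obtain ⟨Q, P, cQ, cP, sQ, sP, hQP⟩ := GG_cf (κ := κ) hR hM hMM h i
    have l1 : Tendsto (fun j => cf R M (GG κ χ c1 c2 (v j)) i) UU
        (𝓝 (ibox R M (fun p => ser R M b' p * Q p + (‖ser R M b' p‖ ^ 2 : ℝ) * ser R M b' p * P p))) := by
      have := nl_conv hR hM (l := (UU : Filter ℕ)) (f := fun j => XV χ' (v j)) (w := ser R M b') (Q := Q) (P := P)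
        (fun j => (XV_c1 h' (hS.c1 j)).continuous) (ser_cont sb') cQ cP (C := 2 * A + S)
        (fun j p => by
          unfold XV; rw [norm_mul]
          have := hS.sup j p; have := (hAb p.2).1
          have : ‖χ' p.2‖ * ‖v j p‖ ≤ A * 2 := by gcongr
          linarith) (fun p => by linarith [hser p]) hbL
      refine this.congr fun j => ?_
      rw [hQP _ (hS.c1 j)]
      congr 1
      funext p
      by_cases hp : M' < |p.2|
      · rw [sQ p hp, sP p hp]; simp
      · unfold XV; rw [hone _ (not_lt.1 hp)]; simp
    rw [tendsto_nhds_unique (haG i) l1]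
    have := nl_conv hR hM (f := par R M b') (w := ser R M b') (Q := Q) (P := P)
        (fun F => par_cont R M b' F) (ser_cont sb') cQ cP (C := S)
        (fun F p => par_norm sb' F p) hser
        (unif_l2 hR hM (fun F => par_cont R M b' F) (ser_cont sb') (par_unif sb'))
    refine this.congr fun F => ?_
    rw [hQP _ (par_cd R M b' F 1)]
  obtain ⟨C, hC, hCb⟩ := dyGG_bound (κ := κ) (R := R) (M := M) h hS0
  -- uniform L² bounds
  have q0 : ∀ F : Finset (ℕ × ℤ), ∑ i ∈ F, ‖b' i‖ ^ 2 ≤ S ^ 2 := fun F => by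
    calc ∑ i ∈ F, ‖b' i‖ ^ 2 ≤ ∑ i ∈ F, ‖b' i‖ * S := by
          refine Finset.sum_le_sum fun i _ => ?_
          rw [sq]; gcongr
          exact sb'.le_tsum i (fun j _ => norm_nonneg _)
      _ = (∑ i ∈ F, ‖b' i‖) * S := by rw [Finset.sum_mul]
      _ ≤ S * S := by gcongr; exact sb'.sum_le_tsum F (fun j _ => norm_nonneg _)
      _ = S ^ 2 := by ring
  set T := ((R * M)⁻¹) ^ 2 * B' with hT
  have q2 : ∀ F : Finset (ℕ × ℤ), ∑ i ∈ F, fy M i.2 ^ 4 * ‖b' i‖ ^ 2 ≤ T := fun F => by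
    calc _ ≤ ∑ i ∈ F, ((R * M)⁻¹) ^ 2 * (lam R M i ^ 2 * ‖b i‖ ^ 2) := by
          refine Finset.sum_le_sum fun i _ => ?_
          rw [nb', mul_pow]
          have : fy M i.2 ^ 4 ≤ lam R M i ^ 2 := by
            unfold lam
            nlinarith [sq_nonneg (fx R i.1), sq_nonneg (fy M i.2), mul_nonneg (sq_nonneg (fx R i.1)) (sq_nonneg (fy M i.2))]
          calc _ = ((R * M)⁻¹) ^ 2 * (fy M i.2 ^ 4 * ‖b i‖ ^ 2) := by ring
            _ ≤ _ := by gcongr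
      _ ≤ T := by rw [← Finset.mul_sum, hT]; gcongr; exact hbB F
  have q1 : ∀ F : Finset (ℕ × ℤ), ∑ i ∈ F, fy M i.2 ^ 2 * ‖b' i‖ ^ 2 ≤ S ^ 2 + T := fun F => by
    refine le_trans ?_ (add_le_add (q0 F) (q2 F))
    rw [← Finset.sum_add_distrib]
    refine Finset.sum_le_sum fun i _ => ?_
    have := sq_nonneg ‖b' i‖
    nlinarith [sq_nonneg (fy M i.2 ^ 2 - 1), mul_nonneg this (sq_nonneg (fy M i.2 ^ 2 - 1)), mul_nonneg this (sq_nonneg (fy M i.2))]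
  set U := R * M * (C * (R * M * (T + (S ^ 2 + T) + S ^ 2))) with hU
  have bU : ∀ F G : Finset (ℕ × ℤ), ∑ i ∈ G, fy M i.2 ^ 2 * ‖cf R M (GG κ χ c1 c2 (par R M b' F)) i‖ ^ 2 ≤ U := by
    intro F G
    set w := par R M b' F with hw
    have w2 : ContDiff ℝ 2 w := par_cd R M b' F 2
    have w1 : ContDiff ℝ 1 w := par_cd R M b' F 1
    have g1 := GG_c1 (κ := κ) h w2
    have d1 : dy w = par R M (fun i => b' i * (Complex.I * fy M i.2)) F := dy_par R M b' F
    have d2 : dy (dy w) = par R M (fun i => b' i * (Complex.I * fy M i.2) * (Complex.I * fy M i.2)) F := by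
      rw [d1, dy_par]
    have cdd : Continuous (dy (dy w)) := by rw [d2]; exact par_cont _ _ _ _
    have cd := dy_cont w1
    have cw := w1.continuous
    have cgg := dy_cont g1
    refine (bessel_dy hR hM hMM g1 (GG_sy h w) G).trans ?_
    rw [hU]
    gcongr
    calc ibox R M (fun p => ‖dy (GG κ χ c1 c2 w) p‖ ^ 2)
        ≤ ibox R M (fun p => C * (‖dy (dy w) p‖ ^ 2 + ‖dy w p‖ ^ 2 + ‖w p‖ ^ 2)) :=
          ibox_mono hR hM (by fun_prop) (by fun_prop) (hCb w w2 (fun p => par_norm sb' F p))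
      _ = C * (ibox R M (fun p => ‖dy (dy w) p‖ ^ 2) + ibox R M (fun p => ‖dy w p‖ ^ 2)
            + ibox R M (fun p => ‖w p‖ ^ 2)) := by
          rw [ibox_nu hR hM (by fun_prop), ibox_nu hR hM (by fun_prop), ibox_nu hR hM (by fun_prop),
            ibox_nu hR hM (by fun_prop), integral_const_mul,
            integral_add (iadd (nu_int (by fun_prop)) (nu_int (by fun_prop))) (nu_int (by fun_prop)),
            integral_add (nu_int (by fun_prop)) (nu_int (by fun_prop))]
      _ ≤ C * (R * M * T + R * M * (S ^ 2 + T) + R * M * S ^ 2) := by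
          gcongr
          · rw [d2]
            refine (par_l2 hR hM F _).trans ?_
            gcongr
            refine le_trans (le_of_eq (Finset.sum_congr rfl fun i _ => ?_)) (q2 F)
            simp only [norm_mul, Complex.norm_I, Complex.norm_real, Real.norm_eq_abs]
            rw [mul_pow, mul_pow]
            simp only [one_mul, sq_abs]; ring
          · rw [d1]
            refine (par_l2 hR hM F _).trans ?_
            gcongr
            refine le_trans (le_of_eq (Finset.sum_congr rfl fun i _ => ?_)) (q1 F)
            simp only [norm_mul, Complex.norm_I, Complex.norm_real, Real.norm_eq_abs]
            rw [mul_pow]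
            simp only [one_mul, sq_abs]; ring
          · refine (par_l2 hR hM F _).trans ?_
            gcongr
            exact q0 F
      _ = _ := by ring
  have fin : ∀ G : Finset (ℕ × ℤ), ∑ i ∈ G, fy M i.2 ^ 2 * (lam R M i ^ 2 * ‖a i‖ ^ 2) ≤ U := by
    intro G
    refine le_of_tendsto (f := fun F => ∑ i ∈ G, fy M i.2 ^ 2 * ‖cf R M (GG κ χ c1 c2 (par R M b' F)) i‖ ^ 2)
      (x := atTop) ?_ (Eventually.of_forall fun F => bU F G)
    refine tendsto_finsetSum _ fun i _ => ?_
    have := ((lim i).norm.pow 2).const_mul (fy M i.2 ^ 2)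
    rw [norm_neg, norm_mul, Complex.norm_real, mul_pow, Real.norm_eq_abs, sq_abs] at this
    exact this
  have s1 : Summable fun i => Real.sqrt (lam R M i) * ‖a i‖ := by
    refine summable_of_weight (W := fun i => lam R M i * (1 + fy M i.2 ^ 2)) (B := B + U)
      (fun i => by have := lam_pos hR M i; positivity) (sum_lamy hR hM) (fun G => ?_)
      (fun i => by positivity)
    refine le_trans (le_of_eq ?_) (add_le_add (haB G) (fin G))
    rw [← Finset.sum_add_distrib]
    refine Finset.sum_congr rfl fun i _ => ?_
    rw [mul_pow, Real.sq_sqrt (lam_pos hR M i).le]; ring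
  refine ⟨_, ?_, ser_bd hR M _, haL⟩
  have na : ∀ i, ‖((R * M : ℝ) : ℂ)⁻¹ * a i‖ = (R * M)⁻¹ * ‖a i‖ := fun i => by
    rw [norm_mul, norm_inv, Complex.norm_real, Real.norm_of_nonneg hRM.le]
  apply ser_c1 hR
  · simp_rw [na]; exact sa.mul_left _
  · simp_rw [na]
    refine (s1.mul_left (R * M)⁻¹).congr fun i => ?_
    ring

end SM
end

open MeasureTheory Real Set Filter Topology

noncomputable section

namespace SM

/-- smooth plateau function: 1 for `|y| ≤ a`, 0 for `|y| ≥ a+1` -/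
def Pl (a y : ℝ) : ℝ := Real.smoothTransition (a + 1 - y) * Real.smoothTransition (a + 1 + y)

lemma Pl_one {a y : ℝ} (h : |y| ≤ a) : Pl a y = 1 := by
  have := abs_le.1 h
  unfold Pl
  rw [Real.smoothTransition.one_of_one_le (by linarith), Real.smoothTransition.one_of_one_le (by linarith)]
  norm_num

lemma Pl_zero {a y : ℝ} (h : a + 1 ≤ |y|) : Pl a y = 0 := by
  unfold Pl
  rcases le_abs.1 h with h | h
  · rw [Real.smoothTransition.zero_of_nonpos (by linarith)]; simp
  · rw [Real.smoothTransition.zero_of_nonpos (x := a + 1 + y) (by linarith)]; simp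

lemma Pl_nonneg (a y : ℝ) : 0 ≤ Pl a y :=
  mul_nonneg (Real.smoothTransition.nonneg _) (Real.smoothTransition.nonneg _)

lemma Pl_le (a y : ℝ) : Pl a y ≤ 1 :=
  mul_le_one₀ (Real.smoothTransition.le_one _) (Real.smoothTransition.nonneg _) (Real.smoothTransition.le_one _)

lemma Pl_cd (a : ℝ) (n : ℕ) : ContDiff ℝ n (Pl a) := by
  unfold Pl
  exact (Real.smoothTransition.contDiff.comp (contDiff_const.sub contDiff_id)).mul
    (Real.smoothTransition.contDiff.comp (contDiff_const.add contDiff_id))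

lemma deriv_zero_out {M : ℝ} {f : ℝ → ℂ} (h : ∀ y, M < |y| → f y = 0) (y : ℝ) (hy : M < |y|) :
    deriv f y = 0 := by
  have : f =ᶠ[𝓝 y] fun _ => 0 := by
    filter_upwards [(continuous_abs.continuousAt (x := y)).eventually (lt_mem_nhds hy)] with z hz
    exact h z hz
  rw [this.deriv_eq]; simp

lemma cut_of_smooth {M : ℝ} {χ : ℝ → ℂ} (hχ : ContDiff ℝ 3 χ) (h : ∀ y, M < |y| → χ y = 0) :
    Cut M χ (deriv χ) (deriv (deriv χ)) (deriv (deriv (deriv χ))) := by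
  have h1 : ContDiff ℝ 2 (deriv χ) := by
    have : ContDiff ℝ (2 + 1) χ := by norm_num; exact hχ
    exact (contDiff_succ_iff_deriv.1 this).2.2
  have h2 : ContDiff ℝ 1 (deriv (deriv χ)) := by
    have : ContDiff ℝ (1 + 1) (deriv χ) := by norm_num; exact h1
    exact (contDiff_succ_iff_deriv.1 this).2.2
  have z1 := deriv_zero_out h
  have z2 := deriv_zero_out z1
  refine ⟨fun y => (hχ.differentiable (by norm_num) y).hasDerivAt,
    fun y => (h1.differentiable (by norm_num) y).hasDerivAt,
    fun y => (h2.differentiable (by norm_num) y).hasDerivAt, h2.continuous_deriv_one, h, z1, z2,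
    deriv_zero_out z2⟩

lemma Pl_cut (a : ℝ) : ∃ c1 c2 c3, Cut (a + 1) (fun y => (Pl a y : ℂ)) c1 c2 c3 :=
  ⟨_, _, _, cut_of_smooth (Complex.ofRealCLM.contDiff.comp (Pl_cd a 3)) (fun y hy => by
    rw [Pl_zero hy.le]; simp)⟩

def thg (y : ℝ) : ℕ → ℝ
  | 0 => 0
  | n + 1 => Pl n y

def th (n : ℕ) (y : ℝ) : ℝ := thg y (n + 1) - thg y n

lemma thg_mem (y : ℝ) (n : ℕ) : 0 ≤ thg y n ∧ thg y n ≤ 1 := by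
  cases n with
  | zero => simp [thg]
  | succ n => exact ⟨Pl_nonneg _ _, Pl_le _ _⟩

lemma th_abs (n : ℕ) (y : ℝ) : |th n y| ≤ 1 := by
  have h1 := thg_mem y n; have h2 := thg_mem y (n + 1)
  unfold th; rw [abs_le]; constructor <;> linarith

lemma th_zero {n : ℕ} {y : ℝ} (h : (n : ℝ) + 1 ≤ |y|) : th n y = 0 := by
  unfold th
  cases n with
  | zero => simp only [thg]; rw [Pl_zero (by simpa using h)]; simp
  | succ n =>
    simp only [thg]
    push_cast at h ⊢
    rw [Pl_zero (by linarith), Pl_zero (by linarith)]; simp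

lemma th_zero' {n N : ℕ} {y : ℝ} (h : |y| ≤ N) (hn : N + 1 ≤ n) : th n y = 0 := by
  obtain ⟨m, rfl⟩ := Nat.exists_eq_add_of_le' (show 1 ≤ n by omega)
  unfold th
  simp only [thg]
  have : (N : ℝ) ≤ m := by exact_mod_cast (by omega : N ≤ m)
  push_cast
  rw [Pl_one (by linarith), Pl_one (by linarith)]; simp

lemma th_sum {N : ℕ} {y : ℝ} (h : |y| ≤ N) : ∑ n ∈ Finset.range (N + 1), th n y = 1 := by
  unfold th
  rw [Finset.sum_range_sub]
  simp only [thg]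
  rw [Pl_one h]; simp

lemma th_cd (n : ℕ) : ContDiff ℝ 1 (fun p : ℝ × ℝ => (th n p.2 : ℂ)) := by
  have : ContDiff ℝ 1 (fun y => th n y) := by
    unfold th
    cases n with
    | zero => simp only [thg]; exact (Pl_cd _ 1).sub contDiff_const
    | succ n => simp only [thg]; exact (Pl_cd _ 1).sub (Pl_cd _ 1)
  exact Complex.ofRealCLM.contDiff.comp (this.comp contDiff_snd)

/-- glueing of local limits -/
def glue (w : ℕ → ℝ × ℝ → ℂ) (p : ℝ × ℝ) : ℂ :=
  ∑ n ∈ Finset.range (⌈|p.2|⌉₊ + 1), (th n p.2 : ℂ) * w n p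

lemma glue_eq (w : ℕ → ℝ × ℝ → ℂ) {N : ℕ} {p : ℝ × ℝ} (h : |p.2| ≤ N) :
    glue w p = ∑ n ∈ Finset.range (N + 1), (th n p.2 : ℂ) * w n p := by
  unfold glue
  have : ⌈|p.2|⌉₊ ≤ N := Nat.ceil_le.2 h
  refine Finset.sum_subset (Finset.range_subset_range.2 (by omega)) fun n _ hn => ?_
  rw [th_zero' (Nat.le_ceil _) (by simpa using hn)]; simp

lemma glue_c1 {w : ℕ → ℝ × ℝ → ℂ} (hw : ∀ n, ContDiff ℝ 1 (w n)) : ContDiff ℝ 1 (glue w) := by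
  rw [contDiff_iff_contDiffAt]
  intro p
  obtain ⟨N, hN⟩ := exists_nat_gt |p.2|
  have : ContDiff ℝ 1 (fun p : ℝ × ℝ => ∑ n ∈ Finset.range (N + 1), (th n p.2 : ℂ) * w n p) :=
    ContDiff.sum fun n _ => (th_cd n).mul (hw n)
  refine this.contDiffAt.congr_of_eventuallyEq ?_
  filter_upwards [((continuous_abs.comp continuous_snd).continuousAt (x := p)).eventually (gt_mem_nhds hN)] with q hq
  exact glue_eq w (le_of_lt hq)

lemma glue_bd {R : ℝ} {w : ℕ → ℝ × ℝ → ℂ} (hw : ∀ n, Bd R (w n)) : Bd R (glue w) := by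
  intro y
  unfold glue
  constructor
  · exact Finset.sum_eq_zero fun n _ => by rw [(hw n y).1]; simp
  · exact Finset.sum_eq_zero fun n _ => by rw [(hw n y).2]; simp

lemma ibox_le_mu {R M : ℝ} (hR : 0 < R) (hM : 0 < M) {f : ℝ × ℝ → ℝ} (hf : Continuous f)
    (h0 : ∀ p, 0 ≤ f p) (hi : Integrable f (mu R)) : ibox R M f ≤ ∫ p, f p ∂(mu R) := by
  rw [ibox_eq hR hM hf]
  exact setIntegral_mono_set hi (Eventually.of_forall h0)
    (LE.le.eventuallyLE (fun p hp => ⟨hp.1, mem_univ _⟩))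

theorem limit_fn {R κ K : ℝ} (hR : 0 < R) {v : ℕ → ℝ × ℝ → ℂ} (hS : Sq R κ K v) :
    ∃ φ : ℝ × ℝ → ℂ, ContDiff ℝ 1 φ ∧ Bd R φ ∧ ∀ N : ℕ, 0 < N →
      Tendsto (fun j => ibox R N (fun p => ‖v j p - φ p‖ ^ 2)) UU (𝓝 0) := by
  have key : ∀ n : ℕ, ∃ w : ℝ × ℝ → ℂ, ContDiff ℝ 1 w ∧ Bd R w ∧
      Tendsto (fun j => ibox R ((n : ℝ) + 4) (fun p => ‖XV (fun y => (Pl (n + 1) y : ℂ)) (v j) p - w p‖ ^ 2))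
        UU (𝓝 0) := by
    intro n
    obtain ⟨c1, c2, c3, h⟩ := Pl_cut ((n : ℝ) + 1)
    obtain ⟨d1, d2, d3, h'⟩ := Pl_cut ((n : ℝ) + 2)
    exact reg2 hR (by positivity) (by linarith) (by linarith) hS h h' (fun y hy => by
      rw [Pl_one (by linarith)]; simp)
  choose w wc wb wl using key
  refine ⟨glue w, glue_c1 wc, glue_bd wb, fun N hN => ?_⟩
  have hNr : (0:ℝ) < N := by exact_mod_cast hN
  have gc := (glue_c1 wc).continuous
  have lim := (tendsto_finsetSum (Finset.range (N + 1)) fun n _ => wl n).const_mul ((N + 1 : ℕ) : ℝ)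
  rw [Finset.sum_const_zero, mul_zero] at lim
  have hvc := fun j => (hS.c1 j).continuous
  have hwc := fun n => (wc n).continuous
  have htc := fun n => (th_cd n).continuous
  refine squeeze_zero (fun j => ibox_nonneg hR hNr (by have := hvc j; fun_prop) (fun p => by positivity))
    (fun j => ?_) lim
  set g : ℕ → ℝ × ℝ → ℂ := fun n p => (th n p.2 : ℂ) * (v j p - w n p) with hg
  have hgc : ∀ n, Continuous (g n) := fun n => (htc n).mul ((hvc j).sub (hwc n))
  have cgn : ∀ n, Continuous (fun p => ‖g n p‖ ^ 2) := fun n => by have := hgc n; fun_prop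
  have hgs : ∀ n : ℕ, Sy ((n : ℝ) + 1) (fun p => ‖g n p‖ ^ 2) := fun n p hp => by
    simp [hg, th_zero (le_of_lt hp)]
  calc ibox R N (fun p => ‖v j p - glue w p‖ ^ 2)
      ≤ ibox R N (fun p => ((N + 1 : ℕ) : ℝ) * ∑ n ∈ Finset.range (N + 1), ‖g n p‖ ^ 2) := by
        refine ibox_mono hR hNr (by have := hvc j; fun_prop)
          (continuous_const.mul (continuous_finsetSum _ fun n _ => cgn n)) fun p hp => ?_
        have hp2 : |p.2| ≤ N := abs_le.2 hp.2
        have e : v j p - glue w p = ∑ n ∈ Finset.range (N + 1), g n p := by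
          rw [glue_eq w hp2]
          simp only [hg, mul_sub]
          rw [Finset.sum_sub_distrib, ← Finset.sum_mul]
          congr 1
          rw [← Complex.ofReal_sum, th_sum hp2]; simp
        rw [e]
        calc _ ≤ (∑ n ∈ Finset.range (N + 1), ‖g n p‖) ^ 2 := by gcongr; exact norm_sum_le _ _
          _ ≤ _ := by
            have := sq_sum_le_card_mul_sum_sq (s := Finset.range (N + 1)) (f := fun n => ‖g n p‖)
            simpa using this
    _ = ((N + 1 : ℕ) : ℝ) * ∑ n ∈ Finset.range (N + 1), ibox R N (fun p => ‖g n p‖ ^ 2) := by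
        have cs : Continuous fun p => ((N + 1 : ℕ) : ℝ) * ∑ n ∈ Finset.range (N + 1), ‖g n p‖ ^ 2 :=
          continuous_const.mul (continuous_finsetSum _ fun n _ => cgn n)
        rw [ibox_nu hR hNr cs,
          integral_const_mul, integral_finsetSum _ (fun n _ => nu_int (cgn n))]
        congr 1
        exact Finset.sum_congr rfl fun n _ => (ibox_nu hR hNr (cgn n)).symm
    _ ≤ _ := by
        gcongr with n hn
        calc ibox R N (fun p => ‖g n p‖ ^ 2) ≤ ∫ p, ‖g n p‖ ^ 2 ∂(mu R) :=
              ibox_le_mu hR hNr (cgn n) (fun p => by positivity) ((hgs n).cpt.integrable (cgn n))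
          _ = ibox R ((n : ℝ) + 4) (fun p => ‖g n p‖ ^ 2) :=
              int_ibox hR (by positivity) (by linarith) (cgn n) (hgs n)
          _ ≤ _ := by
              have cP : Continuous (fun p : ℝ × ℝ => XV (fun y => (Pl (n + 1) y : ℂ)) (v j) p) := by
                have := ((Pl_cd ((n : ℝ) + 1) 1).continuous.comp continuous_snd : Continuous fun p : ℝ × ℝ => Pl (n + 1) p.2)
                have := hvc j
                unfold XV; fun_prop
              have := hwc n
              refine ibox_mono hR (by positivity) (cgn n) (by fun_prop) fun p _ => ?_
              by_cases hp : (n : ℝ) + 1 ≤ |p.2|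
              · simp only [hg, th_zero hp]; simp
              · simp only [hg, XV]
                rw [Pl_one (not_le.1 hp).le, norm_mul, Complex.norm_real, Real.norm_eq_abs]
                have := th_abs n p.2
                simp only [Complex.ofReal_one, one_mul]
                gcongr
                exact mul_le_of_le_one_left (norm_nonneg _) this

end SM
end

open MeasureTheory Real Set Filter Topology

noncomputable section

namespace SM

lemma cmul {f g : ℝ × ℝ → ℂ} (hf : Continuous f) (hg : Continuous g) :
    Continuous (fun p => f p * g p) := hf.mul hg

lemma mu_nu {E : Type*} [NormedAddCommGroup E] [NormedSpace ℝ E] {R M M' : ℝ} (hR : 0 < R)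
    (hM : 0 < M) (hMM : M' < M) {f : ℝ × ℝ → E} (hf : Continuous f) (h0 : Sy M' f) :
    ∫ p, f p ∂(mu R) = ∫ p, f p ∂(nu R M) := by
  rw [int_ibox hR hM hMM hf h0, ibox_nu hR hM hf]

lemma nu_le_mu (R M : ℝ) : nu R M ≤ mu R := by
  have h : Ioo (-R/2) (R/2) ×ˢ Ioo (-M) M ⊆ Ioo (-R/2) (R/2) ×ˢ (univ : Set ℝ) :=
    fun p hp => ⟨hp.1, mem_univ _⟩
  exact Measure.restrict_mono h le_rfl

lemma nu_mono_mu {R M : ℝ} {f : ℝ × ℝ → ℝ} (h0 : ∀ p, 0 ≤ f p)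
    (hi : Integrable f (mu R)) : ∫ p, f p ∂(nu R M) ≤ ∫ p, f p ∂(mu R) :=
  integral_mono_measure (nu_le_mu R M) (Eventually.of_forall h0) hi

instance nu_fin (R M : ℝ) : IsFiniteMeasure (nu R M) := by
  have := (nu_int (R := R) (M := M) (f := fun _ : ℝ × ℝ => (1:ℝ)) continuous_const)
  exact (integrable_const_iff_isFiniteMeasure one_ne_zero).1 this

lemma nu_ae (R M : ℝ) : ∀ᵐ p ∂(nu R M), p ∈ Icc (-R/2) (R/2) ×ˢ Icc (-M) M := by
  have : ∀ᵐ p ∂(nu R M), p ∈ Ioo (-R/2) (R/2) ×ˢ Ioo (-M) M :=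
    ae_restrict_mem (measurableSet_Ioo.prod measurableSet_Ioo)
  filter_upwards [this] with p hp
  exact ⟨Ioo_subset_Icc_self hp.1, Ioo_subset_Icc_self hp.2⟩

lemma wk_ext {R M M' : ℝ} {ι : Type*} {l : Filter ι} {A : ι → ℝ × ℝ → ℂ} {A0 h : ℝ × ℝ → ℂ}
    (hA : ∀ j, Continuous (A j)) (hA0 : Continuous A0) {C : ℝ}
    (hC : ∀ j, ∫ p, ‖A j p‖ ∂(nu R M) ≤ C)
    (hg : ∀ g, ContDiff ℝ 1 g → Sy M' g →
      Tendsto (fun j => ∫ p, g p * A j p ∂(nu R M)) l (𝓝 (∫ p, g p * A0 p ∂(nu R M))))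
    (hh : Continuous h) (hs : Sy M' h) :
    Tendsto (fun j => ∫ p, h p * A j p ∂(nu R M)) l (𝓝 (∫ p, h p * A0 p ∂(nu R M))) := by
  set C0 := ∫ p, ‖A0 p‖ ∂(nu R M) with hC0
  have hC0n : 0 ≤ C0 := integral_nonneg fun p => norm_nonneg _
  rw [Metric.tendsto_nhds]
  intro ε hε
  set D := |C| + C0 + 1 with hD
  have hDp : 0 < D := by positivity
  obtain ⟨g, g1, g2, g3⟩ := hh.exists_contDiff_approx 1 (ε := fun _ => ε / (2 * D)) continuous_const
    (fun _ => by positivity)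
  have gs : Sy M' g := fun p hp => by
    by_contra hne
    exact g3 hne (hs p hp)
  have gc : Continuous g := g1.continuous
  have est : ∀ B : ℝ × ℝ → ℂ, Continuous B → ‖∫ p, h p * B p ∂(nu R M) - ∫ p, g p * B p ∂(nu R M)‖
      ≤ ε / (2 * D) * ∫ p, ‖B p‖ ∂(nu R M) := by
    intro B hB
    rw [← integral_sub (nu_int (cmul hh hB)) (nu_int (cmul gc hB)), ← integral_const_mul]
    refine norm_integral_le_of_norm_le ((nu_int hB.norm).const_mul _) (Eventually.of_forall fun p => ?_)
    rw [← sub_mul, norm_mul]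
    gcongr
    have := g2 p
    rw [dist_comm, dist_eq_norm] at this
    exact this.le
  filter_upwards [(Metric.tendsto_nhds.1 (hg g g1 gs)) (ε / 2) (by positivity)] with j hj
  rw [dist_eq_norm] at hj ⊢
  have e1 := est (A j) (hA j)
  have e2 := est A0 hA0
  have hCj := hC j
  have e3 : ε / (2 * D) * ∫ p, ‖A j p‖ ∂(nu R M) + ε / (2 * D) * C0 ≤ ε / (2 * D) * (|C| + C0) := by
    rw [← mul_add]
    gcongr
    exact hCj.trans (le_abs_self C)
  have e4 : ε / (2 * D) * (|C| + C0) < ε / 2 := by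
    have : |C| + C0 < D := by linarith
    calc ε / (2 * D) * (|C| + C0) < ε / (2 * D) * D := by gcongr
      _ = ε / 2 := by field_simp
  set a := ∫ p, h p * A j p ∂(nu R M)
  set b := ∫ p, h p * A0 p ∂(nu R M)
  set c := ∫ p, g p * A j p ∂(nu R M)
  set d := ∫ p, g p * A0 p ∂(nu R M)
  have : a - b = (a - c) + (c - d) - (b - d) := by ring
  rw [this]
  calc _ ≤ ‖a - c‖ + ‖c - d‖ + ‖b - d‖ := (norm_sub_le _ _).trans (by gcongr; exact norm_add_le _ _)
    _ < ε := by linarith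

lemma l1_conv {R M : ℝ} (hR : 0 < R) (hM : 0 < M) {ι : Type*} {l : Filter ι} {f : ι → ℝ × ℝ → ℂ}
    {w : ℝ × ℝ → ℂ} (hf : ∀ j, Continuous (f j)) (hw : Continuous w)
    (h : Tendsto (fun j => ibox R M (fun p => ‖f j p - w p‖ ^ 2)) l (𝓝 0)) :
    Tendsto (fun j => ∫ p, ‖f j p - w p‖ ^ 2 ∂(nu R M)) l (𝓝 0) ∧
    Tendsto (fun j => ∫ p, ‖f j p - w p‖ ∂(nu R M)) l (𝓝 0) := by
  have hd : ∀ j, Continuous (fun p => f j p - w p) := fun j => (hf j).sub hw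
  simp_rw [fun j => ibox_nu hR hM (by have := hd j; fun_prop : Continuous fun p => ‖f j p - w p‖ ^ 2)] at h
  exact ⟨h, l1_of_l2 (m := nu R M) (f := fun j p => ‖f j p - w p‖) (fun j p => norm_nonneg _)
    (fun j => nu_int (hd j).norm) (fun j => nu_int ((hd j).norm.pow 2)) h⟩

lemma lin_conv {R M : ℝ} (hR : 0 < R) (hM : 0 < M) {ι : Type*} {l : Filter ι} {f : ι → ℝ × ℝ → ℂ}
    {w h : ℝ × ℝ → ℂ} (hf : ∀ j, Continuous (f j)) (hw : Continuous w) (hh : Continuous h)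
    (hl : Tendsto (fun j => ibox R M (fun p => ‖f j p - w p‖ ^ 2)) l (𝓝 0)) :
    Tendsto (fun j => ∫ p, f j p * h p ∂(nu R M)) l (𝓝 (∫ p, w p * h p ∂(nu R M))) := by
  obtain ⟨h2, h1⟩ := l1_conv hR hM hf hw hl
  obtain ⟨q, hq0, hq⟩ := bdd_box (R := R) (M := M) hh
  rw [tendsto_iff_norm_sub_tendsto_zero]
  have h3 := h1.const_mul q
  rw [mul_zero] at h3
  refine squeeze_zero (fun j => norm_nonneg _) (fun j => ?_) h3
  rw [← integral_sub (nu_int (cmul (hf j) hh)) (nu_int (cmul hw hh)), ← integral_const_mul]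
  refine norm_integral_le_of_norm_le ((nu_int ((hf j).sub hw).norm).const_mul _) ?_
  filter_upwards [nu_ae R M] with p hp
  rw [← sub_mul, norm_mul, mul_comm q]
  gcongr
  exact hq p hp

lemma sq_conv {R M : ℝ} (hR : 0 < R) (hM : 0 < M) {ι : Type*} {l : Filter ι} {f : ι → ℝ × ℝ → ℂ}
    {w : ℝ × ℝ → ℂ} {h : ℝ × ℝ → ℝ} (hf : ∀ j, Continuous (f j)) (hw : Continuous w) (hh : Continuous h)
    (hl : Tendsto (fun j => ibox R M (fun p => ‖f j p - w p‖ ^ 2)) l (𝓝 0)) :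
    Tendsto (fun j => ∫ p, h p * (‖f j p‖ ^ 2 - ‖w p‖ ^ 2) ∂(nu R M)) l (𝓝 0) := by
  obtain ⟨h2, h1⟩ := l1_conv hR hM hf hw hl
  obtain ⟨q, hq0, hq⟩ := bdd_box (R := R) (M := M) (Complex.continuous_ofReal.comp hh)
  obtain ⟨r, hr0, hr⟩ := bdd_box (R := R) (M := M) hw
  have h3 := (h2.add (h1.const_mul (2 * r))).const_mul q
  simp only [mul_zero, add_zero] at h3
  rw [tendsto_zero_iff_norm_tendsto_zero]
  refine squeeze_zero (fun j => norm_nonneg _) (fun j => ?_) h3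
  have hd : Continuous (fun p => f j p - w p) := (hf j).sub hw
  have i1 : Integrable (fun p => ‖f j p - w p‖ ^ 2) (nu R M) := nu_int (by fun_prop)
  have i2 : Integrable (fun p => 2 * r * ‖f j p - w p‖) (nu R M) := nu_int (by fun_prop)
  rw [← integral_const_mul, ← integral_add i1 i2, ← integral_const_mul]
  refine norm_integral_le_of_norm_le ((iadd i1 i2).const_mul _) ?_
  filter_upwards [nu_ae R M] with p hp
  rw [norm_mul]
  have a1 : ‖h p‖ ≤ q := by simpa using hq p hp
  have a2 := hr p hp
  have a3 : |‖f j p‖ - ‖w p‖| ≤ ‖f j p - w p‖ := abs_norm_sub_norm_le _ _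
  have a4 : ‖‖f j p‖ ^ 2 - ‖w p‖ ^ 2‖ ≤ ‖f j p - w p‖ ^ 2 + 2 * r * ‖f j p - w p‖ := by
    set s := ‖f j p‖ - ‖w p‖ with hs
    have e : ‖f j p‖ ^ 2 - ‖w p‖ ^ 2 = s ^ 2 + 2 * ‖w p‖ * s := by rw [hs]; ring
    rw [e]
    refine (norm_add_le _ _).trans ?_
    rw [norm_mul, norm_mul, norm_norm, norm_pow]
    simp only [Real.norm_eq_abs, abs_two]
    gcongr
  gcongr

/-- weak convergence of the gradient -/
lemma wk_grad {R κ K M M' : ℝ} (hR : 0 < R) (hM : 0 < M) (hMM : M' < M) {v : ℕ → ℝ × ℝ → ℂ}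
    (hS : Sq R κ K v) {φ : ℝ × ℝ → ℂ} (hφ : ContDiff ℝ 1 φ) (hb : Bd R φ)
    (hl : Tendsto (fun j => ibox R M (fun p => ‖v j p - φ p‖ ^ 2)) UU (𝓝 0))
    {h : ℝ × ℝ → ℂ} (hh : Continuous h) (hs : Sy M' h) :
    Tendsto (fun j => ∫ p, h p * dx (v j) p ∂(nu R M)) UU (𝓝 (∫ p, h p * dx φ p ∂(nu R M))) ∧
    Tendsto (fun j => ∫ p, h p * D2 (v j) p ∂(nu R M)) UU (𝓝 (∫ p, h p * D2 φ p ∂(nu R M))) := by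
  have hvc := fun j => (hS.c1 j).continuous
  have bnd : ∀ (j : ℕ) (B : ℝ × ℝ → ℂ), Continuous B → (∀ p, ‖B p‖ ^ 2 ≤ gsq (v j) p) →
      ∫ p, ‖B p‖ ∂(nu R M) ≤ (nu R M).real univ + K := by
    intro j B hB hBg
    have c1 := gsq_cont (hS.c1 j)
    calc ∫ p, ‖B p‖ ∂(nu R M) ≤ ∫ p, (1 + gsq (v j) p) ∂(nu R M) := by
          apply integral_mono (nu_int hB.norm) (nu_int (by fun_prop))
          intro p
          have := hBg p
          show ‖B p‖ ≤ 1 + gsq (v j) p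
          nlinarith [sq_nonneg (‖B p‖ - 1), norm_nonneg (B p)]
      _ = (nu R M).real univ + ∫ p, gsq (v j) p ∂(nu R M) := by
          rw [integral_add (integrable_const _) (nu_int c1)]; simp
      _ ≤ _ := by
          gcongr
          exact (nu_mono_mu (fun p => by unfold gsq; positivity) (hS.ig j)).trans (hS.bg j)
  constructor
  · refine wk_ext (M' := M') (C := (nu R M).real univ + K) (fun j => dx_cont (hS.c1 j)) (dx_cont hφ)
      (fun j => bnd j _ (dx_cont (hS.c1 j)) (fun p => by unfold gsq; linarith [sq_nonneg ‖D2 (v j) p‖]))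
      ?_ hh hs
    intro g hg gs
    have key : ∀ w : ℝ × ℝ → ℂ, ContDiff ℝ 1 w → Bd R w →
        ∫ p, g p * dx w p ∂(nu R M) = ∫ p, w p * (-dx g p) ∂(nu R M) := by
      intro w hw hwb
      have c1 := dx_cont hw; have c2 := dx_cont hg; have c3 := hg.continuous; have c4 := hw.continuous
      have s1 : Sy M' (fun p => w p * (-dx g p)) := fun p hp => by simp [gs.dx p hp]
      rw [← mu_nu hR hM hMM (cmul c3 c1) gs.mul_left, ← mu_nu hR hM hMM (by fun_prop) s1]
      simp_rw [mul_comm (g _), mul_neg]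
      rw [ibp_x hR hw hg gs.cpt hwb, integral_neg]
    simp_rw [fun j => key (v j) (hS.c1 j) (hS.bd j), key φ hφ hb]
    exact lin_conv hR hM hvc hφ.continuous (dx_cont hg).neg hl
  · refine wk_ext (M' := M') (C := (nu R M).real univ + K) (fun j => D2_cont (hS.c1 j)) (D2_cont hφ)
      (fun j => bnd j _ (D2_cont (hS.c1 j)) (fun p => by unfold gsq; linarith [sq_nonneg ‖dx (v j) p‖]))
      ?_ hh hs
    intro g hg gs
    have key : ∀ w : ℝ × ℝ → ℂ, ContDiff ℝ 1 w →
        ∫ p, g p * D2 w p ∂(nu R M)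
          = ∫ p, w p * (-dy g p - Complex.I * (p.1 * p.2 : ℝ) * g p) ∂(nu R M) := by
      intro w hw
      have c1 := dy_cont hw; have c2 := dy_cont hg; have c3 := hg.continuous; have c4 := hw.continuous
      have c5 := D2_cont hw
      have s1 : Sy M' (fun p => w p * (-dy g p - Complex.I * (p.1 * p.2 : ℝ) * g p)) :=
        fun p hp => by simp [gs.dy p hp, gs p hp]
      have s2 : Sy M' (fun p => w p * dy g p) := fun p hp => by simp [gs.dy p hp]
      have s3 : Sy M' (fun p => dy w p * g p) := fun p hp => by simp [gs p hp]
      have s4 : Sy M' (fun p => Complex.I * (p.1 * p.2 : ℝ) * g p * w p) := fun p hp => by simp [gs p hp]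
      rw [← mu_nu hR hM hMM (cmul c3 c5) gs.mul_left, ← mu_nu hR hM hMM (by fun_prop) s1]
      have l1 : ∀ p, g p * D2 w p = dy w p * g p - Complex.I * (p.1 * p.2 : ℝ) * g p * w p := by
        intro p; unfold D2; ring
      have l2 : ∀ p : ℝ × ℝ, w p * (-dy g p - Complex.I * (p.1 * p.2 : ℝ) * g p)
          = -(w p * dy g p) - Complex.I * (p.1 * p.2 : ℝ) * g p * w p := by intro p; ring
      simp_rw [l1, l2]
      have i2 := s2.cpt.integrable (R := R) (by fun_prop)
      have i3 := s3.cpt.integrable (R := R) (by fun_prop)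
      have i4 := s4.cpt.integrable (R := R) (by fun_prop)
      have i2n : Integrable (fun p => -(w p * dy g p)) (mu R) := i2.neg
      rw [integral_sub i3 i4, integral_sub i2n i4, ibp_y hw hg gs.cpt, integral_neg]
    simp_rw [fun j => key (v j) (hS.c1 j), key φ hφ]
    have c2 := dy_cont hg; have c3 := hg.continuous
    exact lin_conv hR hM hvc hφ.continuous (by fun_prop) hl

end SM
end

open MeasureTheory Real Set Filter Topology

noncomputable section

namespace SM

def dens (κ : ℝ) (v : ℝ × ℝ → ℂ) (p : ℝ × ℝ) : ℝ := gsq v p - κ * ‖v p‖ ^ 2 + κ / 2 * ‖v p‖ ^ 4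

lemma dens_cont {κ : ℝ} {v : ℝ × ℝ → ℂ} (hv : ContDiff ℝ 1 v) : Continuous (dens κ v) := by
  have c1 := gsq_cont hv
  have c2 := hv.continuous
  unfold dens
  fun_prop

structure Cls (R : ℝ) (v : ℝ × ℝ → ℂ) : Prop where
  c1 : ContDiff ℝ 1 v
  bd : Bd R v
  ig : Integrable (gsq v) (mu R)
  i2 : Integrable (fun p => ‖v p‖ ^ 2) (mu R)
  i4 : Integrable (fun p => ‖v p‖ ^ 4) (mu R)

lemma Cls.idens {R κ : ℝ} {v : ℝ × ℝ → ℂ} (h : Cls R v) : Integrable (dens κ v) (mu R) :=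
  (h.ig.sub (h.i2.const_mul κ)).add (h.i4.const_mul (κ / 2))

lemma gsq_nonneg (v : ℝ × ℝ → ℂ) (p : ℝ × ℝ) : 0 ≤ gsq v p := by unfold gsq; positivity

/-- plateau on the strip -/
def PP (N : ℕ) (p : ℝ × ℝ) : ℝ := Pl N p.2

lemma PP_cont (N : ℕ) : Continuous (PP N) := (Pl_cd N 1).continuous.comp continuous_snd
lemma PP_nonneg (N : ℕ) (p : ℝ × ℝ) : 0 ≤ PP N p := Pl_nonneg _ _
lemma PP_le (N : ℕ) (p : ℝ × ℝ) : PP N p ≤ 1 := Pl_le _ _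
lemma PP_sy (N : ℕ) : Sy ((N : ℝ) + 1) (PP N) := fun p hp => Pl_zero hp.le
lemma PP_lim (p : ℝ × ℝ) : Tendsto (fun N => PP N p) atTop (𝓝 1) := by
  obtain ⟨n, hn⟩ := exists_nat_ge |p.2|
  refine tendsto_const_nhds.congr' ?_
  filter_upwards [eventually_ge_atTop n] with m hm
  exact (Pl_one (hn.trans (by exact_mod_cast hm))).symm

lemma PP_syr (N : ℕ) (f : ℝ × ℝ → ℝ) : Sy ((N : ℝ) + 1) (fun p => PP N p * f p) :=
  fun p hp => by simp [PP_sy N p hp]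

lemma PP_lim_int {R : ℝ} {f : ℝ × ℝ → ℝ} (hf : Integrable f (mu R)) (hc : Continuous f) :
    Tendsto (fun N => ∫ p, PP N p * f p ∂(mu R)) atTop (𝓝 (∫ p, f p ∂(mu R))) := by
  refine tendsto_integral_of_dominated_convergence (fun p => ‖f p‖) (fun N => ?_) hf.norm (fun N => ?_) ?_
  · exact ((PP_cont N).mul hc).aestronglyMeasurable
  · refine Eventually.of_forall fun p => ?_
    rw [norm_mul, Real.norm_of_nonneg (PP_nonneg N p)]
    exact mul_le_of_le_one_left (norm_nonneg _) (PP_le N p)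
  · refine Eventually.of_forall fun p => ?_
    simpa using (PP_lim p).mul_const (f p)

lemma PP_int {R : ℝ} {f : ℝ × ℝ → ℝ} (hf : Continuous f) (N : ℕ) :
    Integrable (fun p => PP N p * f p) (mu R) :=
  (PP_syr N f).cpt.integrable ((PP_cont N).mul hf)

lemma integrable_of_PP {R K : ℝ} {f : ℝ × ℝ → ℝ} (hf : Continuous f) (h0 : ∀ p, 0 ≤ f p)
    (hb : ∀ N : ℕ, ∫ p, PP N p * f p ∂(mu R) ≤ K) : Integrable f (mu R) := by
  refine ⟨hf.aestronglyMeasurable, ?_⟩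
  rw [hasFiniteIntegral_iff_ofReal (Eventually.of_forall h0)]
  have hfat := lintegral_liminf_le (u := atTop) (μ := mu R) (f := fun (N : ℕ) p => ENNReal.ofReal (PP N p * f p))
    (fun N => (((PP_cont N).mul hf).measurable).ennreal_ofReal)
  have e1 : ∀ p, liminf (fun N : ℕ => ENNReal.ofReal (PP N p * f p)) atTop = ENNReal.ofReal (f p) := by
    intro p
    refine Tendsto.liminf_eq ?_
    refine ENNReal.tendsto_ofReal ?_
    simpa using (PP_lim p).mul_const (f p)
  simp_rw [e1] at hfat
  refine (hfat.trans ?_).trans_lt (ENNReal.ofReal_lt_top (r := K))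
  refine liminf_le_of_le (by isBoundedDefault) ?_
  intro b hbb
  obtain ⟨N, hN⟩ := hbb.exists
  refine hN.trans ?_
  rw [← ofReal_integral_eq_lintegral_ofReal (PP_int hf N)
    (Eventually.of_forall fun p => mul_nonneg (PP_nonneg N p) (h0 p))]
  exact ENNReal.ofReal_le_ofReal (hb N)

lemma nsq_ge (a b : ℂ) : ‖b‖ ^ 2 + 2 * ((starRingEnd ℂ b) * a - (starRingEnd ℂ b) * b).re ≤ ‖a‖ ^ 2 := by
  have h1 : ‖a‖ ^ 2 = a.re ^ 2 + a.im ^ 2 := by rw [← Complex.normSq_eq_norm_sq, Complex.normSq_apply]; ring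
  have h2 : ‖b‖ ^ 2 = b.re ^ 2 + b.im ^ 2 := by rw [← Complex.normSq_eq_norm_sq, Complex.normSq_apply]; ring
  rw [h1, h2]
  simp
  nlinarith [sq_nonneg (a.re - b.re), sq_nonneg (a.im - b.im)]

lemma low {R κ K : ℝ} (hR : 0 < R) {v : ℕ → ℝ × ℝ → ℂ} (hS : Sq R κ K v) {φ : ℝ × ℝ → ℂ}
    (hφ : ContDiff ℝ 1 φ) (hb : Bd R φ)
    (hl : ∀ N : ℕ, 0 < N → Tendsto (fun j => ibox R N (fun p => ‖v j p - φ p‖ ^ 2)) UU (𝓝 0))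
    {c : ℝ} (hc : 0 ≤ c) (N : ℕ) :
    ∃ T : ℕ → ℝ, Tendsto T UU (𝓝 0) ∧ ∀ j, ∫ p, PP N p * dens c φ p ∂(mu R) + T j
      ≤ ∫ p, PP N p * dens c (v j) p ∂(mu R) := by
  have hM : (0:ℝ) < ((N + 2 : ℕ) : ℝ) := by positivity
  have hMM : (N : ℝ) + 1 < ((N + 2 : ℕ) : ℝ) := by push_cast; linarith
  set M : ℝ := ((N + 2 : ℕ) : ℝ) with hMd
  have hl := hl (N + 2) (by omega)
  have c1 := dx_cont hφ; have c2 := D2_cont hφ; have c3 := hφ.continuous; have c4 := PP_cont N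
  set h1 : ℝ × ℝ → ℂ := fun p => (PP N p : ℂ) * (starRingEnd ℂ) (dx φ p) with hh1
  set h2 : ℝ × ℝ → ℂ := fun p => (PP N p : ℂ) * (starRingEnd ℂ) (D2 φ p) with hh2
  have k1 : Continuous h1 := cmul (Complex.continuous_ofReal.comp c4) (Complex.continuous_conj.comp c1)
  have k2 : Continuous h2 := cmul (Complex.continuous_ofReal.comp c4) (Complex.continuous_conj.comp c2)
  have s1 : Sy ((N:ℝ) + 1) h1 := fun p hp => by simp [hh1, PP_sy N p hp]
  have s2 : Sy ((N:ℝ) + 1) h2 := fun p hp => by simp [hh2, PP_sy N p hp]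
  have w1 := (wk_grad hR hM hMM hS hφ hb hl k1 s1).1
  have w2 := (wk_grad hR hM hMM hS hφ hb hl k2 s2).2
  set h3 : ℝ × ℝ → ℝ := fun p => PP N p * (-c + c * ‖φ p‖ ^ 2) with hh3
  have k3 : Continuous h3 := by fun_prop
  have w3 := sq_conv hR hM (fun j => (hS.c1 j).continuous) c3 k3 hl
  have w1' := (Complex.continuous_re.tendsto _).comp (w1.sub_const (∫ p, h1 p * dx φ p ∂(nu R M)))
  have w2' := (Complex.continuous_re.tendsto _).comp (w2.sub_const (∫ p, h2 p * D2 φ p ∂(nu R M)))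
  simp only [sub_self, Complex.zero_re] at w1' w2'
  refine ⟨_, (by simpa using ((w1'.const_mul 2).add (w2'.const_mul 2)).add w3), fun j => ?_⟩
  have d1 := dx_cont (hS.c1 j); have d2 := D2_cont (hS.c1 j); have d3 := (hS.c1 j).continuous
  have d4 := dens_cont (κ := c) hφ; have d5 := dens_cont (κ := c) (hS.c1 j)
  show _ + (2 * (_ - _ : ℂ).re + 2 * (_ - _ : ℂ).re + _) ≤ _
  rw [← integral_sub (nu_int (cmul k1 d1)) (nu_int (cmul k1 c1)),
    ← integral_sub (nu_int (cmul k2 d2)) (nu_int (cmul k2 c2)),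
    mu_nu hR hM hMM (by fun_prop) (PP_syr N _), mu_nu hR hM hMM (by fun_prop) (PP_syr N _)]
  have r1 : ∀ g : ℝ × ℝ → ℂ, Continuous g → (∫ p, g p ∂(nu R M)).re = ∫ p, (g p).re ∂(nu R M) :=
    fun g hg => (integral_re (nu_int hg)).symm
  rw [r1 _ (by fun_prop), r1 _ (by fun_prop), ← integral_const_mul, ← integral_const_mul]
  have i1 : Integrable (fun p => 2 * (h1 p * dx (v j) p - h1 p * dx φ p).re) (nu R M) :=
    nu_int (continuous_const.mul (Complex.continuous_re.comp (by fun_prop)))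
  have i2 : Integrable (fun p => 2 * (h2 p * D2 (v j) p - h2 p * D2 φ p).re) (nu R M) :=
    nu_int (continuous_const.mul (Complex.continuous_re.comp (by fun_prop)))
  have i3 : Integrable (fun p => h3 p * (‖v j p‖ ^ 2 - ‖φ p‖ ^ 2)) (nu R M) := nu_int (by fun_prop)
  have i4 : Integrable (fun p => PP N p * dens c φ p) (nu R M) := nu_int (by fun_prop)
  have i5 : Integrable (fun p => PP N p * dens c (v j) p) (nu R M) := nu_int (by fun_prop)
  rw [← integral_add i1 i2, ← integral_add (iadd i1 i2) i3, ← integral_add i4 (iadd (iadd i1 i2) i3)]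
  apply integral_mono (iadd i4 (iadd (iadd i1 i2) i3)) i5
  intro p
  show PP N p * dens c φ p + (2 * (h1 p * dx (v j) p - h1 p * dx φ p).re +
    2 * (h2 p * D2 (v j) p - h2 p * D2 φ p).re + h3 p * (‖v j p‖ ^ 2 - ‖φ p‖ ^ 2)) ≤ PP N p * dens c (v j) p
  have e1 : (h1 p * dx (v j) p - h1 p * dx φ p).re = PP N p * ((starRingEnd ℂ (dx φ p)) * dx (v j) p - (starRingEnd ℂ (dx φ p)) * dx φ p).re := by
    rw [← Complex.re_ofReal_mul]; congr 1; simp only [hh1]; ring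
  have e2 : (h2 p * D2 (v j) p - h2 p * D2 φ p).re = PP N p * ((starRingEnd ℂ (D2 φ p)) * D2 (v j) p - (starRingEnd ℂ (D2 φ p)) * D2 φ p).re := by
    rw [← Complex.re_ofReal_mul]; congr 1; simp only [hh2]; ring
  rw [e1, e2]
  simp only [hh3]
  have n1 := nsq_ge (dx (v j) p) (dx φ p)
  have n2 := nsq_ge (D2 (v j) p) (D2 φ p)
  have n3 : 0 ≤ c / 2 * (‖v j p‖ ^ 2 - ‖φ p‖ ^ 2) ^ 2 := by positivity
  have : 0 ≤ PP N p * ((‖dx (v j) p‖ ^ 2 - (‖dx φ p‖ ^ 2 + 2 * ((starRingEnd ℂ (dx φ p)) * dx (v j) p - (starRingEnd ℂ (dx φ p)) * dx φ p).re))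
    + (‖D2 (v j) p‖ ^ 2 - (‖D2 φ p‖ ^ 2 + 2 * ((starRingEnd ℂ (D2 φ p)) * D2 (v j) p - (starRingEnd ℂ (D2 φ p)) * D2 φ p).re))
    + c / 2 * (‖v j p‖ ^ 2 - ‖φ p‖ ^ 2) ^ 2) := mul_nonneg (PP_nonneg N p) (by linarith)
  unfold dens gsq
  linarith

lemma le_of_T {l : ℕ → ℝ} {a K : ℝ} (hl : Tendsto l UU (𝓝 0)) (h : ∀ j, a + l j ≤ K) : a ≤ K := by
  have := hl.const_add a
  rw [add_zero] at this
  exact le_of_tendsto' this h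

theorem lsc {R κ K : ℝ} (hR : 0 < R) (hκ : 0 ≤ κ) {v : ℕ → ℝ × ℝ → ℂ} (hS : Sq R κ K v) {e : ℝ}
    (he : Tendsto (fun j => ∫ p, dens κ (v j) p ∂(mu R)) atTop (𝓝 e)) {t : ℕ → ℝ}
    (ht : Tendsto t atTop (𝓝 0))
    (htail : ∀ j N, ∫ p, (1 - PP N p) * ‖v j p‖ ^ 2 ∂(mu R) ≤ t N) :
    ∃ φ, Cls R φ ∧ ∫ p, dens κ φ p ∂(mu R) ≤ e := by
  obtain ⟨φ, hφ, hb, hl⟩ := limit_fn hR hS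
  have c1 := gsq_cont hφ; have c2 := hφ.continuous
  have vc1 := fun j => gsq_cont (hS.c1 j); have vc2 := fun j => (hS.c1 j).continuous
  have vi4 : ∀ j, Integrable (fun p => ‖v j p‖ ^ 4) (mu R) := by
    intro j
    have c := vc2 j
    refine ((hS.i2 j).const_mul 4).mono' (by fun_prop) (Eventually.of_forall fun p => ?_)
    rw [Real.norm_of_nonneg (by positivity)]
    have := hS.sup j p
    nlinarith [sq_nonneg ‖v j p‖, mul_nonneg (sq_nonneg ‖v j p‖) (by nlinarith [norm_nonneg (v j p)] : 0 ≤ 4 - ‖v j p‖ ^ 2)]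
  have q4 : ∀ j p, ‖v j p‖ ^ 4 ≤ 4 * ‖v j p‖ ^ 2 := by
    intro j p
    have := hS.sup j p
    nlinarith [mul_nonneg (sq_nonneg ‖v j p‖) (by nlinarith [norm_nonneg (v j p)] : 0 ≤ 4 - ‖v j p‖ ^ 2)]
  have vcls : ∀ j, Cls R (v j) := fun j => ⟨hS.c1 j, hS.bd j, hS.ig j, hS.i2 j, vi4 j⟩
  -- integrability of the gradient
  have bg : ∀ N : ℕ, ∫ p, PP N p * gsq φ p ∂(mu R) ≤ K := by
    intro N
    obtain ⟨T, hT, h⟩ := low hR hS hφ hb hl le_rfl N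
    have z : ∀ w, dens 0 w = gsq w := by intro w; funext p; simp [dens]
    simp_rw [z] at h
    refine le_of_T hT fun j => (h j).trans ?_
    refine (integral_mono (PP_int (vc1 j) N) (hS.ig j) fun p => ?_).trans (hS.bg j)
    exact mul_le_of_le_one_left (gsq_nonneg _ _) (PP_le N p)
  have b2 : ∀ N : ℕ, ∫ p, PP N p * ‖φ p‖ ^ 2 ∂(mu R) ≤ K := by
    intro N
    have hM : (0:ℝ) < ((N + 2 : ℕ) : ℝ) := by positivity
    have hMM : (N : ℝ) + 1 < ((N + 2 : ℕ) : ℝ) := by push_cast; linarith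
    have w := sq_conv hR hM vc2 c2 (PP_cont N) (hl (N + 2) (by omega))
    refine le_of_T w fun j => ?_
    have c := vc2 j; have c' := PP_cont N
    rw [mu_nu hR hM hMM (by fun_prop) (PP_syr N _), ← integral_add (nu_int (by fun_prop)) (nu_int (by fun_prop))]
    have : ∀ p, PP N p * ‖φ p‖ ^ 2 + PP N p * (‖v j p‖ ^ 2 - ‖φ p‖ ^ 2) = PP N p * ‖v j p‖ ^ 2 := fun p => by ring
    simp_rw [this]
    rw [← mu_nu hR hM hMM (by fun_prop) (PP_syr N _)]
    refine (integral_mono (PP_int (by fun_prop) N) (hS.i2 j) fun p => ?_).trans (hS.b2 j)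
    exact mul_le_of_le_one_left (by positivity) (PP_le N p)
  have b4 : ∀ N : ℕ, ∫ p, PP N p * ‖φ p‖ ^ 4 ∂(mu R) ≤ K + 4 * K + 2 * K := by
    intro N
    obtain ⟨T, hT, h⟩ := low hR hS hφ hb hl (c := 2) (by norm_num) N
    have a1 : ∫ p, PP N p * ‖φ p‖ ^ 4 ∂(mu R) ≤ ∫ p, PP N p * dens 2 φ p ∂(mu R) + 2 * ∫ p, PP N p * ‖φ p‖ ^ 2 ∂(mu R) := by
      rw [← integral_const_mul, ← integral_add (PP_int (dens_cont hφ) N) ((PP_int (by fun_prop) N).const_mul _)]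
      refine integral_mono (PP_int (by fun_prop) N) (iadd (PP_int (dens_cont hφ) N) ((PP_int (by fun_prop) N).const_mul _)) fun p => ?_
      have := mul_nonneg (PP_nonneg N p) (gsq_nonneg φ p)
      simp only [dens]
      linarith
    have a2 : ∫ p, PP N p * dens 2 φ p ∂(mu R) ≤ K + 4 * K := by
      refine le_of_T hT fun j => (h j).trans ?_
      have i4 := (hS.i2 j).const_mul 4
      have : ∫ p, (gsq (v j) p + 4 * ‖v j p‖ ^ 2) ∂(mu R) ≤ K + 4 * K := by
        rw [integral_add (hS.ig j) i4, integral_const_mul]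
        linarith [hS.bg j, hS.b2 j]
      refine (integral_mono (PP_int (dens_cont (hS.c1 j)) N) (iadd (hS.ig j) i4) fun p => ?_).trans this
      show PP N p * dens 2 (v j) p ≤ gsq (v j) p + 4 * ‖v j p‖ ^ 2
      have g0 := gsq_nonneg (v j) p
      have : dens 2 (v j) p ≤ gsq (v j) p + 4 * ‖v j p‖ ^ 2 := by
        unfold dens; nlinarith [q4 j p, sq_nonneg ‖v j p‖]
      calc _ ≤ PP N p * (gsq (v j) p + 4 * ‖v j p‖ ^ 2) := mul_le_mul_of_nonneg_left this (PP_nonneg N p)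
        _ ≤ _ := mul_le_of_le_one_left (by positivity) (PP_le N p)
    linarith [b2 N]
  have hcls : Cls R φ := ⟨hφ, hb, integrable_of_PP c1 (gsq_nonneg φ) bg,
    integrable_of_PP (by fun_prop) (fun p => by positivity) b2,
    integrable_of_PP (by fun_prop) (fun p => by positivity) b4⟩
  refine ⟨φ, hcls, ?_⟩
  have fin : ∀ N : ℕ, ∫ p, PP N p * dens κ φ p ∂(mu R) ≤ e + κ * t N := by
    intro N
    obtain ⟨T, hT, h⟩ := low hR hS hφ hb hl hκ N
    have l1 : Tendsto (fun j => ∫ p, PP N p * dens κ φ p ∂(mu R) + T j) UU (𝓝 (∫ p, PP N p * dens κ φ p ∂(mu R) + 0)) :=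
      hT.const_add _
    rw [add_zero] at l1
    refine le_of_tendsto_of_tendsto' l1 ((he.mono_left UU_le).add_const _) fun j => (h j).trans ?_
    have c := vc2 j; have c' := PP_cont N
    have i1 : Integrable (fun p => (1 - PP N p) * ‖v j p‖ ^ 2) (mu R) := by
      refine (hS.i2 j).mono' (by fun_prop) (Eventually.of_forall fun p => ?_)
      rw [Real.norm_of_nonneg (mul_nonneg (by linarith [PP_le N p]) (by positivity))]
      exact mul_le_of_le_one_left (by positivity) (by linarith [PP_nonneg N p])
    have i2 := (vcls j).idens (κ := κ)
    have : ∫ p, (dens κ (v j) p + κ * ((1 - PP N p) * ‖v j p‖ ^ 2)) ∂(mu R) ≤ ∫ p, dens κ (v j) p ∂(mu R) + κ * t N := by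
      rw [integral_add i2 (i1.const_mul κ), integral_const_mul]
      gcongr
      exact htail j N
    refine (integral_mono (PP_int (dens_cont (hS.c1 j)) N) (iadd i2 (i1.const_mul κ)) fun p => ?_).trans this
    show PP N p * dens κ (v j) p ≤ dens κ (v j) p + κ * ((1 - PP N p) * ‖v j p‖ ^ 2)
    have : 0 ≤ (1 - PP N p) * (gsq (v j) p + κ / 2 * ‖v j p‖ ^ 4) :=
      mul_nonneg (by linarith [PP_le N p]) (by have := gsq_nonneg (v j) p; positivity)
    unfold dens
    linarith
  have l2 := (ht.const_mul κ).const_add e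
  rw [mul_zero, add_zero] at l2
  exact le_of_tendsto_of_tendsto' (PP_lim_int hcls.idens (dens_cont hφ)) l2 fin

end SM
end

open MeasureTheory Real Set Filter Topology

noncomputable section

namespace SM

/-- amplitude truncation profile -/
def tq (s : ℝ) : ℝ := (√(max s 1))⁻¹
def tg (s : ℝ) : ℝ := 2 * tq s - tq s ^ 2
def tgd (s : ℝ) : ℝ := -tq s ^ 3 + tq s ^ 4

lemma tq_pos (s : ℝ) : 0 < tq s := by unfold tq; positivity
lemma tq_le (s : ℝ) : tq s ≤ 1 := by
  unfold tq
  apply inv_le_one_of_one_le₀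
  rw [Real.one_le_sqrt]
  exact le_max_right _ _
lemma tq_sq (s : ℝ) : tq s ^ 2 * max s 1 = 1 := by
  unfold tq
  rw [inv_pow, Real.sq_sqrt (by positivity)]
  exact inv_mul_cancel₀ (by positivity)
lemma tq_one {s : ℝ} (h : s ≤ 1) : tq s = 1 := by
  unfold tq; rw [max_eq_right h]; simp
lemma tq_cont : Continuous tq := by
  unfold tq
  refine Continuous.inv₀ (by fun_prop) (fun s => by positivity)
lemma thd_cont : Continuous tgd := by
  have := tq_cont
  unfold tgd; fun_prop

lemma tg_deriv (s : ℝ) : HasDerivAt tg (tgd s) s := by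
  have hl : ∀ s : ℝ, s ≤ 1 → HasDerivWithinAt tg (tgd s) (Iic 1) s := by
    intro s hs
    have e : tgd s = 0 := by unfold tgd; rw [tq_one hs]; norm_num
    rw [e]
    refine (hasDerivWithinAt_const s (Iic 1) (1:ℝ)).congr (fun x hx => ?_) ?_
    · unfold tg; rw [tq_one hx]; norm_num
    · unfold tg; rw [tq_one hs]; norm_num
  have hr : ∀ s : ℝ, 1 ≤ s → HasDerivWithinAt tg (tgd s) (Ici 1) s := by
    intro s hs
    have hs0 : s ≠ 0 := by positivity
    have hq : √s ≠ 0 := by positivity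
    have h1 : HasDerivAt (fun s => 2 * (√s)⁻¹ - ((√s)⁻¹) ^ 2)
        (2 * (-(1 / (2 * √s)) / (√s) ^ 2) - (2 : ℕ) * ((√s)⁻¹) ^ (2 - 1) * (-(1 / (2 * √s)) / (√s) ^ 2)) s := by
      have a := (Real.hasDerivAt_sqrt hs0).inv hq
      exact (a.const_mul 2).sub (a.pow 2)
    have e : (2 * (-(1 / (2 * √s)) / (√s) ^ 2) - (2 : ℕ) * ((√s)⁻¹) ^ (2 - 1) * (-(1 / (2 * √s)) / (√s) ^ 2)) = tgd s := by
      unfold tgd tq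
      rw [max_eq_left hs]
      simp only [Nat.add_one_sub_one, pow_one, Nat.cast_ofNat]
      field_simp
      ring
    rw [e] at h1
    refine h1.hasDerivWithinAt.congr (fun x hx => ?_) ?_
    · unfold tg tq; rw [max_eq_left hx]
    · unfold tg tq; rw [max_eq_left hs]
  rcases lt_trichotomy s 1 with h | h | h
  · exact (hl s h.le).hasDerivAt (Iic_mem_nhds h)
  · have := (hl s h.le).union (hr s h.ge)
    rwa [Iic_union_Ici, hasDerivWithinAt_univ] at this
  · exact (hr s h.le).hasDerivAt (Ici_mem_nhds h)

lemma tg_c1 : ContDiff ℝ 1 tg := by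
  rw [contDiff_one_iff_deriv]
  refine ⟨fun s => (tg_deriv s).differentiableAt, ?_⟩
  have : deriv tg = tgd := funext fun s => (tg_deriv s).deriv
  rw [this]
  exact thd_cont

lemma tg_nonneg (s : ℝ) : 0 ≤ tg s := by
  unfold tg; nlinarith [tq_pos s, tq_le s]
lemma tg_le (s : ℝ) : tg s ≤ 1 := by
  unfold tg; nlinarith [sq_nonneg (1 - tq s)]
lemma tg_sup {r : ℝ} (hr : 0 ≤ r) : tg (r ^ 2) * r ≤ 2 := by
  have h1 := tq_sq (r ^ 2)
  have h2 := tq_pos (r ^ 2)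
  have h3 : r ^ 2 ≤ max (r ^ 2) 1 := le_max_left _ _
  have h4 : (tq (r ^ 2) * r) ^ 2 ≤ 1 := by
    rw [mul_pow]; calc _ ≤ tq (r ^ 2) ^ 2 * max (r ^ 2) 1 := by gcongr
      _ = 1 := h1
  have h5 : tq (r ^ 2) * r ≤ 1 := by nlinarith
  unfold tg
  nlinarith [mul_nonneg (sq_nonneg (tq (r ^ 2))) hr]

/-- the potential does not increase -/
lemma tg_pot {r : ℝ} (hr : 0 ≤ r) : -(tg (r ^ 2) * r) ^ 2 + (tg (r ^ 2) * r) ^ 4 / 2 ≤ -r ^ 2 + r ^ 4 / 2 := by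
  by_cases h : r ^ 2 ≤ 1
  · have : tg (r ^ 2) = 1 := by unfold tg; rw [tq_one h]; norm_num
    rw [this]; linarith
  · push Not at h
    have h1 := tq_sq (r ^ 2)
    rw [max_eq_left h.le] at h1
    have h2 := tq_pos (r ^ 2)
    have h0 := tq_le (r ^ 2)
    have h3 := tg_le (r ^ 2)
    have h4 := tg_nonneg (r ^ 2)
    set a := tg (r ^ 2) * r with ha
    have h5 : tq (r ^ 2) * r = 1 := by
      have : (tq (r ^ 2) * r) ^ 2 = 1 := by rw [mul_pow]; exact h1
      have n : 0 ≤ tq (r ^ 2) * r := by positivity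
      nlinarith
    have h6 : a ≤ r := mul_le_of_le_one_left hr h3
    have h7 : 1 ≤ a := by
      rw [ha]; unfold tg; nlinarith
    have h8 : a ^ 2 ≤ r ^ 2 := by gcongr
    have h9 : 1 ≤ a ^ 2 := by nlinarith
    nlinarith [mul_nonneg (sub_nonneg.2 h8) (by linarith : 0 ≤ a ^ 2 + r ^ 2 - 2)]

lemma tg_grad {v A : ℂ} : ‖(2 * tgd (‖v‖ ^ 2) * ((starRingEnd ℂ v) * A).re : ℝ) * v + (tg (‖v‖ ^ 2) : ℂ) * A‖ ^ 2 ≤ ‖A‖ ^ 2 := by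
  set s := ‖v‖ ^ 2 with hs
  set h := tg s with hh
  set d := tgd s with hd
  set r := ((starRingEnd ℂ v) * A).re with hr
  have n : ∀ z : ℂ, ‖z‖ ^ 2 = z.re ^ 2 + z.im ^ 2 := fun z => by
    rw [← Complex.normSq_eq_norm_sq, Complex.normSq_apply]; ring
  have hr' : r = v.re * A.re + v.im * A.im := by simp [hr]
  have e : ‖(2 * d * r : ℝ) * v + (h : ℂ) * A‖ ^ 2 = h ^ 2 * ‖A‖ ^ 2 + r ^ 2 * (4 * d * (h + d * s)) := by
    rw [n, n, hs, n]
    simp only [Complex.add_re, Complex.add_im, Complex.re_ofReal_mul, Complex.im_ofReal_mul]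
    rw [hr']; ring
  rw [e]
  have h0 : 0 ≤ h := tg_nonneg s
  have h1 : h ≤ 1 := tg_le s
  have hA : 0 ≤ ‖A‖ ^ 2 := by positivity
  have hcs : r ^ 2 ≤ s * ‖A‖ ^ 2 := by
    rw [hs, n, n, hr']
    nlinarith [sq_nonneg (v.re * A.im - v.im * A.re)]
  have hh2 : h ^ 2 * ‖A‖ ^ 2 ≤ ‖A‖ ^ 2 := mul_le_of_le_one_left hA (by nlinarith)
  have hm : -1 ≤ h + 2 * s * d ∧ h + 2 * s * d ≤ 1 := by
    by_cases hs1 : s ≤ 1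
    · rw [hd, hh]; unfold tg tgd; rw [tq_one hs1]; norm_num
    · push Not at hs1
      have k := tq_sq s
      rw [max_eq_left hs1.le] at k
      have k1 := tq_pos s
      have k2 := tq_le s
      have : h + 2 * s * d = tq s ^ 2 := by
        rw [hd, hh]; unfold tg tgd
        linear_combination (-2 * tq s + 2 * tq s ^ 2) * k
      rw [this]
      constructor <;> nlinarith
  have hm2 : (h + 2 * s * d) ^ 2 ≤ 1 := by nlinarith [hm.1, hm.2]
  by_cases hq : 4 * d * (h + d * s) ≤ 0
  · nlinarith [mul_nonneg (sq_nonneg r) (neg_nonneg.2 hq)]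
  · push Not at hq
    have a1 := mul_le_mul_of_nonneg_right hcs hq.le
    have a2 : h ^ 2 * ‖A‖ ^ 2 + s * ‖A‖ ^ 2 * (4 * d * (h + d * s)) = ‖A‖ ^ 2 * (h + 2 * s * d) ^ 2 := by ring
    have a3 : ‖A‖ ^ 2 * (h + 2 * s * d) ^ 2 ≤ ‖A‖ ^ 2 := mul_le_of_le_one_right hA hm2
    linarith

/-- truncated function -/
def tr (v : ℝ × ℝ → ℂ) (p : ℝ × ℝ) : ℂ := (tg (‖v p‖ ^ 2) : ℂ) * v p

lemma nsq_c1 {v : ℝ × ℝ → ℂ} (hv : ContDiff ℝ 1 v) : ContDiff ℝ 1 (fun p => (tg (‖v p‖ ^ 2) : ℂ)) :=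
  Complex.ofRealCLM.contDiff.comp (tg_c1.comp (hv.norm_sq ℝ))

lemma der_th {g : ℝ → ℂ} {g' : ℂ} {t : ℝ} (hg : HasDerivAt g g' t) :
    HasDerivAt (fun t => (tg (‖g t‖ ^ 2) : ℂ)) ((2 * tgd (‖g t‖ ^ 2) * ((starRingEnd ℂ (g t)) * g').re : ℝ) : ℂ) t := by
  have h1 := hg.norm_sq
  have h2 := ((tg_deriv _).comp t h1).ofReal_comp
  have e : (2 * tgd (‖g t‖ ^ 2) * ((starRingEnd ℂ (g t)) * g').re : ℝ) = tgd (‖g t‖ ^ 2) * (2 * inner ℝ (g t) g') := by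
    rw [Complex.inner]
    ring
  rw [e]
  exact h2

lemma tr_c1 {v : ℝ × ℝ → ℂ} (hv : ContDiff ℝ 1 v) : ContDiff ℝ 1 (tr v) := (nsq_c1 hv).mul hv

lemma dx_tr {v : ℝ × ℝ → ℂ} (hv : ContDiff ℝ 1 v) (p : ℝ × ℝ) :
    dx (tr v) p = (2 * tgd (‖v p‖ ^ 2) * ((starRingEnd ℂ (v p)) * dx v p).re : ℝ) * v p + (tg (‖v p‖ ^ 2) : ℂ) * dx v p := by
  unfold tr
  rw [dx_mul (c1d (nsq_c1 hv) p) (c1d hv p)]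
  congr 2
  exact (hasDerivAt_dx (nsq_c1 hv) p.1 p.2).unique (der_th (hasDerivAt_dx hv p.1 p.2))

lemma D2_tr {v : ℝ × ℝ → ℂ} (hv : ContDiff ℝ 1 v) (p : ℝ × ℝ) :
    D2 (tr v) p = (2 * tgd (‖v p‖ ^ 2) * ((starRingEnd ℂ (v p)) * D2 v p).re : ℝ) * v p + (tg (‖v p‖ ^ 2) : ℂ) * D2 v p := by
  have e : dy (tr v) p = (2 * tgd (‖v p‖ ^ 2) * ((starRingEnd ℂ (v p)) * dy v p).re : ℝ) * v p + (tg (‖v p‖ ^ 2) : ℂ) * dy v p := by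
    unfold tr
    rw [dy_mul (c1d (nsq_c1 hv) p) (c1d hv p)]
    congr 2
    exact (hasDerivAt_dy (nsq_c1 hv) p.1 p.2).unique (der_th (hasDerivAt_dy hv p.1 p.2))
  have r : ((starRingEnd ℂ (v p)) * D2 v p).re = ((starRingEnd ℂ (v p)) * dy v p).re := by
    unfold D2; simp; ring
  rw [r]
  unfold D2
  rw [e]
  unfold tr
  ring

lemma tr_gsq {v : ℝ × ℝ → ℂ} (hv : ContDiff ℝ 1 v) (p : ℝ × ℝ) : gsq (tr v) p ≤ gsq v p := by
  unfold gsq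
  rw [dx_tr hv, D2_tr hv]
  exact add_le_add tg_grad tg_grad

lemma tr_norm (v : ℝ × ℝ → ℂ) (p : ℝ × ℝ) : ‖tr v p‖ = tg (‖v p‖ ^ 2) * ‖v p‖ := by
  unfold tr; rw [norm_mul, Complex.norm_real, Real.norm_of_nonneg (tg_nonneg _)]

lemma tr_sup (v : ℝ × ℝ → ℂ) (p : ℝ × ℝ) : ‖tr v p‖ ≤ 2 := by
  rw [tr_norm]; exact tg_sup (norm_nonneg _)

lemma tr_le (v : ℝ × ℝ → ℂ) (p : ℝ × ℝ) : ‖tr v p‖ ≤ ‖v p‖ := by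
  rw [tr_norm]; exact mul_le_of_le_one_left (norm_nonneg _) (tg_le _)

lemma tr_cls {R : ℝ} {v : ℝ × ℝ → ℂ} (hv : Cls R v) : Cls R (tr v) := by
  have c1 := tr_c1 hv.c1
  have c2 := c1.continuous
  refine ⟨c1, fun y => ?_, ?_, ?_, ?_⟩
  · unfold tr; rw [(hv.bd y).1, (hv.bd y).2]; simp
  · refine hv.ig.mono' (gsq_cont c1).aestronglyMeasurable (Eventually.of_forall fun p => ?_)
    rw [Real.norm_of_nonneg (gsq_nonneg _ _)]; exact tr_gsq hv.c1 p
  · refine hv.i2.mono' (by fun_prop) (Eventually.of_forall fun p => ?_)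
    rw [Real.norm_of_nonneg (by positivity)]; have := tr_le v p; gcongr
  · refine hv.i4.mono' (by fun_prop) (Eventually.of_forall fun p => ?_)
    rw [Real.norm_of_nonneg (by positivity)]; have := tr_le v p; gcongr

lemma tr_en {R κ : ℝ} (hκ : 0 ≤ κ) {v : ℝ × ℝ → ℂ} (hv : Cls R v) :
    ∫ p, dens κ (tr v) p ∂(mu R) ≤ ∫ p, dens κ v p ∂(mu R) := by
  refine integral_mono (tr_cls hv).idens hv.idens fun p => ?_
  have h1 := tr_gsq hv.c1 p
  have h2 := mul_le_mul_of_nonneg_left (tg_pot (norm_nonneg (v p))) hκ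
  unfold dens
  rw [tr_norm]
  linarith

end SM
end

open MeasureTheory Real Set Filter Topology

noncomputable section

namespace SM

lemma nsq_add (a b : ℂ) (t : ℝ) : ‖a + t * b‖ ^ 2 = ‖a‖ ^ 2 + 2 * t * (a * (starRingEnd ℂ b)).re + t ^ 2 * ‖b‖ ^ 2 := by
  have n : ∀ z : ℂ, ‖z‖ ^ 2 = z.re ^ 2 + z.im ^ 2 := fun z => by
    rw [← Complex.normSq_eq_norm_sq, Complex.normSq_apply]; ring
  rw [n, n, n]
  simp
  ring

def pert (v φ : ℝ × ℝ → ℂ) (t : ℝ) (p : ℝ × ℝ) : ℂ := v p + (t : ℂ) * φ p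

lemma pert_c1 {v φ : ℝ × ℝ → ℂ} (hv : ContDiff ℝ 1 v) (hφ : ContDiff ℝ 1 φ) (t : ℝ) :
    ContDiff ℝ 1 (pert v φ t) := hv.add (contDiff_const.mul hφ)

lemma dx_pert {v φ : ℝ × ℝ → ℂ} (hv : ContDiff ℝ 1 v) (hφ : ContDiff ℝ 1 φ) (t : ℝ) (p : ℝ × ℝ) :
    dx (pert v φ t) p = dx v p + t * dx φ p := by
  unfold pert
  rw [dx_add (c1d hv p) (c1d (contDiff_const.mul hφ) p), dx_mul (c1d contDiff_const p) (c1d hφ p)]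
  simp [dx]

lemma D2_pert {v φ : ℝ × ℝ → ℂ} (hv : ContDiff ℝ 1 v) (hφ : ContDiff ℝ 1 φ) (t : ℝ) (p : ℝ × ℝ) :
    D2 (pert v φ t) p = D2 v p + t * D2 φ p := by
  have : dy (pert v φ t) p = dy v p + t * dy φ p := by
    unfold pert
    rw [dy_add (c1d hv p) (c1d (contDiff_const.mul hφ) p), dy_mul (c1d contDiff_const p) (c1d hφ p)]
    simp [dy]
  unfold D2
  rw [this]
  unfold pert
  ring

def Qr (κ : ℝ) (φ : ℝ × ℝ → ℂ) (p : ℝ × ℝ) : ℝ := gsq φ p + κ * (20 * ‖φ p‖ ^ 2 + ‖φ p‖ ^ 4)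

lemma conj_eq (κ : ℝ) (v φ : ℝ × ℝ → ℂ) (p : ℝ × ℝ) :
    elI κ v (fun q => (starRingEnd ℂ) (φ q)) p = dx v p * (starRingEnd ℂ) (dx φ p)
      + D2 v p * (starRingEnd ℂ) (D2 φ p) + (κ * (‖v p‖ ^ 2 - 1) : ℝ) * (v p * (starRingEnd ℂ) (φ p)) := by
  unfold elI
  rw [dx_conj, dy_conj]
  unfold D2
  simp
  ring

lemma dens_pert {κ : ℝ} (hκ : 0 ≤ κ) {v φ : ℝ × ℝ → ℂ} (hv : ContDiff ℝ 1 v) (hφ : ContDiff ℝ 1 φ)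
    (hs : ∀ p, ‖v p‖ ≤ 2) {t : ℝ} (ht : |t| ≤ 1) (p : ℝ × ℝ) :
    dens κ (pert v φ t) p ≤ dens κ v p + t * (2 * (elI κ v (fun q => (starRingEnd ℂ) (φ q)) p).re)
      + t ^ 2 * Qr κ φ p := by
  unfold dens gsq Qr
  rw [dx_pert hv hφ, D2_pert hv hφ, conj_eq]
  have e : ‖pert v φ t p‖ ^ 4 = (‖pert v φ t p‖ ^ 2) ^ 2 := by ring
  rw [e]
  have e2 : ‖pert v φ t p‖ ^ 2 = _ := nsq_add (v p) (φ p) t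
  rw [e2, nsq_add, nsq_add, Complex.add_re, Complex.add_re, Complex.re_ofReal_mul]
  unfold gsq
  set a := ‖v p‖ with ha
  set c := ‖φ p‖ with hc
  set b := (v p * (starRingEnd ℂ) (φ p)).re with hb
  have a0 : 0 ≤ a := norm_nonneg _
  have c0 : 0 ≤ c := norm_nonneg _
  have hbb : b ^ 2 ≤ a ^ 2 * c ^ 2 := by
    have : |b| ≤ a * c := by
      refine (Complex.abs_re_le_norm _).trans ?_
      rw [norm_mul, RCLike.norm_conj]
    rw [← mul_pow, ← sq_abs b]
    gcongr
  have ha2 : a ^ 2 ≤ 4 := by nlinarith [hs p]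
  have hb4 : b ^ 2 ≤ 4 * c ^ 2 := hbb.trans (by nlinarith [sq_nonneg c])
  have t2 : t ^ 2 ≤ 1 := by rw [← sq_abs]; nlinarith [abs_nonneg t]
  have ac : a ^ 2 * c ^ 2 ≤ 4 * c ^ 2 := by nlinarith [sq_nonneg c]
  have s2 : (2 * t * b + t ^ 2 * c ^ 2) ^ 2 ≤ t ^ 2 * (32 * c ^ 2 + 2 * c ^ 4) := by
    have i1 : (2 * t * b + t ^ 2 * c ^ 2) ^ 2 ≤ t ^ 2 * (8 * b ^ 2 + 2 * t ^ 2 * c ^ 4) := by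
      nlinarith [sq_nonneg (2 * t * b - t ^ 2 * c ^ 2)]
    refine i1.trans ?_
    apply mul_le_mul_of_nonneg_left _ (sq_nonneg t)
    have : t ^ 2 * c ^ 4 ≤ c ^ 4 := mul_le_of_le_one_left (by positivity) t2
    linarith
  have s3 := mul_le_mul_of_nonneg_left s2 hκ
  have s4 := mul_le_mul_of_nonneg_left (mul_le_mul_of_nonneg_left ac hκ) (sq_nonneg t)
  have s5 : 0 ≤ t ^ 2 * κ * c ^ 2 := by positivity
  linarith

lemma pert_cls {R κ : ℝ} (hκ : 0 ≤ κ) {v φ : ℝ × ℝ → ℂ} (hv : Cls R v) (hφ : ContDiff ℝ 1 φ) (hc : CptY φ) (hb : Bd R φ) (t : ℝ) :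
    Cls R (pert v φ t) := by
  have c1 := pert_c1 hv.c1 hφ t
  obtain ⟨M, hM⟩ := hc
  have sφ : Sy M φ := hM
  have gen : ∀ f g : ℝ × ℝ → ℝ, Continuous f → Continuous g → Integrable g (mu R) → (∀ p, M < |p.2| → f p = g p) →
      Integrable f (mu R) := by
    intro f g hf hg hi h
    have : Integrable (fun p => f p - g p) (mu R) :=
      CptY.integrable ⟨M, fun p hp => by simp [h p hp]⟩ (hf.sub hg)
    have h2 := iadd this hi
    simpa using h2
  have k1 := c1.continuous
  have k2 := hv.c1.continuous
  refine ⟨c1, fun y => ?_, ?_, ?_, ?_⟩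
  · unfold pert; rw [(hv.bd y).1, (hv.bd y).2, (hb y).1, (hb y).2]; simp
  · refine gen _ _ (gsq_cont c1) (gsq_cont hv.c1) hv.ig fun p hp => ?_
    unfold gsq
    rw [dx_pert hv.c1 hφ, D2_pert hv.c1 hφ]
    unfold D2
    rw [sφ.dx p hp, sφ.dy p hp, sφ p hp]; simp
  · refine gen _ _ (by fun_prop) (by fun_prop) hv.i2 fun p hp => ?_
    unfold pert; rw [sφ p hp]; simp
  · refine gen _ _ (by fun_prop) (by fun_prop) hv.i4 fun p hp => ?_
    unfold pert; rw [sφ p hp]; simp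

lemma elI_int {R κ : ℝ} {v ψ : ℝ × ℝ → ℂ} (hv : ContDiff ℝ 1 v) (hψ : ContDiff ℝ 1 ψ) (hc : CptY ψ) :
    Integrable (elI κ v ψ) (mu R) := by
  obtain ⟨M, hM⟩ := hc
  have s : Sy M ψ := hM
  refine CptY.integrable ⟨M, fun p hp => ?_⟩ (elI_cont hv hψ)
  unfold elI
  rw [s.dx p hp, s.dy p hp, s p hp]; simp

lemma conj_cpt {φ : ℝ × ℝ → ℂ} (hc : CptY φ) : CptY (fun q => (starRingEnd ℂ) (φ q)) := by
  obtain ⟨M, hM⟩ := hc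
  exact ⟨M, fun p hp => by simp [hM p hp]⟩

lemma el_ineq {R κ e : ℝ} (hκ : 0 ≤ κ) (hmin : ∀ w, Cls R w → e ≤ ∫ p, dens κ w p ∂(mu R)) {v φ : ℝ × ℝ → ℂ}
    (hv : Cls R v) (hs : ∀ p, ‖v p‖ ≤ 2) (hφ : ContDiff ℝ 1 φ) (hc : CptY φ) (hb : Bd R φ) {t : ℝ} (ht : |t| ≤ 1) :
    e ≤ ∫ p, dens κ v p ∂(mu R) + t * (2 * (∫ p, elI κ v (fun q => (starRingEnd ℂ) (φ q)) p ∂(mu R)).re)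
      + t ^ 2 * ∫ p, Qr κ φ p ∂(mu R) := by
  have h1 := hmin _ (pert_cls hκ hv hφ hc hb t)
  refine h1.trans ?_
  have ie := elI_int (κ := κ) (R := R) hv.c1 (conj_c1 hφ) (conj_cpt hc)
  have iq : Integrable (Qr κ φ) (mu R) := by
    obtain ⟨M, hM⟩ := hc
    have s : Sy M φ := hM
    have k1 := gsq_cont hφ
    have k2 := hφ.continuous
    refine CptY.integrable ⟨M, fun p hp => ?_⟩ (by unfold Qr; fun_prop)
    unfold Qr gsq D2
    rw [s.dx p hp, s.dy p hp, s p hp]; simp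
  have r1 : (∫ p, elI κ v (fun q => (starRingEnd ℂ) (φ q)) p ∂(mu R)).re
      = ∫ p, (elI κ v (fun q => (starRingEnd ℂ) (φ q)) p).re ∂(mu R) := (integral_re ie).symm
  have ir : Integrable (fun p => (elI κ v (fun q => (starRingEnd ℂ) (φ q)) p).re) (mu R) := ie.re
  have i1 : Integrable (fun p => t * (2 * (elI κ v (fun q => (starRingEnd ℂ) (φ q)) p).re)) (mu R) :=
    (ir.const_mul 2).const_mul t
  rw [r1, ← integral_const_mul, ← integral_const_mul, ← integral_const_mul, ← integral_add hv.idens i1,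
    ← integral_add (iadd hv.idens i1) (iq.const_mul _)]
  exact integral_mono (pert_cls hκ hv hφ hc hb t).idens (iadd (iadd hv.idens i1) (iq.const_mul _))
    (fun p => dens_pert hκ hv.c1 hφ hs ht p)

lemma quad_conv {δ x : ℕ → ℝ} {q : ℝ} (hδ : Tendsto δ atTop (𝓝 0))
    (h : ∀ j t, |t| ≤ 1 → 0 ≤ δ j + t * x j + t ^ 2 * q) : Tendsto x atTop (𝓝 0) := by
  rw [Metric.tendsto_nhds]
  intro ε hε
  set τ := min 1 (ε / (2 * (|q| + 1))) with hτ
  have τ0 : 0 < τ := lt_min one_pos (by positivity)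
  have τ1 : τ ≤ 1 := min_le_left _ _
  have τ2 : τ * q < ε / 2 + ε / 4 := by
    have a : τ * (|q| + 1) ≤ ε / 2 := by
      calc _ ≤ ε / (2 * (|q| + 1)) * (|q| + 1) := by gcongr; exact min_le_right _ _
        _ = ε / 2 := by field_simp
    have b : τ * q ≤ τ * (|q| + 1) := by gcongr; linarith [le_abs_self q]
    linarith
  filter_upwards [(Metric.tendsto_nhds.1 hδ) (τ * ε / 4) (by positivity)] with j hj
  rw [Real.dist_eq, sub_zero] at hj ⊢
  have hj' := (le_abs_self _).trans_lt hj
  have h1 := h j τ (by rwa [abs_of_pos τ0])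
  have h2 := h j (-τ) (by rwa [abs_neg, abs_of_pos τ0])
  rw [abs_lt]
  constructor
  · have : 0 < τ * (x j + ε) := by nlinarith
    linarith [(mul_pos_iff_of_pos_left τ0).1 this]
  · have : 0 < τ * (ε - x j) := by nlinarith
    linarith [(mul_pos_iff_of_pos_left τ0).1 this]

theorem el_conv {R κ e : ℝ} (hκ : 0 ≤ κ) (hmin : ∀ w, Cls R w → e ≤ ∫ p, dens κ w p ∂(mu R)) {v : ℕ → ℝ × ℝ → ℂ}
    (hv : ∀ j, Cls R (v j)) (hs : ∀ j p, ‖v j p‖ ≤ 2)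
    (he : Tendsto (fun j => ∫ p, dens κ (v j) p ∂(mu R)) atTop (𝓝 e))
    {ψ : ℝ × ℝ → ℂ} (hψ : ContDiff ℝ 1 ψ) (hc : CptY ψ) (hb : Bd R ψ) :
    Tendsto (fun j => ∫ p, elI κ (v j) ψ p ∂(mu R)) atTop (𝓝 0) := by
  have re : ∀ ψ : ℝ × ℝ → ℂ, ContDiff ℝ 1 ψ → CptY ψ → Bd R ψ →
      Tendsto (fun j => (∫ p, elI κ (v j) ψ p ∂(mu R)).re) atTop (𝓝 0) := by
    intro ψ hψ hc hb
    have hδ := he.sub_const e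
    rw [sub_self] at hδ
    have bb : Bd R (fun q => (starRingEnd ℂ) (ψ q)) := fun y => by simp [(hb y).1, (hb y).2]
    have := quad_conv hδ (x := fun j => 2 * (∫ p, elI κ (v j) ψ p ∂(mu R)).re) (fun j t ht => by
      have := el_ineq hκ hmin (hv j) (hs j) (conj_c1 hψ) (conj_cpt hc) bb ht
      simp only [Complex.conj_conj] at this
      linarith)
    have h := this.const_mul (1/2)
    rw [mul_zero] at h
    exact h.congr fun j => by ring
  have h1 := re ψ hψ hc hb
  have h2 := re (fun p => -Complex.I * ψ p) (contDiff_const.mul hψ)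
    (by obtain ⟨M, hM⟩ := hc; exact ⟨M, fun p hp => by simp [hM p hp]⟩)
    (fun y => by simp [(hb y).1, (hb y).2])
  have lin : ∀ j, ∫ p, elI κ (v j) (fun p => -Complex.I * ψ p) p ∂(mu R) = -Complex.I * ∫ p, elI κ (v j) ψ p ∂(mu R) := by
    intro j
    rw [← integral_const_mul]
    congr 1
    funext p
    unfold elI
    rw [dx_mul (c1d contDiff_const p) (c1d hψ p), dy_mul (c1d contDiff_const p) (c1d hψ p)]
    simp [dx, dy]
    ring
  simp_rw [lin] at h2
  simp only [neg_mul, Complex.neg_re, Complex.I_mul_re, neg_neg] at h2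
  have h3 := (Complex.continuous_ofReal.tendsto _).comp h1
  have h4 := ((Complex.continuous_ofReal.tendsto _).comp h2).mul_const Complex.I
  have h5 := h3.add h4
  simp only [Complex.ofReal_zero, zero_mul, add_zero] at h5
  refine h5.congr fun j => ?_
  exact Complex.re_add_im _

end SM
end

open MeasureTheory Real Set Filter Topology

noncomputable section

namespace SM

def sh (h : ℝ) (p : ℝ × ℝ) : ℝ × ℝ := (p.1, p.2 + h)

lemma sh_cd (h : ℝ) {n : WithTop ℕ∞} : ContDiff ℝ n (sh h) := contDiff_fst.prodMk (contDiff_snd.add contDiff_const)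

lemma sh_int {R : ℝ} (hR : 0 < R) {f : ℝ × ℝ → ℂ} (hf : Continuous f) (hc : CptY f) (h : ℝ) :
    ∫ p, f (sh h p) ∂(mu R) = ∫ p, f p ∂(mu R) := by
  obtain ⟨M, hM⟩ := hc
  have c2 : CptY (fun p => f (sh h p)) := ⟨M + |h|, fun p hp => hM _ (by
    have := abs_sub_abs_le_abs_sub p.2 (-h)
    rw [abs_neg, sub_neg_eq_add] at this
    show M < |p.2 + h|
    linarith)⟩
  rw [int_inner hR (c2.integrable (hf.comp (sh_cd h (n := 1)).continuous)),
    int_inner hR (CptY.integrable ⟨M, hM⟩ hf)]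
  exact integral_add_right_eq_self (fun y => ∫ x in (-R/2)..(R/2), f (x, y)) h

lemma der_shift {R M M' : ℝ} (hR : 0 < R) (hM : 0 < M) (hMM : M' < M) {a b : ℝ × ℝ → ℂ} (ha : Continuous a)
    (hb : ContDiff ℝ 1 b) (hs : ∀ h : ℝ, |h| < 1 → Sy M' (fun p => a p * b (sh h p)))
    (hs' : Sy M' (fun p => a p * dy b p)) :
    HasDerivAt (fun h => ∫ p, a p * b (sh h p) ∂(mu R)) (∫ p, a p * dy b p ∂(mu R)) 0 := by
  have cb := hb.continuous
  have cd := dy_cont hb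
  have e : (fun h => ∫ p, a p * b (sh h p) ∂(mu R)) =ᶠ[𝓝 0] fun h => ∫ p, a p * b (sh h p) ∂(nu R M) := by
    filter_upwards [Metric.ball_mem_nhds (0:ℝ) one_pos] with h hh
    rw [Metric.mem_ball, dist_zero_right] at hh
    exact mu_nu hR hM hMM (cmul ha (cb.comp (sh_cd h (n := 1)).continuous)) (hs h hh)
  rw [mu_nu hR hM hMM (cmul ha cd) hs']
  refine HasDerivAt.congr_of_eventuallyEq ?_ e
  obtain ⟨A, A0, hA⟩ := bdd_box (R := R) (M := M) ha
  obtain ⟨B, B0, hB⟩ := bdd_box (R := R) (M := M + 1) cd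
  have key := hasDerivAt_integral_of_dominated_loc_of_deriv_le (μ := nu R M) (x₀ := (0:ℝ)) (s := Metric.ball 0 1)
    (F := fun h p => a p * b (sh h p)) (F' := fun h p => a p * dy b (sh h p)) (bound := fun _ => A * B)
    (Metric.ball_mem_nhds (0:ℝ) one_pos)
    (Eventually.of_forall fun h => (cmul ha (cb.comp (sh_cd h (n := 1)).continuous)).aestronglyMeasurable)
    (nu_int (cmul ha (cb.comp (sh_cd 0 (n := 1)).continuous)))
    (cmul ha (cd.comp (sh_cd 0 (n := 1)).continuous)).aestronglyMeasurable
    ?_ (integrable_const _) ?_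
  · have := key.2
    have z : ∀ p : ℝ × ℝ, sh 0 p = p := fun p => by simp [sh]
    simp_rw [z] at this
    exact this
  · filter_upwards [nu_ae R M] with p hp h hh
    rw [Metric.mem_ball, dist_zero_right, Real.norm_eq_abs, abs_lt] at hh
    rw [norm_mul]
    refine mul_le_mul (hA p hp) (hB _ ⟨hp.1, ?_⟩) (norm_nonneg _) A0.le
    have := hp.2
    exact ⟨by show -(M+1) ≤ p.2 + h; linarith [this.1], by show p.2 + h ≤ M + 1; linarith [this.2]⟩
  · refine Eventually.of_forall fun p h hh => ?_
    have h1 := (hasDerivAt_dy hb p.1 (p.2 + h)).comp_const_add p.2 h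
    exact h1.const_mul (a p)

lemma J_id {R M : ℝ} (hR : 0 < R) (hM : 0 ≤ M) {v : ℝ × ℝ → ℂ} (hv : ContDiff ℝ 1 v) (hb : Bd R v)
    {η : ℝ → ℝ} (hη : ContDiff ℝ 1 η) (h0 : ∀ y, M < |y| → η y = 0) :
    ∫ p, (η p.2 : ℂ) * dx v p * (starRingEnd ℂ) (dy v p) ∂(mu R)
      = ∫ p, (starRingEnd ℂ) (dx v p) * (((deriv η p.2 : ℝ) : ℂ) * v p + (η p.2 : ℂ) * dy v p) ∂(mu R) := by
  have cv := hv.continuous; have c1 := dx_cont hv; have c2 := dy_cont hv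
  have eC : ContDiff ℝ 1 (fun p : ℝ × ℝ => (η p.2 : ℂ)) :=
    Complex.ofRealCLM.contDiff.comp (hη.comp contDiff_snd)
  have ec := eC.continuous
  have vC := conj_c1 hv
  have sE : Sy M (fun p : ℝ × ℝ => (η p.2 : ℂ)) := fun p hp => by simp [h0 _ hp]
  have dyE : ∀ p : ℝ × ℝ, dy (fun p : ℝ × ℝ => (η p.2 : ℂ)) p = ((deriv η p.2 : ℝ) : ℂ) := fun p =>
    dy_snd (g := fun y => (η y : ℂ)) ((hη.differentiable (by norm_num)) p.2).hasDerivAt.ofReal_comp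
  have dxE : ∀ p : ℝ × ℝ, dx (fun p : ℝ × ℝ => (η p.2 : ℂ)) p = 0 := fun p =>
    dx_snd (g := fun y => (η y : ℂ)) ((hη.differentiable (by norm_num)) p.2).hasDerivAt.ofReal_comp
  -- first representation
  have d1 := der_shift (R := R) (M := M + 2) (M' := M + 1) hR (by linarith) (by linarith)
    (a := fun p => (η p.2 : ℂ) * dx v p) (b := fun p => (starRingEnd ℂ) (v p)) (cmul ec c1) vC
    (fun h hh p hp => by simp [h0 p.2 (by linarith)]) (fun p hp => by simp [h0 p.2 (by linarith)])
  simp_rw [dy_conj] at d1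
  -- second representation
  have wC : ContDiff ℝ 1 (fun p => (η p.2 : ℂ) * v p) := eC.mul hv
  have sW : Sy M (fun p => (η p.2 : ℂ) * v p) := fun p hp => by simp [h0 _ hp]
  have d2 := der_shift (R := R) (M := M + 2) (M' := M + 1) hR (by linarith) (by linarith)
    (a := fun p => (starRingEnd ℂ) (dx v p)) (b := fun p => (η p.2 : ℂ) * v p) (Complex.continuous_conj.comp c1) wC
    (fun h hh p hp => by
      have := abs_sub_abs_le_abs_sub p.2 (-h)
      rw [abs_neg, sub_neg_eq_add] at this
      have h1 : M < |(sh h p).2| := by show M < |p.2 + h|; linarith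
      show _ * ((η (sh h p).2 : ℂ) * v (sh h p)) = 0
      rw [h0 _ h1]; simp) (fun p hp => by
      show _ * dy (fun p => (η p.2 : ℂ) * v p) p = 0
      rw [sW.dy p (by linarith)]; simp)
  have e1 : ∀ p, dy (fun p => (η p.2 : ℂ) * v p) p = ((deriv η p.2 : ℝ) : ℂ) * v p + (η p.2 : ℂ) * dy v p := by
    intro p
    rw [dy_mul (c1d eC p) (c1d hv p), dyE]
  simp_rw [e1] at d2
  -- relation
  have rel : ∀ h : ℝ, ∫ p, (η p.2 : ℂ) * dx v p * (starRingEnd ℂ) (v (sh h p)) ∂(mu R)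
      = -∫ p, (starRingEnd ℂ) (dx v p) * ((η (sh (-h) p).2 : ℂ) * v (sh (-h) p)) ∂(mu R) := by
    intro h
    have gC : ContDiff ℝ 1 (fun p => (η p.2 : ℂ) * (starRingEnd ℂ) (v (sh h p))) := eC.mul (vC.comp (sh_cd h))
    have gS : CptY (fun p => (η p.2 : ℂ) * (starRingEnd ℂ) (v (sh h p))) := ⟨M, fun p hp => by simp [h0 _ hp]⟩
    have i := ibp_x hR hv gC gS hb
    have l : ∀ p, dx (fun p => (η p.2 : ℂ) * (starRingEnd ℂ) (v (sh h p))) p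
        = (η p.2 : ℂ) * (starRingEnd ℂ) (dx v (sh h p)) := by
      intro p
      have vs : ContDiff ℝ 1 (fun p => (starRingEnd ℂ) (v (sh h p))) := vC.comp (sh_cd h)
      rw [dx_mul (c1d eC p) (c1d vs p), dxE]
      have : dx (fun p => (starRingEnd ℂ) (v (sh h p))) p = (starRingEnd ℂ) (dx v (sh h p)) := by
        have q1 := hasDerivAt_dx (vC.comp (sh_cd h)) p.1 p.2
        have q2 := hasDerivAt_dx vC p.1 (p.2 + h)
        have := q1.unique q2
        rw [dx_conj] at this
        exact this
      rw [this]; simp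
    simp_rw [l] at i
    have tr := sh_int hR (f := fun p => (starRingEnd ℂ) (dx v p) * ((η (sh (-h) p).2 : ℂ) * v (sh (-h) p)))
      (cmul (Complex.continuous_conj.comp c1) (wC.continuous.comp (sh_cd (-h) (n := 1)).continuous))
      ⟨M + |h|, fun p hp => by
        have := abs_sub_abs_le_abs_sub p.2 h
        have h1 : M < |(sh (-h) p).2| := by show M < |p.2 + -h|; rw [← sub_eq_add_neg]; linarith
        show _ * ((η (sh (-h) p).2 : ℂ) * v (sh (-h) p)) = 0
        rw [h0 _ h1]; simp⟩ h
    rw [← tr]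
    have z : ∀ p, sh (-h) (sh h p) = p := fun p => by simp [sh]
    simp_rw [z]
    calc _ = ∫ p, dx v p * ((η p.2 : ℂ) * (starRingEnd ℂ) (v (sh h p))) ∂(mu R) := by
          congr 1; funext p; ring
      _ = _ := i
      _ = _ := by congr 2; funext p; ring
  have d3 : HasDerivAt (fun h => -∫ p, (starRingEnd ℂ) (dx v p) * ((η (sh (-h) p).2 : ℂ) * v (sh (-h) p)) ∂(mu R))
      (∫ p, (starRingEnd ℂ) (dx v p) * (((deriv η p.2 : ℝ) : ℂ) * v p + (η p.2 : ℂ) * dy v p) ∂(mu R)) 0 := by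
    have d2' : HasDerivAt (fun h => ∫ p, (starRingEnd ℂ) (dx v p) * ((η (sh h p).2 : ℂ) * v (sh h p)) ∂(mu R))
      (∫ p, (starRingEnd ℂ) (dx v p) * (((deriv η p.2 : ℝ) : ℂ) * v p + (η p.2 : ℂ) * dy v p) ∂(mu R)) (-(0:ℝ)) := by
      rw [neg_zero]; exact d2
    have := (d2'.scomp (0:ℝ) (hasDerivAt_neg (0:ℝ))).neg
    rw [neg_one_smul, neg_neg] at this
    exact this
  have d4 := d3.congr_of_eventuallyEq (Eventually.of_forall rel)
  exact d1.unique d4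

end SM
end

open MeasureTheory Real Set Filter Topology

noncomputable section

namespace SM

lemma conf {R M : ℝ} (hR : 0 < R) (hM : 0 ≤ M) {v : ℝ × ℝ → ℂ} (hv : ContDiff ℝ 1 v) (hb : Bd R v)
    {η : ℝ → ℝ} (hη : ContDiff ℝ 1 η) (h0 : ∀ y, M < |y| → η y = 0) :
    ∫ p, η p.2 * p.2 * ‖v p‖ ^ 2 ∂(mu R) ≤ ∫ p, |η p.2| * gsq v p ∂(mu R)
      + ∫ p, |deriv η p.2| * (‖v p‖ * ‖dx v p‖) ∂(mu R) := by
  have cv := hv.continuous; have c1 := dx_cont hv; have c2 := dy_cont hv; have c3 := gsq_cont hv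
  have eC : ContDiff ℝ 1 (fun p : ℝ × ℝ => (η p.2 : ℂ)) :=
    Complex.ofRealCLM.contDiff.comp (hη.comp contDiff_snd)
  have ec := eC.continuous
  have er : Continuous η := hη.continuous
  have ed : Continuous (deriv η) := hη.continuous_deriv (by norm_num)
  have d0 : ∀ y, M < |y| → deriv η y = 0 := by
    intro y hy
    have : η =ᶠ[𝓝 y] fun _ => 0 := by
      have : IsOpen {q : ℝ | M < |q|} := isOpen_lt continuous_const continuous_abs
      filter_upwards [this.mem_nhds hy] with q hq using h0 q hq
    rw [this.deriv_eq]; simp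
  -- the commutator
  set J := ∫ p, (η p.2 : ℂ) * dx v p * (starRingEnd ℂ) (dy v p) ∂(mu R) with hJ
  have hJid := J_id hR hM hv hb hη h0
  have ib : Integrable (fun p : ℝ × ℝ => (η p.2 : ℂ) * dx v p * (starRingEnd ℂ) (dy v p)) (mu R) :=
    CptY.integrable ⟨M, fun p hp => by simp [h0 _ hp]⟩ (cmul (cmul ec c1) (Complex.continuous_conj.comp c2))
  have i1 : Integrable (fun p : ℝ × ℝ => ((deriv η p.2 : ℝ) : ℂ) * (v p * (starRingEnd ℂ) (dx v p))) (mu R) :=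
    CptY.integrable ⟨M, fun p hp => by simp [d0 _ hp]⟩ (by
      have : Continuous fun p => (starRingEnd ℂ) (dx v p) := Complex.continuous_conj.comp c1
      fun_prop)
  have i2 : Integrable (fun p : ℝ × ℝ => (starRingEnd ℂ) ((η p.2 : ℂ) * dx v p * (starRingEnd ℂ) (dy v p))) (mu R) :=
    CptY.integrable ⟨M, fun p hp => by simp [h0 _ hp]⟩ (Complex.continuous_conj.comp (cmul (cmul ec c1) (Complex.continuous_conj.comp c2)))
  have i3 : Integrable (fun p : ℝ × ℝ => |deriv η p.2| * (‖v p‖ * ‖dx v p‖)) (mu R) :=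
    CptY.integrable ⟨M, fun p hp => by simp [d0 _ hp]⟩ (by fun_prop)
  have hJ2 : J - (starRingEnd ℂ) J = ∫ p, ((deriv η p.2 : ℝ) : ℂ) * (v p * (starRingEnd ℂ) (dx v p)) ∂(mu R) := by
    rw [sub_eq_iff_eq_add]
    conv_lhs => rw [hJ, hJid]
    rw [hJ, ← integral_conj, ← integral_add i1 i2]
    congr 1
    funext p
    simp
    ring
  have hJ3 : 2 * J.im ≤ ∫ p, |deriv η p.2| * (‖v p‖ * ‖dx v p‖) ∂(mu R) := by
    have : ‖J - (starRingEnd ℂ) J‖ ≤ ∫ p, |deriv η p.2| * (‖v p‖ * ‖dx v p‖) ∂(mu R) := by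
      rw [hJ2]
      refine norm_integral_le_of_norm_le i3 (Eventually.of_forall fun p => ?_)
      rw [norm_mul, norm_mul, Complex.norm_real, RCLike.norm_conj, Real.norm_eq_abs]
    refine le_trans ?_ this
    have h2 : (J - (starRingEnd ℂ) J).im = 2 * J.im := by simp; ring
    rw [← h2]
    exact (le_abs_self _).trans (Complex.abs_im_le_norm _)
  -- integration by parts in x
  set A : ℝ × ℝ → ℝ := fun p => η p.2 * p.2 * ‖v p‖ ^ 2 + 2 * (η p.2 * p.2 * p.1) * (dx v p * (starRingEnd ℂ) (v p)).re with hA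
  have iA : Integrable A (mu R) := by
    refine CptY.integrable ⟨M, fun p hp => by simp [hA, h0 _ hp]⟩ ?_
    have : Continuous fun p => (dx v p * (starRingEnd ℂ) (v p)).re :=
      Complex.continuous_re.comp (cmul c1 (Complex.continuous_conj.comp cv))
    fun_prop
  have zA : ∫ p, A p ∂(mu R) = 0 := by
    have kC : ContDiff ℝ 1 (fun p : ℝ × ℝ => ((η p.2 * p.2 : ℝ) : ℂ)) :=
      Complex.ofRealCLM.contDiff.comp ((hη.comp contDiff_snd).mul contDiff_snd)
    have xC : ContDiff ℝ 1 (fun p : ℝ × ℝ => ((p.1 : ℝ) : ℂ)) := Complex.ofRealCLM.contDiff.comp contDiff_fst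
    have vC := conj_c1 hv
    have wC : ContDiff ℝ 1 (fun p => v p * (starRingEnd ℂ) (v p)) := hv.mul vC
    have yC : ContDiff ℝ 1 (fun p : ℝ × ℝ => ((p.1 : ℝ) : ℂ) * (v p * (starRingEnd ℂ) (v p))) := xC.mul wC
    have FC : ContDiff ℝ 1 (fun p : ℝ × ℝ => ((η p.2 * p.2 : ℝ) : ℂ) * (((p.1 : ℝ) : ℂ) * (v p * (starRingEnd ℂ) (v p)))) := kC.mul yC
    have z := int_dx_zero hR FC ⟨M, fun p hp => by simp [h0 _ hp]⟩ (fun y => by simp [(hb y).1, (hb y).2])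
    have l : ∀ p : ℝ × ℝ, dx (fun p : ℝ × ℝ => ((η p.2 * p.2 : ℝ) : ℂ) * (((p.1 : ℝ) : ℂ) * (v p * (starRingEnd ℂ) (v p)))) p = (A p : ℂ) := by
      intro p
      rw [dx_mul (c1d kC p) (c1d yC p), dx_mul (c1d xC p) (c1d wC p), dx_mul (c1d hv p) (c1d vC p), dx_conj]
      have q1 : dx (fun p : ℝ × ℝ => ((η p.2 * p.2 : ℝ) : ℂ)) p = 0 :=
        dx_snd (g := fun y => ((η y * y : ℝ) : ℂ))
          (((hη.differentiable (by norm_num)) p.2).hasDerivAt.mul (hasDerivAt_id p.2)).ofReal_comp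
      have q2 : dx (fun p : ℝ × ℝ => ((p.1 : ℝ) : ℂ)) p = 1 := by
        have := dx_fst (p := p) (g := fun y => ((y : ℝ) : ℂ)) (hasDerivAt_id p.1).ofReal_comp
        simpa using this
      rw [q1, q2]
      have q3 : v p * (starRingEnd ℂ) (v p) = ((‖v p‖ ^ 2 : ℝ) : ℂ) := by rw [Complex.mul_conj, Complex.normSq_eq_norm_sq]
      have q4 : dx v p * (starRingEnd ℂ) (v p) + v p * (starRingEnd ℂ) (dx v p) = ((2 * (dx v p * (starRingEnd ℂ) (v p)).re : ℝ) : ℂ) := by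
        apply Complex.ext <;> simp <;> ring
      rw [q3, q4]
      simp only [hA]
      push_cast
      ring
    simp_rw [l] at z
    rw [integral_complex_ofReal] at z
    exact_mod_cast z
  have iB : Integrable (fun p : ℝ × ℝ => 2 * ((η p.2 : ℂ) * dx v p * (starRingEnd ℂ) (dy v p)).im) (mu R) := ib.im.const_mul 2
  have iG : Integrable (fun p : ℝ × ℝ => |η p.2| * gsq v p) (mu R) :=
    CptY.integrable ⟨M, fun p hp => by simp [h0 _ hp]⟩ (by fun_prop)
  have iL : Integrable (fun p : ℝ × ℝ => η p.2 * p.2 * ‖v p‖ ^ 2) (mu R) :=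
    CptY.integrable ⟨M, fun p hp => by simp [h0 _ hp]⟩ (by fun_prop)
  have imJ : ∫ p, ((η p.2 : ℂ) * dx v p * (starRingEnd ℂ) (dy v p)).im ∂(mu R) = J.im := integral_im ib
  have fin : ∫ p, η p.2 * p.2 * ‖v p‖ ^ 2 ∂(mu R)
      ≤ ∫ p, (A p + 2 * ((η p.2 : ℂ) * dx v p * (starRingEnd ℂ) (dy v p)).im + |η p.2| * gsq v p) ∂(mu R) := by
    refine integral_mono iL (iadd (iadd iA iB) iG) fun p => ?_
    show η p.2 * p.2 * ‖v p‖ ^ 2 ≤ A p + 2 * ((η p.2 : ℂ) * dx v p * (starRingEnd ℂ) (dy v p)).im + |η p.2| * gsq v p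
    have e : A p + 2 * ((η p.2 : ℂ) * dx v p * (starRingEnd ℂ) (dy v p)).im
        = η p.2 * p.2 * ‖v p‖ ^ 2 + η p.2 * (2 * (dx v p * (starRingEnd ℂ) (D2 v p)).im) := by
      simp only [hA]
      unfold D2
      simp
      ring
    rw [e]
    have b : |2 * (dx v p * (starRingEnd ℂ) (D2 v p)).im| ≤ gsq v p := by
      rw [abs_mul, abs_two]
      have := Complex.abs_im_le_norm (dx v p * (starRingEnd ℂ) (D2 v p))
      rw [norm_mul, RCLike.norm_conj] at this
      unfold gsq
      nlinarith [sq_nonneg (‖dx v p‖ - ‖D2 v p‖)]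
    have : -(η p.2 * (2 * (dx v p * (starRingEnd ℂ) (D2 v p)).im)) ≤ |η p.2| * gsq v p := by
      refine (neg_le_abs _).trans ?_
      rw [abs_mul]
      gcongr
    linarith
  rw [integral_add (iadd iA iB) iG, integral_add iA iB, zA, integral_const_mul, imJ] at fin
  linarith

/-- bounded derivative of the plateau functions -/
lemma Pl_der : ∃ C, 0 ≤ C ∧ ∀ a y : ℝ, |deriv (Pl a) y| ≤ C := by
  have cd : ContDiff ℝ 1 Real.smoothTransition := Real.smoothTransition.contDiff
  have df : Differentiable ℝ Real.smoothTransition := cd.differentiable (by norm_num)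
  obtain ⟨B, hB⟩ := (isCompact_Icc (a := (0:ℝ)) (b := 1)).exists_bound_of_continuousOn
    (cd.continuous_deriv (by norm_num)).continuousOn
  have hB' : ∀ y, |deriv Real.smoothTransition y| ≤ |B| := by
    intro y
    rcases lt_or_ge y 0 with h | h
    · have : Real.smoothTransition =ᶠ[𝓝 y] fun _ => 0 := by
        filter_upwards [Iio_mem_nhds h] with z hz using Real.smoothTransition.zero_of_nonpos (le_of_lt hz)
      rw [this.deriv_eq]; simp
    rcases lt_or_ge 1 y with h1 | h1
    · have : Real.smoothTransition =ᶠ[𝓝 y] fun _ => 1 := by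
        filter_upwards [Ioi_mem_nhds h1] with z hz using Real.smoothTransition.one_of_one_le (le_of_lt hz)
      rw [this.deriv_eq]; simp
    · exact (hB y ⟨h, h1⟩).trans (le_abs_self B)
  refine ⟨2 * |B|, by positivity, fun a y => ?_⟩
  have h1 : HasDerivAt (fun y => Real.smoothTransition (a + 1 - y)) (-deriv Real.smoothTransition (a + 1 - y)) y :=
    (df _).hasDerivAt.comp_const_sub (a + 1) y
  have h2 : HasDerivAt (fun y => Real.smoothTransition (a + 1 + y)) (deriv Real.smoothTransition (a + 1 + y)) y :=
    (df _).hasDerivAt.comp_const_add (a + 1) y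
  have h3 : HasDerivAt (Pl a) _ y := h1.mul h2
  rw [h3.deriv]
  have n1 := Real.smoothTransition.nonneg (a + 1 - y)
  have n2 := Real.smoothTransition.nonneg (a + 1 + y)
  have m1 := Real.smoothTransition.le_one (a + 1 - y)
  have m2 := Real.smoothTransition.le_one (a + 1 + y)
  refine (abs_add_le _ _).trans ?_
  rw [abs_mul, abs_mul, abs_neg, abs_of_nonneg n1, abs_of_nonneg n2]
  have t1 := hB' (a + 1 - y)
  have t2 := hB' (a + 1 + y)
  have := mul_le_mul t1 m2 n2 (abs_nonneg B)
  have := mul_le_mul m1 t2 (abs_nonneg _) zero_le_one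
  linarith

end SM
end

open MeasureTheory Real Set Filter Topology

noncomputable section

namespace SM

lemma atan_abs (y : ℝ) : |Real.arctan y| ≤ 2 := by
  have h1 := Real.arctan_lt_pi_div_two y
  have h2 := Real.neg_pi_div_two_lt_arctan y
  have h3 := Real.pi_lt_four
  rw [abs_le]; constructor <;> linarith

lemma yat_even (y : ℝ) : y * Real.arctan y = |y| * Real.arctan |y| := by
  rcases abs_cases y with ⟨h, _⟩ | ⟨h, _⟩
  · rw [h]
  · rw [h, Real.arctan_neg]; ring

lemma yat_ge (y : ℝ) : (1 + |y|) / 2 ≤ 1 + y * Real.arctan y := by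
  rw [yat_even]
  have h0 := abs_nonneg y
  have h3 := Real.pi_gt_three
  have h2 : 0 ≤ Real.arctan |y| := Real.arctan_nonneg.2 h0
  rcases le_or_gt |y| 1 with h | h
  · have := mul_nonneg h0 h2
    linarith
  · have : Real.arctan 1 ≤ Real.arctan |y| := Real.arctan_strictMono.monotone h.le
    rw [Real.arctan_one] at this
    have : |y| * (1/2) ≤ |y| * Real.arctan |y| := mul_le_mul_of_nonneg_left (by linarith) h0
    linarith

lemma yat_nonneg (y : ℝ) : 0 ≤ y * Real.arctan y := by
  rw [yat_even]; exact mul_nonneg (abs_nonneg _) (Real.arctan_nonneg.2 (abs_nonneg y))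

lemma PP_tail (N : ℕ) (p : ℝ × ℝ) : 1 - PP N p ≤ 2 / ((N:ℝ) + 1) * (1 + p.2 * Real.arctan p.2) := by
  have h := yat_ge p.2
  have hN : (0:ℝ) < (N:ℝ) + 1 := by positivity
  rcases le_or_gt |p.2| N with h1 | h1
  · have : PP N p = 1 := Pl_one h1
    rw [this, sub_self]
    have := yat_nonneg p.2
    positivity
  · have := PP_nonneg N p
    have : 1 ≤ 2 / ((N:ℝ) + 1) * (1 + p.2 * Real.arctan p.2) := by
      rw [div_mul_eq_mul_div, le_div_iff₀ hN]; linarith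
    linarith

lemma conf_all : ∃ C : ℝ, 0 ≤ C ∧ ∀ R : ℝ, 0 < R → ∀ v, Cls R v →
    Integrable (fun p => p.2 * Real.arctan p.2 * ‖v p‖ ^ 2) (mu R) ∧
    ∫ p, p.2 * Real.arctan p.2 * ‖v p‖ ^ 2 ∂(mu R) ≤
      C * (∫ p, gsq v p ∂(mu R) + ∫ p, ‖v p‖ ^ 2 ∂(mu R)) := by
  obtain ⟨C0, hC0, hC⟩ := Pl_der
  refine ⟨3 + 2 * C0, by positivity, fun R hR v hv => ?_⟩
  have cv := hv.c1.continuous; have c1 := dx_cont hv.c1; have c3 := gsq_cont hv.c1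
  have ca := Real.continuous_arctan
  set f : ℝ × ℝ → ℝ := fun p => p.2 * Real.arctan p.2 * ‖v p‖ ^ 2 with hf
  have fc : Continuous f := by
    have : Continuous fun p : ℝ × ℝ => Real.arctan p.2 := ca.comp continuous_snd
    fun_prop
  have f0 : ∀ p, 0 ≤ f p := fun p => mul_nonneg (yat_nonneg _) (by positivity)
  have key : ∀ N : ℕ, ∫ p, PP N p * f p ∂(mu R) ≤
      (3 + 2 * C0) * (∫ p, gsq v p ∂(mu R) + ∫ p, ‖v p‖ ^ 2 ∂(mu R)) := by
    intro N
    set η : ℝ → ℝ := fun y => Real.arctan y * Pl N y with hη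
    have pc : ContDiff ℝ 1 (Pl N) := Pl_cd N 1
    have ec : ContDiff ℝ 1 η := Real.contDiff_arctan.mul pc
    have z : ∀ y, (N:ℝ) + 1 < |y| → η y = 0 := fun y hy => by simp [hη, Pl_zero hy.le]
    have k := conf hR (by positivity : (0:ℝ) ≤ (N:ℝ) + 1) hv.c1 hv.bd ec z
    have e1 : ∀ y, |η y| ≤ 2 := by
      intro y
      simp only [hη, abs_mul, abs_of_nonneg (Pl_nonneg N y)]
      have := mul_le_mul (atan_abs y) (Pl_le N y) (Pl_nonneg N y) (by norm_num)
      linarith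
    have e2 : ∀ y, |deriv η y| ≤ 1 + 2 * C0 := by
      intro y
      have h1 : HasDerivAt (Pl N) (deriv (Pl N) y) y := (pc.differentiable (by norm_num) y).hasDerivAt
      have h2 : HasDerivAt η _ y := (Real.hasDerivAt_arctan y).mul h1
      rw [h2.deriv]
      refine (abs_add_le _ _).trans ?_
      rw [abs_mul, abs_mul, abs_of_nonneg (Pl_nonneg N y)]
      have a1 : |1 / (1 + y ^ 2)| ≤ 1 := by
        rw [abs_of_nonneg (by positivity), div_le_one (by positivity)]; nlinarith [sq_nonneg y]
      have := mul_le_mul a1 (Pl_le N y) (Pl_nonneg N y) (by norm_num)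
      have := mul_le_mul (atan_abs y) (hC N y) (abs_nonneg _) (by norm_num)
      linarith
    have l0 : ∫ p, PP N p * f p ∂(mu R) = ∫ p, η p.2 * p.2 * ‖v p‖ ^ 2 ∂(mu R) := by
      refine integral_congr_ae (Eventually.of_forall fun p => ?_)
      show Pl N p.2 * (p.2 * Real.arctan p.2 * ‖v p‖ ^ 2) = Real.arctan p.2 * Pl N p.2 * p.2 * ‖v p‖ ^ 2
      ring
    rw [l0]
    refine k.trans ?_
    have b1 : ∫ p, |η p.2| * gsq v p ∂(mu R) ≤ ∫ p, 2 * gsq v p ∂(mu R) := by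
      refine integral_mono_of_nonneg (Eventually.of_forall fun p => ?_) (hv.ig.const_mul 2)
        (Eventually.of_forall fun p => ?_)
      · exact mul_nonneg (abs_nonneg _) (gsq_nonneg _ _)
      · exact mul_le_mul_of_nonneg_right (e1 _) (gsq_nonneg _ _)
    have b2 : ∫ p, |deriv η p.2| * (‖v p‖ * ‖dx v p‖) ∂(mu R) ≤
        ∫ p, (1 + 2 * C0) * (gsq v p + ‖v p‖ ^ 2) ∂(mu R) := by
      refine integral_mono_of_nonneg (Eventually.of_forall fun p => ?_) ((iadd hv.ig hv.i2).const_mul _)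
        (Eventually.of_forall fun p => ?_)
      · show 0 ≤ |deriv η p.2| * (‖v p‖ * ‖dx v p‖); positivity
      · refine mul_le_mul (e2 _) ?_ (by positivity) (by positivity)
        have : ‖dx v p‖ ^ 2 ≤ gsq v p := by unfold gsq; nlinarith [sq_nonneg ‖D2 v p‖]
        nlinarith [sq_nonneg (‖v p‖ - ‖dx v p‖), sq_nonneg ‖v p‖, sq_nonneg ‖dx v p‖]
    rw [integral_const_mul] at b1 b2
    rw [integral_add hv.ig hv.i2] at b2
    have : 0 ≤ ∫ p, ‖v p‖ ^ 2 ∂(mu R) := integral_nonneg fun p => by positivity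
    linarith
  have fi := integrable_of_PP fc f0 key
  exact ⟨fi, le_of_tendsto' (PP_lim_int fi fc) key⟩

/-- universal tail bound -/
lemma tails : ∃ C : ℝ, 0 ≤ C ∧ ∀ R : ℝ, 0 < R → ∀ v, Cls R v → ∀ N : ℕ,
    ∫ p, (1 - PP N p) * ‖v p‖ ^ 2 ∂(mu R) ≤
      C / ((N:ℝ) + 1) * (∫ p, gsq v p ∂(mu R) + ∫ p, ‖v p‖ ^ 2 ∂(mu R)) := by
  obtain ⟨C, hC, h⟩ := conf_all
  refine ⟨2 * (1 + C), by positivity, fun R hR v hv N => ?_⟩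
  obtain ⟨hi, hb⟩ := h R hR v hv
  have a0 : 0 ≤ ∫ p, gsq v p ∂(mu R) := integral_nonneg fun p => gsq_nonneg _ _
  have b1 : ∫ p, (1 - PP N p) * ‖v p‖ ^ 2 ∂(mu R) ≤
      ∫ p, 2 / ((N:ℝ) + 1) * (‖v p‖ ^ 2 + p.2 * Real.arctan p.2 * ‖v p‖ ^ 2) ∂(mu R) := by
    refine integral_mono_of_nonneg (Eventually.of_forall fun p => ?_) ((iadd hv.i2 hi).const_mul _)
      (Eventually.of_forall fun p => ?_)
    · exact mul_nonneg (by linarith [PP_le N p]) (by positivity)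
    · show (1 - PP N p) * ‖v p‖ ^ 2 ≤ 2 / ((N:ℝ) + 1) * (‖v p‖ ^ 2 + p.2 * Real.arctan p.2 * ‖v p‖ ^ 2)
      have := mul_le_mul_of_nonneg_right (PP_tail N p) (sq_nonneg ‖v p‖)
      linarith
  rw [integral_const_mul, integral_add hv.i2 hi] at b1
  refine b1.trans ?_
  rw [mul_div_right_comm, mul_assoc]
  refine mul_le_mul_of_nonneg_left ?_ (by positivity)
  linarith

/-- coercivity on bounded functions -/
lemma coer {R κ : ℝ} (hR : 0 < R) (hκ : 0 ≤ κ) (E : ℝ) : ∃ K : ℝ, 0 ≤ K ∧ ∀ v, Cls R v → (∀ p, ‖v p‖ ≤ 2) →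
    ∫ p, dens κ v p ∂(mu R) ≤ E → ∫ p, gsq v p ∂(mu R) ≤ K ∧ ∫ p, ‖v p‖ ^ 2 ∂(mu R) ≤ K := by
  obtain ⟨C, hC, h⟩ := tails
  obtain ⟨N, hN⟩ := exists_nat_ge (2 * C + 4 * κ * C)
  set θ := C / ((N:ℝ) + 1) with hθ
  have hN1 : (0:ℝ) < (N:ℝ) + 1 := by positivity
  have t0 : 0 ≤ θ := by positivity
  have kc : 0 ≤ κ * C := by positivity
  have t1 : θ ≤ 1 / 2 := by rw [hθ, div_le_iff₀ hN1]; linarith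
  have t2 : κ * θ ≤ 1 / 4 := by
    rw [hθ, ← mul_div_assoc, div_le_iff₀ hN1]; linarith
  set B := ∫ p, PP N p * 4 ∂(mu R) with hB
  have hB0 : 0 ≤ B := integral_nonneg fun p => mul_nonneg (PP_nonneg N p) (by norm_num)
  refine ⟨2 * (|E| + 2 * κ * B) + 2 * B, by positivity, fun v hv hs hE => ?_⟩
  have cv := hv.c1.continuous
  set a := ∫ p, gsq v p ∂(mu R)
  set b := ∫ p, ‖v p‖ ^ 2 ∂(mu R) with hb
  have a0 : 0 ≤ a := integral_nonneg fun p => gsq_nonneg _ _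
  have b0 : 0 ≤ b := integral_nonneg fun p => by positivity
  have tl := h R hR v hv N
  have i1 : Integrable (fun p => PP N p * ‖v p‖ ^ 2) (mu R) := PP_int (by fun_prop) N
  have i2 : Integrable (fun p => (1 - PP N p) * ‖v p‖ ^ 2) (mu R) := by
    have := isub hv.i2 i1
    refine this.congr (Eventually.of_forall fun p => ?_)
    show ‖v p‖ ^ 2 - PP N p * ‖v p‖ ^ 2 = (1 - PP N p) * ‖v p‖ ^ 2
    ring
  have e1 : b = ∫ p, PP N p * ‖v p‖ ^ 2 ∂(mu R) + ∫ p, (1 - PP N p) * ‖v p‖ ^ 2 ∂(mu R) := by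
    rw [← integral_add i1 i2, hb]
    refine integral_congr_ae (Eventually.of_forall fun p => ?_)
    show ‖v p‖ ^ 2 = PP N p * ‖v p‖ ^ 2 + (1 - PP N p) * ‖v p‖ ^ 2
    ring
  have e2 : ∫ p, PP N p * ‖v p‖ ^ 2 ∂(mu R) ≤ B := by
    refine integral_mono i1 (PP_int continuous_const N) fun p => ?_
    refine mul_le_mul_of_nonneg_left ?_ (PP_nonneg N p)
    have := hs p
    nlinarith [norm_nonneg (v p)]
  have e3 : a - κ * b ≤ ∫ p, dens κ v p ∂(mu R) := by
    have : a - κ * b = ∫ p, (gsq v p - κ * ‖v p‖ ^ 2) ∂(mu R) := by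
      rw [integral_sub hv.ig (hv.i2.const_mul κ), integral_const_mul]
    rw [this]
    refine integral_mono (isub hv.ig (hv.i2.const_mul κ)) hv.idens fun p => ?_
    have : 0 ≤ κ / 2 * ‖v p‖ ^ 4 := by positivity
    show gsq v p - κ * ‖v p‖ ^ 2 ≤ gsq v p - κ * ‖v p‖ ^ 2 + κ / 2 * ‖v p‖ ^ 4
    linarith
  have hEa := le_abs_self E
  have b1 : b ≤ 2 * B + 2 * θ * a := by
    have := mul_le_mul_of_nonneg_right t1 b0
    rw [← hθ, mul_add] at tl
    linarith
  have b2 : κ * b ≤ 2 * κ * B + a / 2 := by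
    have := mul_le_mul_of_nonneg_left b1 hκ
    have := mul_le_mul_of_nonneg_right t2 a0
    linarith
  have b3 : 2 * θ * a ≤ a := by
    have := mul_le_mul_of_nonneg_right t1 a0
    linarith
  constructor <;> linarith

theorem main_cls {R κ e : ℝ} (hR : 0 < R) (hκ : 0 ≤ κ)
    (hmin : ∀ w, Cls R w → e ≤ ∫ p, dens κ w p ∂(mu R))
    (hap : ∀ ε : ℝ, 0 < ε → ∃ w, Cls R w ∧ ∫ p, dens κ w p ∂(mu R) < e + ε) :
    ∃ φ, Cls R φ ∧ ∫ p, dens κ φ p ∂(mu R) ≤ e := by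
  have hap' : ∀ j : ℕ, ∃ w, Cls R w ∧ ∫ p, dens κ w p ∂(mu R) < e + 1 / ((j:ℝ) + 1) :=
    fun j => hap _ (by positivity)
  choose w hw hwe using hap'
  have hv : ∀ j, Cls R (tr (w j)) := fun j => tr_cls (hw j)
  have hs : ∀ j p, ‖tr (w j) p‖ ≤ 2 := fun j p => tr_sup _ _
  have hle : ∀ j, ∫ p, dens κ (tr (w j)) p ∂(mu R) ≤ e + 1 / ((j:ℝ) + 1) :=
    fun j => (tr_en hκ (hw j)).trans (hwe j).le
  have he : Tendsto (fun j => ∫ p, dens κ (tr (w j)) p ∂(mu R)) atTop (𝓝 e) := by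
    refine tendsto_of_tendsto_of_tendsto_of_le_of_le tendsto_const_nhds ?_ (fun j => hmin _ (hv j)) hle
    simpa using (tendsto_one_div_add_atTop_nhds_zero_nat (𝕜 := ℝ)).const_add e
  obtain ⟨K, hK, hco⟩ := coer hR hκ (e + 1)
  have hco' : ∀ j, _ := fun j => hco (tr (w j)) (hv j) (hs j) ((hle j).trans (by
    have : 1 / ((j:ℝ) + 1) ≤ 1 := by
      rw [div_le_one (by positivity)]; linarith [(Nat.cast_nonneg j : (0:ℝ) ≤ j)]
    linarith))
  obtain ⟨C, hC, htl⟩ := tails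
  have hS : Sq R κ K (fun j => tr (w j)) :=
    ⟨fun j => (hv j).c1, fun j => (hv j).bd, hs, fun j => (hv j).ig, fun j => (hv j).i2,
      fun j => (hco' j).1, fun j => (hco' j).2, fun ψ h1 h2 h3 => el_conv hκ hmin hv hs he h1 h2 h3⟩
  refine lsc hR hκ hS he (t := fun N => C / ((N:ℝ) + 1) * (K + K)) ?_ fun j N => ?_
  · have := (tendsto_one_div_add_atTop_nhds_zero_nat (𝕜 := ℝ)).const_mul (C * (K + K))
    rw [mul_zero] at this
    refine this.congr fun N => ?_
    ring
  · refine (htl R hR _ (hv j) N).trans ?_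
    refine mul_le_mul_of_nonneg_left ?_ (by positivity)
    exact add_le_add (hco' j).1 (hco' j).2

end SM
end





namespace SM

/-- gauge factor -/
def ph (s : ℝ) (p : ℝ × ℝ) : ℂ := Complex.exp (Complex.I * ((s * (p.1 * p.2 ^ 2 / 2) : ℝ) : ℂ))

lemma ph_c1 (s : ℝ) : ContDiff ℝ 1 (ph s) := by
  unfold ph
  have : ContDiff ℝ 1 (fun p : ℝ × ℝ => ((s * (p.1 * p.2 ^ 2 / 2) : ℝ) : ℂ)) :=
    Complex.ofRealCLM.contDiff.comp
      (show ContDiff ℝ 1 (fun p : ℝ × ℝ => s * (p.1 * p.2 ^ 2 / 2)) by fun_prop)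
  exact (contDiff_const.mul this).cexp

lemma ph_norm (s : ℝ) (p : ℝ × ℝ) : ‖ph s p‖ = 1 := by
  unfold ph; rw [mul_comm]; exact Complex.norm_exp_ofReal_mul_I _

lemma ph_inv (p : ℝ × ℝ) : ph (-1) p * ph 1 p = 1 := by
  unfold ph; rw [← Complex.exp_add]
  convert Complex.exp_zero using 2
  push_cast; ring

lemma dx_ph (p : ℝ × ℝ) : dx (ph (-1)) p = -(Complex.I * ((p.2 ^ 2 / 2 : ℝ) : ℂ)) * ph (-1) p := by
  have h1 := hasDerivAt_dx (ph_c1 (-1)) p.1 p.2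
  have h3 : HasDerivAt (fun t : ℝ => (-1) * (t * p.2 ^ 2 / 2)) ((-1) * (1 * p.2 ^ 2 / 2)) p.1 :=
    ((((hasDerivAt_id p.1).mul_const (p.2 ^ 2)).div_const 2).const_mul (-1 : ℝ))
  have h2 := (h3.ofReal_comp.const_mul Complex.I).cexp
  have := h1.unique h2
  rw [this]
  simp only [ph]; push_cast; ring

lemma dy_ph (p : ℝ × ℝ) : dy (ph (-1)) p = -(Complex.I * ((p.1 * p.2 : ℝ) : ℂ)) * ph (-1) p := by
  have h1 := hasDerivAt_dy (ph_c1 (-1)) p.1 p.2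
  have h3 : HasDerivAt (fun t : ℝ => (-1) * (p.1 * t ^ 2 / 2)) ((-1) * (p.1 * (((2:ℕ):ℝ) * p.2 ^ (2 - 1)) / 2)) p.2 :=
    ((((hasDerivAt_pow 2 p.2).const_mul p.1).div_const 2).const_mul (-1 : ℝ))
  have h2 := (h3.ofReal_comp.const_mul Complex.I).cexp
  have := h1.unique h2
  rw [this]
  simp only [ph]; push_cast; ring

lemma gauge_grad {v : ℝ × ℝ → ℂ} (hv : ContDiff ℝ 1 v) (p : ℝ × ℝ) :
    magGradSq Avan (fun q => ph (-1) q * v q) p = gsq v p := by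
  have a1 := dx_mul (c1d (ph_c1 (-1)) p) (c1d hv p)
  have a2 := dy_mul (c1d (ph_c1 (-1)) p) (c1d hv p)
  rw [dx_ph] at a1
  rw [dy_ph] at a2
  have e1 : dx (fun q => ph (-1) q * v q) p - Complex.I * ((Avan p).1 : ℂ) * (ph (-1) p * v p) = ph (-1) p * dx v p := by
    rw [a1]; simp only [Avan]; push_cast; ring
  have e2 : dy (fun q => ph (-1) q * v q) p - Complex.I * ((Avan p).2 : ℂ) * (ph (-1) p * v p) = ph (-1) p * D2 v p := by
    rw [a2]; simp only [Avan, D2]; push_cast; ring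
  show ‖dx (fun q => ph (-1) q * v q) p - Complex.I * ((Avan p).1 : ℂ) * (ph (-1) p * v p)‖ ^ 2 +
    ‖dy (fun q => ph (-1) q * v q) p - Complex.I * ((Avan p).2 : ℂ) * (ph (-1) p * v p)‖ ^ 2 = _
  rw [e1, e2, norm_mul, norm_mul, ph_norm, one_mul, one_mul]
  rfl

lemma front (R : ℝ) (hR : 0 < R) (u : ℝ × ℝ → ℂ) :
    (∀ x ∈ frontier (Strip R), u x = 0) ↔ Bd R u := by
  unfold Strip Bd
  rw [frontier_prod_univ_eq, frontier_Ioo (by linarith)]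
  constructor
  · intro h y
    exact ⟨h _ ⟨by simp, trivial⟩, h _ ⟨by simp, trivial⟩⟩
  · rintro h ⟨x, y⟩ ⟨hx, _⟩
    rcases hx with hx | hx
    · have hx : x = -R/2 := hx
      rw [hx]; exact (h y).1
    · have hx : x = R/2 := hx
      rw [hx]; exact (h y).2

lemma gauge_mem {R : ℝ} (hR : 0 < R) {v : ℝ × ℝ → ℂ} (hv : ContDiff ℝ 1 v) :
    MemH1mag0 R (fun q => ph (-1) q * v q) ↔ Cls R v := by
  have e1 : magGradSq Avan (fun q => ph (-1) q * v q) = gsq v := funext (gauge_grad hv)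
  have e2 : ∀ q, ‖ph (-1) q * v q‖ = ‖v q‖ := fun q => by rw [norm_mul, ph_norm, one_mul]
  have e3 : Bd R (fun q => ph (-1) q * v q) ↔ Bd R v := by
    unfold Bd
    have : ∀ q, ph (-1) q * v q = 0 ↔ v q = 0 := fun q => by
      rw [← norm_eq_zero, e2, norm_eq_zero]
    simp_rw [this]
  unfold MemH1mag0
  rw [e1, front R hR, e3]
  simp_rw [e2]
  constructor
  · rintro ⟨_, h2, h3, h4, h5⟩
    exact ⟨hv, h5, h3, h2, h4⟩
  · rintro ⟨_, h2, h3, h4, h5⟩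
    exact ⟨(ph_c1 (-1)).mul hv, h4, h3, h5, h2⟩

lemma gauge_en {L R : ℝ} {v : ℝ × ℝ → ℂ} (hv : ContDiff ℝ 1 v) :
    Estrip L R (fun q => ph (-1) q * v q) = ∫ p, dens (L ^ (-(2:ℝ)/3)) v p ∂(mu R) := by
  unfold Estrip mu
  refine integral_congr_ae (Eventually.of_forall fun p => ?_)
  show stripDensity L (fun q => ph (-1) q * v q) p = dens (L ^ (-(2:ℝ)/3)) v p
  unfold stripDensity dens
  rw [gauge_grad hv]
  show _ - _ * ‖ph (-1) p * v p‖ ^ 2 + _ * ‖ph (-1) p * v p‖ ^ 4 = _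
  rw [norm_mul, ph_norm, one_mul]

lemma gauge_back {u : ℝ × ℝ → ℂ} (hu : ContDiff ℝ 1 u) :
    ∃ v, ContDiff ℝ 1 v ∧ u = fun q => ph (-1) q * v q :=
  ⟨fun q => ph 1 q * u q, (ph_c1 1).mul hu, funext fun q => by rw [← mul_assoc, ph_inv, one_mul]⟩

lemma zero_mem (R : ℝ) : MemH1mag0 R (fun _ => 0) := by
  have : magGradSq Avan (fun _ => 0) = fun _ => 0 := by funext x; simp [magGradSq]
  refine ⟨contDiff_const, ?_, ?_, ?_, fun _ _ => rfl⟩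
  · simp
  · rw [this]; simp
  · simp

end SM

/-- The infimum defining `e_gs(L;R)` is attained. -/
theorem strip_minimizer_exists (L R : ℝ) (hL : 0 < L) (hR : 0 < R) :
    ∃ φ : ℝ × ℝ → ℂ, MemH1mag0 R φ ∧ Estrip L R φ = egs L R := by
  by_cases hbd : BddBelow (Estrip L R '' {u | MemH1mag0 R u})
  · have hκ : 0 ≤ L ^ (-(2:ℝ)/3) := by positivity
    have hmin : ∀ u, MemH1mag0 R u → egs L R ≤ Estrip L R u := fun u hu =>
      csInf_le hbd ⟨u, hu, rfl⟩
    obtain ⟨φ, h1, h2⟩ := SM.main_cls (e := egs L R) hR hκ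
      (fun w hw => by
        rw [← SM.gauge_en hw.c1]
        exact hmin _ ((SM.gauge_mem hR hw.c1).2 hw))
      (fun ε hε => by
        have hne : (Estrip L R '' {u | MemH1mag0 R u}).Nonempty := ⟨_, _, SM.zero_mem R, rfl⟩
        obtain ⟨_, ⟨u, hu, rfl⟩, hlt⟩ := exists_lt_of_csInf_lt hne
          (show sInf (Estrip L R '' {u | MemH1mag0 R u}) < egs L R + ε from lt_add_of_pos_right _ hε)
        obtain ⟨v, hv, rfl⟩ := SM.gauge_back (show MemH1mag0 R u from hu).1
        exact ⟨v, (SM.gauge_mem hR hv).1 hu, by rw [← SM.gauge_en hv]; exact hlt⟩)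
    have hm := (SM.gauge_mem hR h1.c1).2 h1
    exact ⟨_, hm, le_antisymm (by rw [SM.gauge_en h1.c1]; exact h2) (hmin _ hm)⟩
  · refine ⟨fun _ => 0, SM.zero_mem R, ?_⟩
    unfold egs
    rw [Real.sInf_of_not_bddBelow hbd]
    unfold Estrip
    have : stripDensity L (fun _ => 0) = fun _ => 0 := by
      funext x; simp [stripDensity, magGradSq]
    rw [this]; simp

end
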